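/- Let f:(R,m) → (S,n) be a flat local homomorphism of noetherian local rings, where both R and S are complete with respect to their maximal-ideal-adic topologies and the closed fiber S/mS is a regular local ring, and let M be a finitely generated S-module. Then Gfd_S(M) ≤ Gfd_R(M) + edim(S) − edim(R). -/

import Mathlib

/- ## Preliminary definitions -/

universe u

open IsLocalRing

noncomputable section

/-- The embedding dimension of a local ring: `dim_k (m/m²)`. -/
def embDim (R : Type u) [CommRing R] [IsLocalRing R] : ℕ :=
  Module.finrank (ResidueField R) (CotangentSpace R)

/-- Witness that `Q` is a Gorenstein flat `R`-module: a two-sided exact complex `F` of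
flat modules, which stays exact after applying `I ⊗ᵣ -` for every injective module `I`,
with `Q` isomorphic to the image of the differential `F₁ → F₀`. -/
structure GorensteinFlatWitness (R : Type u) [CommRing R] (Q : Type u) [AddCommGroup Q]
    [Module R Q] where
  F : ℤ → Type u
  [instAdd : ∀ i, AddCommGroup (F i)]
  [instMod : ∀ i, Module R (F i)]
  d : (i : ℤ) → F (i + 1) →ₗ[R] F i
  flat : ∀ i, Module.Flat R (F i)
  exact : ∀ i : ℤ, Function.Exact (d (i + 1)) (d i)
  exact_tensor : ∀ (I : Type u) [AddCommGroup I] [Module R I], Module.Injective R I →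
    ∀ i : ℤ, Function.Exact (LinearMap.lTensor I (d (i + 1))) (LinearMap.lTensor I (d i))
  iso : Nonempty (Q ≃ₗ[R] LinearMap.range (d 0))

/-- `Q` is a Gorenstein flat `R`-module. -/
def IsGorensteinFlat (R : Type u) [CommRing R] (Q : Type u) [AddCommGroup Q]
    [Module R Q] : Prop :=
  Nonempty (GorensteinFlatWitness R Q)

/-- Witness that `J` is a Gorenstein injective `R`-module: a two-sided exact complex `I` of
injective modules, which stays exact after applying `Hom_R(E, -)` for every injective module
`E`, with `J` isomorphic to the image of the differential `I₁ → I₀`. -/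
structure GorensteinInjectiveWitness (R : Type u) [CommRing R] (J : Type u) [AddCommGroup J]
    [Module R J] where
  I : ℤ → Type u
  [instAdd : ∀ i, AddCommGroup (I i)]
  [instMod : ∀ i, Module R (I i)]
  d : (i : ℤ) → I (i + 1) →ₗ[R] I i
  injective : ∀ i, Module.Injective R (I i)
  exact : ∀ i : ℤ, Function.Exact (d (i + 1)) (d i)
  exact_hom : ∀ (E : Type u) [AddCommGroup E] [Module R E], Module.Injective R E →
    ∀ i : ℤ, Function.Exact (LinearMap.llcomp (σ₁₂ := RingHom.id R) R E (I (i + 1 + 1)) (I (i + 1)) (d (i + 1)))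
      (LinearMap.llcomp (σ₁₂ := RingHom.id R) R E (I (i + 1)) (I i) (d i))
  iso : Nonempty (J ≃ₗ[R] LinearMap.range (d 0))

/-- `J` is a Gorenstein injective `R`-module. -/
def IsGorensteinInjective (R : Type u) [CommRing R] (J : Type u) [AddCommGroup J]
    [Module R J] : Prop :=
  Nonempty (GorensteinInjectiveWitness R J)

/-- A surjection onto `M` whose source is Gorenstein flat. -/
structure GorensteinFlatCover (R : Type u) [CommRing R] (M : Type u) [AddCommGroup M]
    [Module R M] where
  Q : Type u
  [instAdd : AddCommGroup Q]
  [instMod : Module R Q]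
  π : Q →ₗ[R] M
  gflat : IsGorensteinFlat R Q
  surj : Function.Surjective π

attribute [instance] GorensteinFlatCover.instAdd GorensteinFlatCover.instMod

/-- `M` admits an exact sequence `0 → Qₙ → ⋯ → Q₀ → M → 0` with all `Qᵢ` Gorenstein flat;
equivalently (by splicing), defined by recursion on `n`. -/
def gfdLE (R : Type u) [CommRing R] :
    (n : ℕ) → (M : Type u) → [AddCommGroup M] → [Module R M] → Prop
  | 0, M, _, _ => IsGorensteinFlat R M
  | n + 1, M, _, _ => ∃ c : GorensteinFlatCover R M, gfdLE R n (LinearMap.ker c.π)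

/-- The Gorenstein flat dimension of `M` over `R`, as an element of `ℕ∞`
(the zero module has Gorenstein flat dimension `0` here, and `⊤` means infinite). -/
def gfd (R : Type u) [CommRing R] (M : Type u) [AddCommGroup M] [Module R M] : ℕ∞ :=
  sInf ((↑) '' { n : ℕ | gfdLE R n M })

/-- A flat cover of `M`. -/
structure FlatCover (R : Type u) [CommRing R] (M : Type u) [AddCommGroup M]
    [Module R M] where
  Q : Type u
  [instAdd : AddCommGroup Q]
  [instMod : Module R Q]
  π : Q →ₗ[R] M
  flat : Module.Flat R Q
  surj : Function.Surjective π

attribute [instance] FlatCover.instAdd FlatCover.instMod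

/-- `M` admits a flat resolution of length `≤ n`. -/
def fdLE (R : Type u) [CommRing R] :
    (n : ℕ) → (M : Type u) → [AddCommGroup M] → [Module R M] → Prop
  | 0, M, _, _ => Module.Flat R M
  | n + 1, M, _, _ => ∃ c : FlatCover R M, fdLE R n (LinearMap.ker c.π)

/-- The flat dimension of `M` over `R`, as an element of `ℕ∞`. -/
def flatDim (R : Type u) [CommRing R] (M : Type u) [AddCommGroup M] [Module R M] : ℕ∞ :=
  sInf ((↑) '' { n : ℕ | fdLE R n M })

/-- An embedding of `M` into a Gorenstein injective module. -/
structure GorensteinInjectiveHull (R : Type u) [CommRing R] (M : Type u) [AddCommGroup M]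
    [Module R M] where
  J : Type u
  [instAdd : AddCommGroup J]
  [instMod : Module R J]
  ι : M →ₗ[R] J
  ginj : IsGorensteinInjective R J
  inj : Function.Injective ι

attribute [instance] GorensteinInjectiveHull.instAdd GorensteinInjectiveHull.instMod

/-- `M` admits an exact sequence `0 → M → J₀ → ⋯ → J₋ₙ → 0` with all `Jᵢ`
Gorenstein injective. -/
def gidLE (R : Type u) [CommRing R] :
    (n : ℕ) → (M : Type u) → [AddCommGroup M] → [Module R M] → Prop
  | 0, M, _, _ => IsGorensteinInjective R M
  | n + 1, M, _, _ => ∃ c : GorensteinInjectiveHull R M,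
      gidLE R n (c.J ⧸ LinearMap.range c.ι)

/-- The Gorenstein injective dimension of `M` over `R`, as an element of `ℕ∞`. -/
def gid (R : Type u) [CommRing R] (M : Type u) [AddCommGroup M] [Module R M] : ℕ∞ :=
  sInf ((↑) '' { n : ℕ | gidLE R n M })

/-- An embedding of `M` into an injective module. -/
structure InjectiveHullStep (R : Type u) [CommRing R] (M : Type u) [AddCommGroup M]
    [Module R M] where
  J : Type u
  [instAdd : AddCommGroup J]
  [instMod : Module R J]
  ι : M →ₗ[R] J
  injective : Module.Injective R J
  inj : Function.Injective ι

attribute [instance] InjectiveHullStep.instAdd InjectiveHullStep.instMod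

/-- `M` admits an injective resolution of length `≤ n`. -/
def idLE (R : Type u) [CommRing R] :
    (n : ℕ) → (M : Type u) → [AddCommGroup M] → [Module R M] → Prop
  | 0, M, _, _ => Module.Injective R M
  | n + 1, M, _, _ => ∃ c : InjectiveHullStep R M, idLE R n (c.J ⧸ LinearMap.range c.ι)

/-- The injective dimension of `M` over `R`, as an element of `ℕ∞`. -/
def injDim (R : Type u) [CommRing R] (M : Type u) [AddCommGroup M] [Module R M] : ℕ∞ :=
  sInf ((↑) '' { n : ℕ | idLE R n M })

/-- The `i`-th Ext module `Ext_R^i(N, M)`. -/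
def extModule (R : Type u) [CommRing R] (i : ℕ) (N M : Type u) [AddCommGroup N] [Module R N]
    [AddCommGroup M] [Module R M] : ModuleCat.{u} R :=
  ((Ext R (ModuleCat.{u} R) i).obj (Opposite.op (ModuleCat.of R N))).obj (ModuleCat.of R M)

/-- The depth of `M` with respect to the ideal `I`: the least `i` such that
`Ext_R^i(R/I, M) ≠ 0` (with value `⊤ : ℕ∞` if no such `i` exists). -/
def idealDepth (R : Type u) [CommRing R] (I : Ideal R) (M : Type u) [AddCommGroup M]
    [Module R M] : ℕ∞ :=
  sInf ((↑) '' { i : ℕ | ¬ Subsingleton (extModule R i (R ⧸ I) M) })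

/-- A finitely generated `S`-module `M` is totally reflexive if the biduality map
`M → Hom_S(Hom_S(M,S),S)` is bijective and `Ext_S^i(M,S) = 0 = Ext_S^i(M^*,S)`
for all `i ≥ 1`. -/
def IsTotallyReflexive (S : Type u) [CommRing S] (M : Type u) [AddCommGroup M]
    [Module S M] : Prop :=
  Module.Finite S M ∧ Function.Bijective (Module.Dual.eval S M) ∧
    ∀ i : ℕ, 1 ≤ i → Subsingleton (extModule S i M S) ∧
      Subsingleton (extModule S i (Module.Dual S M) S)

/-- A noetherian local ring is G-regular if every totally reflexive module is free. -/
def IsGRegular (S : Type u) [CommRing S] : Prop :=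
  ∀ (M : Type u) [AddCommGroup M] [Module S M], IsTotallyReflexive S M → Module.Free S M

/-- A commutative ring is a regular local ring if it is a noetherian local ring whose
maximal ideal is generated by a regular sequence. -/
def IsRegularLocal (A : Type u) [CommRing A] : Prop :=
  IsNoetherianRing A ∧ ∃ h : IsLocalRing A, ∃ rs : List A,
    RingTheory.Sequence.IsRegular A rs ∧
      Ideal.span { x | x ∈ rs } = @IsLocalRing.maximalIdeal A _ h

/-- A Gorenstein local ring: a noetherian local ring of finite self-injective dimension. -/
def IsGorensteinLocal (A : Type u) [CommRing A] : Prop :=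
  IsNoetherianRing A ∧ IsLocalRing A ∧ injDim A A < ⊤

/-- `E` is an injective envelope (injective hull) of the residue field of the local
ring `S`: an injective module containing the residue field as an essential submodule. -/
def IsInjEnvResidueField (S : Type u) [CommRing S] [IsLocalRing S] (E : Type u)
    [AddCommGroup E] [Module S E] : Prop :=
  Module.Injective S E ∧ ∃ ι : ResidueField S →ₗ[S] E, Function.Injective ι ∧
    ∀ N : Submodule S E, N ≠ ⊥ → N ⊓ LinearMap.range ι ≠ ⊥

end
/- ## Homological dimensions along a ring homomorphism -/

noncomputable section

variable {R S : Type u} [CommRing R] [CommRing S]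

/-- The flat dimension `fd_R S` of `S` as an `R`-module along `f : R → S`. -/
def flatDimAlong (f : R →+* S) : ℕ∞ :=
  letI := f.toModule; flatDim R S

/-- The Gorenstein flat dimension over `R` of an `S`-module `M`, viewed as an
`R`-module along `f : R → S`. -/
def gfdAlong (f : R →+* S) (M : Type u) [AddCommGroup M] [Module S M] : ℕ∞ :=
  letI := Module.compHom M f; gfd R M

/-- The Gorenstein injective dimension over `R` of an `S`-module `M`, viewed as an
`R`-module along `f : R → S`. -/
def gidAlong (f : R →+* S) (M : Type u) [AddCommGroup M] [Module S M] : ℕ∞ :=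
  letI := Module.compHom M f; gid R M

/-- `M` is Gorenstein flat as an `R`-module along `f : R → S`. -/
def IsGorensteinFlatAlong (f : R →+* S) (M : Type u) [AddCommGroup M] [Module S M] : Prop :=
  letI := Module.compHom M f; IsGorensteinFlat R M

/-- `M` is Gorenstein injective as an `R`-module along `f : R → S`. -/
def IsGorensteinInjectiveAlong (f : R →+* S) (M : Type u) [AddCommGroup M]
    [Module S M] : Prop :=
  letI := Module.compHom M f; IsGorensteinInjective R M

end

section

open TensorProduct

/-- Extension of linear maps along injections into an injective module. -/
theorem inj_ext {R : Type u} [CommRing R] {X Y J : Type u} [AddCommGroup X] [Module R X]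
    [AddCommGroup Y] [Module R Y] [AddCommGroup J] [Module R J] (hJ : Module.Injective R J)
    (i : X →ₗ[R] Y) (hi : Function.Injective i) (g : X →ₗ[R] J) :
    ∃ h : Y →ₗ[R] J, ∀ x, h (i x) = g x :=
  hJ.out i hi g

/-- If `g` kills the kernel of `p`, then `g` factors through `p`. -/
theorem inj_factor {R : Type u} [CommRing R] {X Y J : Type u} [AddCommGroup X] [Module R X]
    [AddCommGroup Y] [Module R Y] [AddCommGroup J] [Module R J] (hJ : Module.Injective R J)
    (p : X →ₗ[R] Y) (g : X →ₗ[R] J) (hg : ∀ x, p x = 0 → g x = 0) :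
    ∃ h : Y →ₗ[R] J, ∀ x, h (p x) = g x := by
  obtain ⟨h, hh⟩ := inj_ext hJ ((LinearMap.ker p).liftQ p le_rfl)
    (by rw [← LinearMap.ker_eq_bot]; exact Submodule.ker_liftQ_eq_bot _ _ _ le_rfl)
    ((LinearMap.ker p).liftQ g (fun x hx => hg x hx))
  exact ⟨h, fun x => hh (Submodule.Quotient.mk x)⟩

/-- Every module embeds in an injective one. -/
theorem exists_injective_embedding (R : Type u) [CommRing R] (X : Type u) [AddCommGroup X]
    [Module R X] : ∃ (J : Type u) (_ : AddCommGroup J) (_ : Module R J) (i : X →ₗ[R] J),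
      Module.Injective R J ∧ Function.Injective i := by
  let J := CategoryTheory.Injective.under (ModuleCat.of R X)
  let i : ModuleCat.of R X ⟶ J := CategoryTheory.Injective.ι _
  refine ⟨J, inferInstance, inferInstance, i.hom, ?_, ?_⟩
  · haveI : CategoryTheory.Injective (ModuleCat.of R J) :=
      CategoryTheory.Injective.injective_under _
    exact Module.injective_module_of_injective_object R J
  · exact (ModuleCat.mono_iff_injective i).mp inferInstance

/-- `E` is an injective hull of the residue field, with socle generated by `e₀`. -/
structure IsMatlis (R : Type u) [CommRing R] [IsLocalRing R] (E : Type u) [AddCommGroup E]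
    [Module R E] (e₀ : E) : Prop where
  inj : Module.Injective R E
  ne : e₀ ≠ 0
  soc : ∀ a ∈ maximalIdeal R, a • e₀ = 0
  ess : ∀ e : E, e ≠ 0 → ∃ r : R, r • e = e₀

theorem exists_isMatlis (R : Type u) [CommRing R] [IsLocalRing R] :
    ∃ (E : Type u) (_ : AddCommGroup E) (_ : Module R E) (e₀ : E), IsMatlis R E e₀ := by
  obtain ⟨J, _, _, i, hJ, hi⟩ := exists_injective_embedding R (ResidueField R)
  set e₀ : J := i 1 with he₀
  have hne : e₀ ≠ 0 := by
    intro h; exact one_ne_zero (hi (by rw [← he₀, h, map_zero]))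
  have hsoc : ∀ a ∈ maximalIdeal R, a • e₀ = 0 := by
    intro a ha
    rw [he₀, ← map_smul, Algebra.smul_def, mul_one]
    rw [show algebraMap R (ResidueField R) a = residue R a from rfl, (residue_eq_zero_iff a).2 ha,
      map_zero]
  have hspan : ∀ e ∈ Submodule.span R {e₀}, e ≠ 0 → ∃ r : R, r • e = e₀ := by
    intro e he h
    obtain ⟨r, rfl⟩ := Submodule.mem_span_singleton.1 he
    have hr : IsUnit r := by
      by_contra hr
      exact h (hsoc r ((mem_maximalIdeal r).2 hr))
    obtain ⟨v, rfl⟩ := hr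
    exact ⟨(v⁻¹ : Rˣ), by rw [smul_smul]; simp⟩
  -- maximal essential extension
  obtain ⟨E, -, hE⟩ := zorn_le_nonempty₀
    {E : Submodule R J | ∀ e ∈ E, e ≠ 0 → ∃ r : R, r • e = e₀} (by
      intro c hc hch y hy
      refine ⟨sSup c, ?_, fun z hz => le_sSup hz⟩
      intro e he
      rw [Submodule.mem_sSup_of_directed ⟨y, hy⟩ hch.directedOn] at he
      obtain ⟨z, hz, hez⟩ := he
      exact hc hz e hez) (Submodule.span R {e₀}) hspan
  have hEess := hE.prop
  obtain ⟨K, -, hK⟩ := zorn_le_nonempty₀ {K : Submodule R J | Disjoint K E} (by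
      intro c hc hch y hy
      refine ⟨sSup c, ?_, fun z hz => le_sSup hz⟩
      show Disjoint _ _
      rw [Submodule.disjoint_def]
      intro e he heE
      rw [Submodule.mem_sSup_of_directed ⟨y, hy⟩ hch.directedOn] at he
      obtain ⟨z, hz, hez⟩ := he
      exact Submodule.disjoint_def.1 (hc hz) e hez heE) ⊥ (by
        show Disjoint _ _
        exact disjoint_bot_left)
  have hKd : Disjoint K E := hK.prop
  rw [Submodule.disjoint_def] at hKd
  -- extend the inverse of `E → J/K`
  obtain ⟨g, hg⟩ := inj_ext hJ (K.mkQ ∘ₗ E.subtype) (by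
    rw [injective_iff_map_eq_zero]
    intro e he
    have : (e : J) ∈ K := by simpa using he
    exact Subtype.ext (hKd _ this e.2)) E.subtype
  have hg' : ∀ e ∈ E, g (K.mkQ e) = e := fun e he => hg ⟨e, he⟩
  -- every nonzero element of `J/K` has a nonzero multiple in `E`
  have hess : ∀ y : J, y ∉ K → ∃ r : R, ∃ e ∈ E, e ≠ 0 ∧ K.mkQ (r • y) = K.mkQ e := by
    intro y hy
    by_contra! hcon
    have hd : Disjoint (K ⊔ Submodule.span R {y}) E := by
      rw [Submodule.disjoint_def]
      intro e he heE
      obtain ⟨k, hk, z, hz, rfl⟩ := Submodule.mem_sup.1 he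
      obtain ⟨r, rfl⟩ := Submodule.mem_span_singleton.1 hz
      by_contra h
      exact hcon r _ heE h (by simp [hk])
    exact hy (hK.le_of_ge hd le_sup_left
      (Submodule.mem_sup_right (Submodule.mem_span_singleton_self y)))
  have hrange : LinearMap.range (g ∘ₗ K.mkQ) ≤ E := by
    refine hE.le_of_ge ?_ (fun e he => ⟨e, hg' e he⟩)
    rintro _ ⟨y, rfl⟩ hy
    have hyK : y ∉ K := by
      intro h
      apply hy
      simp [(Submodule.Quotient.mk_eq_zero K).2 h]
    obtain ⟨r, e, he, hne', h⟩ := hess y hyK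
    obtain ⟨s, hs⟩ := hEess e he hne'
    refine ⟨s * r, ?_⟩
    rw [mul_smul, ← map_smul, LinearMap.comp_apply, h, hg' e he, hs]
  let π : J →ₗ[R] E := (g ∘ₗ K.mkQ).codRestrict E (fun y => hrange ⟨y, rfl⟩)
  have he₀E : e₀ ∈ E := by
    by_contra h
    have : E ≠ ⊥ := by
      rintro rfl
      have := hE.le_of_ge (y := Submodule.span R {e₀}) hspan bot_le
      exact h (this (Submodule.mem_span_singleton_self _))
    obtain ⟨e, he, hne'⟩ := Submodule.exists_mem_ne_zero_of_ne_bot this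
    obtain ⟨s, hs⟩ := hEess e he hne'
    exact h (hs ▸ E.smul_mem s he)
  refine ⟨E, inferInstance, inferInstance, ⟨e₀, he₀E⟩, ⟨?_, ?_, ?_, ?_⟩⟩
  · refine ⟨fun X Y _ _ _ _ f hf q => ?_⟩
    obtain ⟨h, hh⟩ := inj_ext hJ f hf (E.subtype ∘ₗ q)
    refine ⟨π ∘ₗ h, fun x => Subtype.ext ?_⟩
    show g (K.mkQ (h (f x))) = _
    rw [hh x]
    exact hg' _ (q x).2
  · intro h; exact hne (congrArg Subtype.val h)
  · intro a ha; exact Subtype.ext (hsoc a ha)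
  · intro e he
    obtain ⟨r, hr⟩ := hEess e e.2 (fun h => he (Subtype.ext h))
    exact ⟨r, Subtype.ext hr⟩

namespace IsMatlis

variable {R : Type u} [CommRing R] [IsLocalRing R] {E : Type u} [AddCommGroup E]
    [Module R E] {e₀ : E}

theorem exists_smul_eq (h : IsMatlis R E e₀) (e : E) (he : ∀ a ∈ maximalIdeal R, a • e = 0) :
    ∃ r : R, e = r • e₀ := by
  by_cases h0 : e = 0
  · exact ⟨0, by simp [h0]⟩
  obtain ⟨r, hr⟩ := h.ess e h0
  have hu : IsUnit r := by
    by_contra hu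
    exact h.ne (by rw [← hr, he r ((mem_maximalIdeal r).2 hu)])
  obtain ⟨v, rfl⟩ := hu
  exact ⟨(v⁻¹ : Rˣ), by rw [← hr, smul_smul]; simp⟩

theorem torsion [IsNoetherianRing R] (h : IsMatlis R E e₀) (e : E) :
    ∃ k : ℕ, ∀ a ∈ maximalIdeal R ^ k, a • e = 0 := by
  by_contra! hcon
  have hmem : ∀ k : ℕ, ∃ b ∈ maximalIdeal R ^ k, b • e = e₀ := by
    intro k
    obtain ⟨a, ha, hae⟩ := hcon k
    obtain ⟨r, hr⟩ := h.ess _ hae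
    exact ⟨r * a, Ideal.mul_mem_left _ _ ha, by rw [mul_smul, hr]⟩
  obtain ⟨b0, -, hb0⟩ := hmem 0
  let N := Submodule.span R {e}
  have := Ideal.iInf_pow_smul_eq_bot_of_isLocalRing (R := R) (M := N) (maximalIdeal R)
    (Ideal.IsPrime.ne_top inferInstance)
  let z : N := ⟨e₀, hb0 ▸ N.smul_mem _ (Submodule.mem_span_singleton_self e)⟩
  have hz : z ∈ (⨅ k : ℕ, maximalIdeal R ^ k • (⊤ : Submodule R N)) := by
    rw [Submodule.mem_iInf]
    intro k
    obtain ⟨b, hb, hbe⟩ := hmem k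
    have : z = b • (⟨e, Submodule.mem_span_singleton_self e⟩ : N) := Subtype.ext hbe.symm
    rw [this]
    exact Submodule.smul_mem_smul hb trivial
  rw [this] at hz
  exact h.ne (congrArg Subtype.val ((Submodule.mem_bot R).1 hz))

/-- `E` is a cogenerator. -/
theorem exists_ne_zero (h : IsMatlis R E e₀) {X : Type u} [AddCommGroup X] [Module R X]
    (x : X) (hx : x ≠ 0) : ∃ φ : X →ₗ[R] E, φ x ≠ 0 := by
  have hle : LinearMap.ker (LinearMap.toSpanSingleton R X x) ≤ maximalIdeal R := by
    apply le_maximalIdeal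
    intro ht
    apply hx
    have : (1 : R) ∈ LinearMap.ker (LinearMap.toSpanSingleton R X x) := ht ▸ trivial
    simpa using this
  obtain ⟨φ, hφ⟩ := inj_factor h.inj (LinearMap.toSpanSingleton R X x)
    (LinearMap.toSpanSingleton R E e₀) (fun r hr => h.soc r (hle hr))
  refine ⟨φ, ?_⟩
  have := hφ 1
  simp only [LinearMap.toSpanSingleton_apply, one_smul] at this
  rw [this]
  exact h.ne

/-- Separation of a point from a submodule. -/
theorem exists_separating (h : IsMatlis R E e₀) {X : Type u} [AddCommGroup X] [Module R X]
    (N : Submodule R X) (x : X) (hx : x ∉ N) :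
    ∃ φ : X →ₗ[R] E, (∀ y ∈ N, φ y = 0) ∧ φ x ≠ 0 := by
  obtain ⟨φ, hφ⟩ := h.exists_ne_zero (N.mkQ x) (by simpa using hx)
  refine ⟨φ ∘ₗ N.mkQ, fun y hy => ?_, hφ⟩
  simp [(Submodule.Quotient.mk_eq_zero N).2 hy]

end IsMatlis

section Common

variable {R : Type u} [CommRing R] [IsNoetherianRing R]

/-- Criterion for the vanishing of a tensor whose right factors are homomorphisms into an
injective module. -/
theorem sum_tmul_eq_zero_of_injective {X I J : Type u} [AddCommGroup X] [Module R X]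
    [AddCommGroup I] [Module R I] [AddCommGroup J] [Module R J] (hJ : Module.Injective R J)
    {r : ℕ} (e : Fin r → X) (φ : Fin r → I →ₗ[R] J)
    (h : ∀ y : Fin r → I, (∀ c : Fin r → R, ∑ i, c i • e i = 0 → ∑ i, c i • y i = 0) →
      ∑ i, φ i (y i) = 0) :
    ∑ i, e i ⊗ₜ[R] φ i = 0 := by
  classical
  let N : Submodule R (Fin r → R) := LinearMap.ker (Fintype.linearCombination R e)
  obtain ⟨s, c, hc⟩ := Submodule.fg_iff_exists_fin_generating_family.1
    (IsNoetherian.noetherian N)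
  have hcN : ∀ j, ∑ i, c j i • e i = 0 := by
    intro j
    have : c j ∈ N := hc ▸ Submodule.subset_span ⟨j, rfl⟩
    simpa [N, Fintype.linearCombination_apply] using this
  let p : (Fin r → I) →ₗ[R] (Fin s → I) :=
    LinearMap.pi fun j => ∑ i, c j i • LinearMap.proj i
  let g : (Fin r → I) →ₗ[R] J := ∑ i, φ i ∘ₗ LinearMap.proj i
  obtain ⟨ψ, hψ⟩ := inj_factor hJ p g (by
    intro y hy
    have := h y (by
      intro d hd
      have hdN : d ∈ Submodule.span R (Set.range c) := by
        rw [hc]; simpa [N, Fintype.linearCombination_apply] using hd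
      induction hdN using Submodule.span_induction with
      | mem d hd' =>
        obtain ⟨j, rfl⟩ := hd'
        simpa [p] using congrFun hy j
      | zero => simp
      | add a b ha hb h1 h2 =>
        have ha' : a ∈ N := hc ▸ ha
        have hb' : b ∈ N := hc ▸ hb
        simp only [Pi.add_apply, add_smul, Finset.sum_add_distrib]
        rw [h1 (by simpa [N, Fintype.linearCombination_apply] using ha'),
          h2 (by simpa [N, Fintype.linearCombination_apply] using hb'), add_zero]
      | smul t a ha h1 =>
        have ha' : a ∈ N := hc ▸ ha
        simp only [Pi.smul_apply, smul_assoc, ← Finset.smul_sum]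
        rw [h1 (by simpa [N, Fintype.linearCombination_apply] using ha'), smul_zero])
    simpa [g] using this)
  have hφ : ∀ i, φ i = ∑ j, c j i • (ψ ∘ₗ LinearMap.single R (fun _ : Fin s => I) j) := by
    intro i
    ext x
    have h1 := hψ (Pi.single i x)
    have h2 : g (Pi.single i x) = φ i x := by
      simp only [g, LinearMap.sum_apply, LinearMap.comp_apply, LinearMap.proj_apply]
      rw [Finset.sum_eq_single i]
      · simp
      · intro j _ hj; simp [Pi.single_eq_of_ne hj]
      · simp
    rw [← h2, ← h1]
    have h3 : p (Pi.single i x) = ∑ j, c j i • Pi.single j x := by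
      ext k
      simp [p, Finset.sum_apply, Pi.single_apply]
    rw [h3, map_sum]
    simp
  simp_rw [hφ, tmul_sum, tmul_smul, smul_tmul']
  rw [Finset.sum_comm]
  simp_rw [← sum_tmul, hcN, zero_tmul, Finset.sum_const_zero]

theorem flat_hom_of_injective {I J : Type u} [AddCommGroup I] [Module R I] [AddCommGroup J]
    [Module R J] (hI : Module.Injective R I) (hJ : Module.Injective R J) :
    Module.Flat R (I →ₗ[R] J) := by
  rw [Module.Flat.iff_rTensor_injective']
  intro 𝔞
  rw [injective_iff_map_eq_zero]
  intro w hw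
  obtain ⟨r, a, φ, rfl⟩ := TensorProduct.exists_sum_tmul_eq w
  apply sum_tmul_eq_zero_of_injective hJ
  intro y hy
  -- `y i = a i • z`
  obtain ⟨z, hz⟩ := inj_factor hI (Fintype.linearCombination R (fun i => (a i : R)))
    (Fintype.linearCombination R y) (by
      intro c hc
      rw [Fintype.linearCombination_apply] at hc ⊢
      apply hy
      apply Subtype.ext
      simpa using hc)
  have hyz : ∀ i, y i = (a i : R) • z 1 := by
    classical
    intro i
    have := hz (Pi.single i 1)
    simp only [Fintype.linearCombination_apply_single, one_smul] at this
    rw [← this, ← map_smul]; simp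
  have hw' : (∑ i, (a i : R) • φ i) = 0 := by
    have := congrArg (TensorProduct.lid R _) hw
    simpa using this
  have := congrArg (fun ψ => ψ (z 1)) hw'
  simp only [LinearMap.sum_apply, LinearMap.smul_apply, LinearMap.zero_apply] at this
  rw [← this]
  exact Finset.sum_congr rfl fun i _ => by rw [hyz i, map_smul]

theorem injective_hom_of_flat {F J : Type u} [AddCommGroup F] [Module R F] [AddCommGroup J]
    [Module R J] [Module.Flat R F] (hJ : Module.Injective R J) :
    Module.Injective R (F →ₗ[R] J) := by
  refine ⟨fun X Y _ _ _ _ f hf g => ?_⟩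
  obtain ⟨h, hh⟩ := inj_ext hJ (f.rTensor F)
    (Module.Flat.rTensor_preserves_injective_linearMap f hf)
    (TensorProduct.lift g)
  refine ⟨TensorProduct.curry h, fun x => ?_⟩
  ext y
  have := hh (x ⊗ₜ y)
  simpa using this

theorem injective_tensor_of_flat {F I : Type u} [AddCommGroup F] [Module R F] [AddCommGroup I]
    [Module R I] [Module.Flat R F] (hI : Module.Injective R I) :
    Module.Injective R (F ⊗[R] I) := by
  classical
  apply Module.Baer.injective
  intro 𝔞 g
  obtain ⟨r, a, ha⟩ := Submodule.fg_iff_exists_fin_generating_family.1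
    (IsNoetherian.noetherian 𝔞)
  have haI : ∀ i, a i ∈ 𝔞 := fun i => ha ▸ Submodule.subset_span ⟨i, rfl⟩
  let N : Submodule R (Fin r → R) := LinearMap.ker (Fintype.linearCombination R a)
  obtain ⟨s, c, hc⟩ := Submodule.fg_iff_exists_fin_generating_family.1
    (IsNoetherian.noetherian N)
  let p : (Fin r → I) →ₗ[R] (Fin s → I) :=
    LinearMap.pi fun j => ∑ i, c j i • LinearMap.proj i
  let q : I →ₗ[R] (Fin r → I) := LinearMap.pi fun i => a i • LinearMap.id
  have hex : Function.Exact q p := by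
    intro y
    constructor
    · intro hy
      obtain ⟨z, hz⟩ := inj_factor hI (Fintype.linearCombination R a)
        (Fintype.linearCombination R y) (by
          intro d hd
          have hdN : d ∈ Submodule.span R (Set.range c) := by rw [hc]; exact hd
          clear hd
          induction hdN using Submodule.span_induction with
          | mem d hd' =>
            obtain ⟨j, rfl⟩ := hd'
            simpa [p, Fintype.linearCombination_apply] using congrFun hy j
          | zero => simp
          | add a b ha hb h1 h2 => rw [map_add, h1, h2, add_zero]
          | smul t a ha h1 => rw [map_smul, h1, smul_zero])
      refine ⟨z 1, ?_⟩
      ext i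
      have := hz (Pi.single i 1)
      simp only [Fintype.linearCombination_apply_single, one_smul] at this
      rw [← this]
      show a i • z 1 = _
      rw [← map_smul]; simp
    · rintro ⟨z, rfl⟩
      ext j
      have : c j ∈ N := hc ▸ Submodule.subset_span ⟨j, rfl⟩
      have : ∑ i, c j i * a i = 0 := by
        simpa [N, Fintype.linearCombination_apply] using this
      simp only [p, q, LinearMap.pi_apply, LinearMap.sum_apply, LinearMap.smul_apply,
        LinearMap.proj_apply, LinearMap.id_apply, smul_smul, ← Finset.sum_smul, this, zero_smul,
        Pi.zero_apply]
  have hexT := Module.Flat.lTensor_exact F hex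
  let w : Fin r → F ⊗[R] I := fun i => g ⟨a i, haI i⟩
  let e1 := TensorProduct.piRight R R F (fun _ : Fin r => I)
  let e2 := TensorProduct.piRight R R F (fun _ : Fin s => I)
  have hcomm : ∀ v j, e2 (p.lTensor F v) j = ∑ i, c j i • e1 v i := by
    intro v j
    induction v with
    | zero => simp
    | tmul x y => simp [e1, e2, p, tmul_sum]
    | add a b h1 h2 => simp only [map_add, Pi.add_apply, h1, h2, smul_add, Finset.sum_add_distrib]
  have hcomm' : ∀ v i, e1 (q.lTensor F v) i = a i • v := by
    intro v i
    induction v with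
    | zero => simp
    | tmul x y => simp [e1, q]
    | add a b h1 h2 => simp only [map_add, Pi.add_apply, h1, h2, smul_add]
  obtain ⟨v, hv⟩ := (hexT (e1.symm w)).1 (by
    apply e2.injective
    ext j
    rw [hcomm, map_zero]
    simp only [LinearEquiv.apply_symm_apply, w, ← map_smul, ← map_sum, Pi.zero_apply]
    convert map_zero g
    apply Subtype.ext
    have : c j ∈ N := hc ▸ Submodule.subset_span ⟨j, rfl⟩
    simpa [N, Fintype.linearCombination_apply] using this)
  have hvw : ∀ i, g ⟨a i, haI i⟩ = a i • v := by
    intro i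
    rw [← hcomm', hv]
    simp [w]
  refine ⟨LinearMap.toSpanSingleton R _ v, ?_⟩
  intro x hx
  have hx' : x ∈ Submodule.span R (Set.range a) := by rw [ha]; exact hx
  rw [LinearMap.toSpanSingleton_apply]
  induction hx' using Submodule.span_induction with
  | mem d hd' =>
    obtain ⟨j, rfl⟩ := hd'
    exact (hvw j).symm
  | zero => rw [zero_smul]; exact (map_zero g).symm
  | add a b h1 h2 h3 h4 =>
    rw [ha] at h1 h2
    rw [add_smul, h3 h1, h4 h2, ← map_add]; rfl
  | smul t b h1 h2 =>
    rw [ha] at h1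
    rw [smul_assoc, h2 h1, ← map_smul]; rfl

end Common

namespace IsMatlis

variable {R : Type u} [CommRing R] [IsLocalRing R] [IsNoetherianRing R] {E : Type u}
    [AddCommGroup E] [Module R E] {e₀ : E}

/-- An endomorphism of `E` is a homothety on each `E[m^k]`. -/
theorem exists_homothety (h : IsMatlis R E e₀) (φ : E →ₗ[R] E) (k : ℕ) :
    ∃ r : R, ∀ e : E, (∀ a ∈ maximalIdeal R ^ k, a • e = 0) → φ e = r • e := by
  classical
  induction k with
  | zero =>
    refine ⟨0, fun e he => ?_⟩
    have : e = 0 := by simpa using he 1 (by simp)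
    simp [this]
  | succ k ih =>
    obtain ⟨r, hr⟩ := ih
    obtain ⟨s, g, hg⟩ := Submodule.fg_iff_exists_fin_generating_family.1
      (IsNoetherian.noetherian (maximalIdeal R ^ k))
    have hgm : ∀ i, g i ∈ maximalIdeal R ^ k := fun i => hg ▸ Submodule.subset_span ⟨i, rfl⟩
    let T : Submodule R E :=
      { carrier := {e | ∀ a ∈ maximalIdeal R ^ (k + 1), a • e = 0}
        add_mem' := fun {x y} hx hy a ha => by rw [smul_add, hx a ha, hy a ha, add_zero]
        zero_mem' := fun a _ => smul_zero a
        smul_mem' := fun c x hx a ha => by rw [smul_comm, hx a ha, smul_zero] }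
    let G : T →ₗ[R] (Fin s → E) := LinearMap.pi fun i => g i • T.subtype
    obtain ⟨θ, hθ⟩ := inj_factor h.inj G ((φ - r • LinearMap.id) ∘ₗ T.subtype) (by
      intro e he
      have : ∀ a ∈ maximalIdeal R ^ k, a • (e : E) = 0 := by
        intro a ha
        rw [← hg] at ha
        induction ha using Submodule.span_induction with
        | mem d hd =>
          obtain ⟨j, rfl⟩ := hd
          exact congrFun he j
        | zero => simp
        | add a b _ _ h1 h2 => rw [add_smul, h1, h2, add_zero]
        | smul t a _ h1 => rw [smul_assoc, h1, smul_zero]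
      simp [hr _ this])
    have hsoc : ∀ j : Fin s, ∃ c : R, θ (Pi.single j e₀) = c • e₀ := by
      intro j
      apply h.exists_smul_eq
      intro a ha
      rw [← map_smul, ← Pi.single_smul, h.soc a ha, Pi.single_zero, map_zero]
    choose c hc using hsoc
    refine ⟨r + ∑ j, c j * g j, fun e he => ?_⟩
    have h1 := hθ ⟨e, he⟩
    have hge : ∀ j, ∃ t : R, g j • e = t • e₀ := by
      intro j
      apply h.exists_smul_eq
      intro a ha
      rw [smul_smul, mul_comm]
      exact he _ (by rw [pow_succ]; exact Ideal.mul_mem_mul (hgm j) ha)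
    choose t ht using hge
    have h2 : θ (G ⟨e, he⟩) = (∑ j, c j * g j) • e := by
      have : G ⟨e, he⟩ = ∑ j, Pi.single j (t j • e₀) := by
        ext j
        simp [G, Finset.sum_apply, Pi.single_apply, ht]
      rw [this, map_sum, Finset.sum_smul]
      refine Finset.sum_congr rfl fun j _ => ?_
      rw [Pi.single_smul, map_smul, hc, mul_smul, ht, smul_comm]
    rw [add_smul, ← h2, h1]
    simp

/-- The double annihilator property of `E`. -/
theorem double_annihilator (h : IsMatlis R E e₀) {r : ℕ} (e y : Fin r → E)
    (hey : ∀ c : Fin r → R, ∑ i, c i • e i = 0 → ∑ i, c i • y i = 0) :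
    ∃ t : R, ∀ i, y i = t • e i := by
  classical
  by_contra! hcon
  have hy : y ∉ Submodule.span R {e} := by
    intro hy
    obtain ⟨t, rfl⟩ := Submodule.mem_span_singleton.1 hy
    obtain ⟨i, hi⟩ := hcon t
    exact hi rfl
  obtain ⟨φ, h1, h2⟩ := h.exists_separating _ y hy
  choose ke hke using fun i => h.torsion (e i)
  choose ky hky using fun i => h.torsion (y i)
  let K := (∑ i, ke i) + ∑ i, ky i
  choose c hc using fun i =>
    h.exists_homothety (φ ∘ₗ LinearMap.single R (fun _ : Fin r => E) i) K
  have hsum : ∀ z : Fin r → E, (∀ i, ∀ a ∈ maximalIdeal R ^ K, a • z i = 0) →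
      φ z = ∑ i, c i • z i := by
    intro z hz
    have : z = ∑ i, Pi.single i (z i) := by
      ext j; simp [Finset.sum_apply, Pi.single_apply]
    conv_lhs => rw [this, map_sum]
    exact Finset.sum_congr rfl fun i _ => hc i (z i) (hz i)
  have hle1 : ∀ i, maximalIdeal R ^ K ≤ maximalIdeal R ^ ke i := fun i =>
    Ideal.pow_le_pow_right ((Finset.single_le_sum (f := ke) (fun _ _ => Nat.zero_le _)
      (Finset.mem_univ i)).trans (Nat.le_add_right _ _))
  have hle2 : ∀ i, maximalIdeal R ^ K ≤ maximalIdeal R ^ ky i := fun i =>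
    Ideal.pow_le_pow_right ((Finset.single_le_sum (f := ky) (fun _ _ => Nat.zero_le _)
      (Finset.mem_univ i)).trans (Nat.le_add_left _ _))
  apply h2
  rw [hsum y fun i a ha => hky i a (hle2 i ha)]
  apply hey
  rw [← hsum e fun i a ha => hke i a (hle1 i ha)]
  exact h1 e (Submodule.mem_span_singleton_self e)

end IsMatlis

/-- Evaluation `E ⊗ Hom(F, Hom(E, E)) → Hom(F, E)`. -/
noncomputable def matlisEval (R : Type u) [CommRing R] (E F : Type u) [AddCommGroup E] [Module R E]
    [AddCommGroup F] [Module R F] :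
    E ⊗[R] (F →ₗ[R] E →ₗ[R] E) →ₗ[R] (F →ₗ[R] E) :=
  TensorProduct.lift
    { toFun := fun e => { toFun := fun φ => φ.flip e
                          map_add' := fun _ _ => rfl
                          map_smul' := fun _ _ => rfl }
      map_add' := fun x y => by ext φ z; exact (φ z).map_add x y
      map_smul' := fun c x => by ext φ z; exact (φ z).map_smul c x }

@[simp]
theorem matlisEval_tmul {R : Type u} [CommRing R] {E F : Type u} [AddCommGroup E]
    [Module R E] [AddCommGroup F] [Module R F] (e : E) (φ : F →ₗ[R] E →ₗ[R] E) (y : F) :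
    matlisEval R E F (e ⊗ₜ φ) y = φ y e := rfl

namespace IsMatlis

variable {R : Type u} [CommRing R] [IsLocalRing R] [IsNoetherianRing R] {E : Type u}
    [AddCommGroup E] [Module R E] {e₀ : E}

theorem eval_injective (h : IsMatlis R E e₀) (F : Type u) [AddCommGroup F] [Module R F]
    [Module.Flat R F] : Function.Injective (matlisEval R E F) := by
  rw [injective_iff_map_eq_zero]
  intro w hw
  obtain ⟨r, e, φ, rfl⟩ := TensorProduct.exists_sum_tmul_eq w
  have hJ : Module.Injective R (F →ₗ[R] E) := injective_hom_of_flat h.inj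
  have key := sum_tmul_eq_zero_of_injective hJ e (fun i => (φ i).flip) (by
    intro y hy
    obtain ⟨t, ht⟩ := h.double_annihilator e y hy
    simp_rw [ht, map_smul, ← Finset.smul_sum]
    rw [show ∑ i, (φ i).flip (e i) = 0 from ?_, smul_zero]
    rw [map_sum] at hw
    exact hw)
  let flipMap : (E →ₗ[R] F →ₗ[R] E) →ₗ[R] (F →ₗ[R] E →ₗ[R] E) :=
    { toFun := fun φ => φ.flip, map_add' := fun _ _ => rfl, map_smul' := fun _ _ => rfl }
  have := congrArg (flipMap.lTensor E) key
  rw [map_sum, map_zero] at this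
  exact this

theorem isArtinian_span (R : Type u) [CommRing R] [IsLocalRing R] [IsNoetherianRing R]
    {X : Type u} [AddCommGroup X] [Module R X] (x : X) (k : ℕ)
    (hx : ∀ a ∈ maximalIdeal R ^ k, a • x = 0) : IsArtinian R (Submodule.span R {x}) := by
  let I := maximalIdeal R ^ (k + 1)
  have hI : I ≤ maximalIdeal R := Ideal.pow_le_self (Nat.succ_ne_zero k)
  have : Nontrivial (R ⧸ I) := Ideal.Quotient.nontrivial_iff.2
    (fun h => (maximalIdeal.isMaximal R).ne_top (top_le_iff.1 (h ▸ hI)))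
  have : IsLocalRing (R ⧸ I) := IsLocalRing.of_surjective' (Ideal.Quotient.mk I)
    Ideal.Quotient.mk_surjective
  have hart : IsArtinianRing (R ⧸ I) := by
    rw [isArtinianRing_iff_isNilpotent_maximalIdeal]
    refine ⟨k + 1, ?_⟩
    rw [← IsLocalRing.map_maximalIdeal_of_surjective (Ideal.Quotient.mk I)
      Ideal.Quotient.mk_surjective, ← Ideal.map_pow]
    exact Ideal.map_quotient_self I
  have : IsArtinian R (R ⧸ I) :=
    isArtinian_of_surjective_algebraMap (Ideal.Quotient.mk_surjective (I := I))
  let f : (R ⧸ I) →ₗ[R] Submodule.span R {x} := Submodule.liftQ I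
    (LinearMap.toSpanSingleton R _ ⟨x, Submodule.mem_span_singleton_self x⟩) (by
      intro a ha
      apply Subtype.ext
      exact hx a (Ideal.pow_le_pow_right (Nat.le_succ k) ha))
  apply isArtinian_of_surjective _ f
  rintro ⟨y, hy⟩
  obtain ⟨r, rfl⟩ := Submodule.mem_span_singleton.1 hy
  exact ⟨Submodule.Quotient.mk r, rfl⟩

theorem mem_range_eval (h : IsMatlis R E e₀) (F : Type u) [AddCommGroup F] [Module R F]
    [Module.Flat R F] (θ : F →ₗ[R] E) (k : ℕ) (hθ : ∀ a ∈ maximalIdeal R ^ k, a • θ = 0) :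
    ∃ w, matlisEval R E F w = θ := by
  classical
  have := isArtinian_span R θ k hθ
  have hJ : Module.Injective R (F →ₗ[R] E) := injective_hom_of_flat h.inj
  let N := Submodule.span R {θ}
  obtain ⟨s, hs⟩ := Finset.exists_inf_le (fun φ : N →ₗ[R] E => LinearMap.ker φ)
  have hinj : Function.Injective (LinearMap.pi fun φ : s => (φ : N →ₗ[R] E)) := by
    rw [injective_iff_map_eq_zero]
    intro x hx
    by_contra hne
    obtain ⟨φ, hφ⟩ := h.exists_ne_zero x hne
    apply hφ
    have hmem : x ∈ s.inf fun φ : N →ₗ[R] E => LinearMap.ker φ := by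
      rw [Submodule.mem_finsetInf]
      intro φ hφ
      exact congrFun hx ⟨φ, hφ⟩
    exact hs φ hmem
  obtain ⟨ψ, hψ⟩ := inj_ext hJ _ hinj N.subtype
  let t : N := ⟨θ, Submodule.mem_span_singleton_self θ⟩
  refine ⟨∑ φ : s, (φ : N →ₗ[R] E) t ⊗ₜ (ψ ∘ₗ LinearMap.single R (fun _ : s => E) φ).flip, ?_⟩
  have h1 := hψ t
  have h2 : (LinearMap.pi fun φ : s => (φ : N →ₗ[R] E)) t
      = ∑ φ : s, Pi.single φ ((φ : N →ₗ[R] E) t) := by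
    ext φ; simp [Finset.sum_apply, Pi.single_apply]
  rw [h2, map_sum] at h1
  rw [map_sum]
  exact h1

theorem eval_torsion (h : IsMatlis R E e₀) (F : Type u) [AddCommGroup F] [Module R F]
    (w : E ⊗[R] (F →ₗ[R] E →ₗ[R] E)) :
    ∃ k, ∀ a ∈ maximalIdeal R ^ k, a • matlisEval R E F w = 0 := by
  induction w with
  | zero => exact ⟨0, by simp⟩
  | tmul e φ =>
    obtain ⟨k, hk⟩ := h.torsion e
    refine ⟨k, fun a ha => ?_⟩
    rw [← map_smul, smul_tmul', hk a ha, zero_tmul, map_zero]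
  | add x y hx hy =>
    obtain ⟨k, hk⟩ := hx
    obtain ⟨l, hl⟩ := hy
    refine ⟨k + l, fun a ha => ?_⟩
    rw [map_add, smul_add, hk a (Ideal.pow_le_pow_right (Nat.le_add_right _ _) ha),
      hl a (Ideal.pow_le_pow_right (Nat.le_add_left _ _) ha), add_zero]

end IsMatlis

section Torsion

variable {R : Type u} [CommRing R] [IsNoetherianRing R]

/-- In an injective module, an element is divisible by powers of `a` up to `a`-torsion, without
shrinking its annihilator. -/
theorem exists_pow_smul_eq {J : Type u} [AddCommGroup J] [Module R J]
    (hJ : Module.Injective R J) (a : R) (l : ℕ) (w : J) :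
    ∃ (N : ℕ) (w' : J), a ^ (N + l) • w' = a ^ N • w ∧ ∀ b : R, b • w = 0 → b • w' = 0 := by
  let I : ℕ →o Submodule R R :=
    { toFun := fun n => LinearMap.ker (LinearMap.toSpanSingleton R J (a ^ n • w))
      monotone' := by
        intro m n hmn r hr
        obtain ⟨k, rfl⟩ := Nat.exists_eq_add_of_le hmn
        simp only [LinearMap.mem_ker, LinearMap.toSpanSingleton_apply] at hr ⊢
        rw [pow_add, mul_comm, mul_smul, smul_comm, hr, smul_zero] }
  obtain ⟨N, hN⟩ := monotone_stabilizes_iff_noetherian.2 inferInstance I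
  let 𝔟 : Ideal R := LinearMap.ker (LinearMap.toSpanSingleton R J w)
  obtain ⟨h, hh⟩ := inj_factor hJ (𝔟.mkQ ∘ₗ LinearMap.toSpanSingleton R R (a ^ (N + l)))
    (LinearMap.toSpanSingleton R J (a ^ N • w)) (by
      intro r hr
      have h1 : r • a ^ (N + l) ∈ 𝔟 := (Submodule.Quotient.mk_eq_zero 𝔟).1 hr
      have h2 : r ∈ I (N + l) := by
        show r • a ^ (N + l) • w = 0
        rw [← smul_assoc]; exact h1
      rw [← hN _ (Nat.le_add_right N l)] at h2
      exact h2)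
  refine ⟨N, h (𝔟.mkQ 1), ?_, ?_⟩
  · rw [← map_smul, ← map_smul]
    have := hh 1
    simp only [LinearMap.comp_apply, LinearMap.toSpanSingleton_apply, one_smul] at this
    rw [← this, smul_eq_mul, mul_one]
  · intro b hb
    rw [← map_smul, ← map_smul, smul_eq_mul, mul_one]
    rw [show 𝔟.mkQ b = 0 from (Submodule.Quotient.mk_eq_zero _).2 hb, map_zero]

/-- The torsion subcomplex of an exact complex of injectives is exact. -/
theorem exists_torsion_lift {J : ℕ → Type u} [∀ i, AddCommGroup (J i)] [∀ i, Module R (J i)]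
    (hJ : ∀ i, Module.Injective R (J i)) (d : ∀ i, J (i + 1) →ₗ[R] J i)
    (hd : ∀ i, Function.Exact (d (i + 1)) (d i)) (L : List R) :
    ∀ (i : ℕ) (y : J (i + 1)), d i y = 0 → (∀ a ∈ L, ∃ N : ℕ, a ^ N • y = 0) →
      ∃ z : J (i + 2), d (i + 1) z = y ∧ ∀ a ∈ L, ∃ N : ℕ, a ^ N • z = 0 := by
  induction L with
  | nil =>
    intro i y hy _
    obtain ⟨z, hz⟩ := (hd i y).1 hy
    exact ⟨z, hz, by simp⟩
  | cons a L ih =>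
    intro i y hy hL
    obtain ⟨z, hz, hzL⟩ := ih i y hy fun b hb => hL b (List.mem_cons_of_mem _ hb)
    obtain ⟨l, hl⟩ := hL a List.mem_cons_self
    obtain ⟨w, hw, hwL⟩ := ih (i + 1) (a ^ l • z) (by rw [map_smul, hz, hl]) (by
      intro b hb
      obtain ⟨N, hN⟩ := hzL b hb
      exact ⟨N, by rw [smul_comm, hN, smul_zero]⟩)
    obtain ⟨N, w', hw', hann⟩ := exists_pow_smul_eq (hJ _) a l w
    refine ⟨z - d (i + 2) w', ?_, ?_⟩
    · rw [map_sub, hz, (hd (i + 1)).apply_apply_eq_zero, sub_zero]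
    · intro b hb
      rcases List.mem_cons.1 hb with rfl | hb
      · refine ⟨N + l, ?_⟩
        rw [smul_sub, ← map_smul, hw', map_smul, hw, smul_smul, ← pow_add, sub_self]
      · obtain ⟨N1, h1⟩ := hzL b hb
        obtain ⟨N2, h2⟩ := hwL b hb
        refine ⟨N1 + N2, ?_⟩
        rw [smul_sub, ← map_smul, pow_add, mul_smul (b ^ N1) (b ^ N2) w', hann _ h2, smul_zero,
          map_zero, mul_comm, mul_smul, h1, smul_zero, sub_zero]

/-- Contravariant exactness of homomorphisms into an injective module. -/
theorem exact_hom_of_injective {X Y Z J : Type u} [AddCommGroup X] [Module R X] [AddCommGroup Y]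
    [Module R Y] [AddCommGroup Z] [Module R Z] [AddCommGroup J] [Module R J]
    (hJ : Module.Injective R J) (f : X →ₗ[R] Y) (g : Y →ₗ[R] Z) (h : Function.Exact f g)
    (φ : Y →ₗ[R] J) (hφ : φ ∘ₗ f = 0) : ∃ ψ : Z →ₗ[R] J, ψ ∘ₗ g = φ := by
  obtain ⟨ψ, hψ⟩ := inj_factor hJ g φ (by
    intro y hy
    obtain ⟨x, rfl⟩ := (h y).1 hy
    exact LinearMap.congr_fun hφ x)
  exact ⟨ψ, LinearMap.ext hψ⟩

end Torsion

section Flat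

variable {R : Type u} [CommRing R]

theorem flat_of_flat_of_flat {K L F : Type u} [AddCommGroup K] [Module R K] [AddCommGroup L]
    [Module R L] [AddCommGroup F] [Module R F] [Module.Flat R L] [Module.Flat R F]
    (f : K →ₗ[R] L) (g : L →ₗ[R] F) (hf : Function.Injective f) (h : Function.Exact f g)
    (hg : Function.Surjective g) : Module.Flat R K := by
  rw [Module.Flat.iff_rTensor_injective']
  intro I
  have h1 := LinearMap.lTensor_injective_of_exact_of_flat g hg f hf h I
  have h2 := Module.Flat.rTensor_preserves_injective_linearMap (M := L) I.subtype
    I.injective_subtype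
  have : Function.Injective (f.lTensor R ∘ₗ I.subtype.rTensor K) := by
    rw [LinearMap.lTensor_comp_rTensor, ← LinearMap.rTensor_comp_lTensor]
    exact h2.comp h1
  exact Function.Injective.of_comp this

theorem flat_mid {K L F : Type u} [AddCommGroup K] [Module R K] [AddCommGroup L]
    [Module R L] [AddCommGroup F] [Module R F] [Module.Flat R K] [Module.Flat R F]
    (f : K →ₗ[R] L) (g : L →ₗ[R] F) (hf : Function.Injective f) (h : Function.Exact f g)
    (hg : Function.Surjective g) : Module.Flat R L := by
  rw [Module.Flat.iff_rTensor_injective']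
  intro I
  rw [injective_iff_map_eq_zero]
  intro w hw
  have hF := Module.Flat.rTensor_preserves_injective_linearMap (M := F) I.subtype
    I.injective_subtype
  have hK := Module.Flat.rTensor_preserves_injective_linearMap (M := K) I.subtype
    I.injective_subtype
  have h1 : g.lTensor I w = 0 := by
    apply hF
    rw [map_zero]
    have := LinearMap.congr_fun (LinearMap.rTensor_comp_lTensor (f := I.subtype) (g := g)) w
    have h2 := LinearMap.congr_fun (LinearMap.lTensor_comp_rTensor (f := I.subtype) (g := g)) w
    simp only [LinearMap.comp_apply] at this h2
    rw [this, ← h2, hw, map_zero]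
  obtain ⟨v, rfl⟩ := (lTensor_exact I h hg w).1 h1
  have hR := LinearMap.lTensor_injective_of_exact_of_flat g hg f hf h R
  have : v = 0 := by
    apply hK
    apply hR
    have := LinearMap.congr_fun (LinearMap.rTensor_comp_lTensor (f := I.subtype) (g := f)) v
    have h2 := LinearMap.congr_fun (LinearMap.lTensor_comp_rTensor (f := I.subtype) (g := f)) v
    simp only [LinearMap.comp_apply] at this h2
    rw [h2, ← this, hw, map_zero, map_zero]
  rw [this, map_zero]

end Flat

section

open CategoryTheory

section TopVanish

variable (R : Type u) [CommRing R] (C : Type u) [AddCommGroup C] [Module R C]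

/-- `Ext^j(X, C) = 0` for all `j > B`. -/
def ExtVanish (B : ℕ) (X : Type u) [AddCommGroup X] [Module R X] : Prop :=
  ∀ j : ℕ, B < j → Subsingleton (Abelian.Ext (ModuleCat.of R X) (ModuleCat.of R C) j)

variable {R C}

theorem ExtVanish.mono {B B' : ℕ} {X : Type u} [AddCommGroup X] [Module R X]
    (h : ExtVanish R C B X) (hB : B ≤ B') : ExtVanish R C B' X :=
  fun j hj => h j (hB.trans_lt hj)

variable {X Y Z : Type u} [AddCommGroup X] [Module R X] [AddCommGroup Y] [Module R Y]
  [AddCommGroup Z] [Module R Z]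

theorem ExtVanish.of_equiv (e : X ≃ₗ[R] Y) {B : ℕ} (h : ExtVanish R C B X) :
    ExtVanish R C B Y := by
  intro j hj
  have := h j hj
  refine ⟨fun a b => ?_⟩
  have key : ∀ a : Abelian.Ext (ModuleCat.of R Y) (ModuleCat.of R C) j,
      (Abelian.Ext.mk₀ e.toModuleIso.inv).comp
        ((Abelian.Ext.mk₀ e.toModuleIso.hom).comp a (zero_add j)) (zero_add j) = a := by
    intro a
    rw [Abelian.Ext.mk₀_comp_mk₀_assoc, Iso.inv_hom_id, Abelian.Ext.mk₀_id_comp]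
  rw [← key a, ← key b, Subsingleton.elim ((Abelian.Ext.mk₀ e.toModuleIso.hom).comp a (zero_add j))]

theorem shortExact_of (f : X →ₗ[R] Y) (g : Y →ₗ[R] Z) (hf : Function.Injective f)
    (h : Function.Exact f g) (hg : Function.Surjective g) :
    (ModuleCat.shortComplexOfCompEqZero f g h.linearMap_comp_eq_zero).ShortExact :=
  ModuleCat.shortComplex_shortExact _ h hf hg

/-- Closure under kernels. -/
theorem ExtVanish.left {B : ℕ} (f : X →ₗ[R] Y) (g : Y →ₗ[R] Z) (hf : Function.Injective f)
    (h : Function.Exact f g) (hg : Function.Surjective g) (hY : ExtVanish R C B Y)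
    (hZ : ExtVanish R C (B + 1) Z) : ExtVanish R C B X := by
  intro j hj
  have := hY j hj
  have := hZ (1 + j) (by omega)
  refine subsingleton_of_forall_eq 0 fun a => ?_
  obtain ⟨b, rfl⟩ := Abelian.Ext.contravariant_sequence_exact₁ (shortExact_of f g hf h hg)
    (ModuleCat.of R C) a rfl (@Subsingleton.elim _ this _ _)
  rw [@Subsingleton.elim _ (hY j hj) b 0]
  simp

/-- Closure under extensions. -/
theorem ExtVanish.mid {B : ℕ} (f : X →ₗ[R] Y) (g : Y →ₗ[R] Z) (hf : Function.Injective f)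
    (h : Function.Exact f g) (hg : Function.Surjective g) (hX : ExtVanish R C B X)
    (hZ : ExtVanish R C B Z) : ExtVanish R C B Y := by
  intro j hj
  refine subsingleton_of_forall_eq 0 fun a => ?_
  obtain ⟨b, rfl⟩ := Abelian.Ext.contravariant_sequence_exact₂ (shortExact_of f g hf h hg)
    (ModuleCat.of R C) a (@Subsingleton.elim _ (hX j hj) _ _)
  rw [@Subsingleton.elim _ (hZ j hj) b 0]
  simp

/-- Closure under cokernels, with a shift. -/
theorem ExtVanish.right {B : ℕ} (f : X →ₗ[R] Y) (g : Y →ₗ[R] Z) (hf : Function.Injective f)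
    (h : Function.Exact f g) (hg : Function.Surjective g) (hX : ExtVanish R C B X)
    (hY : ExtVanish R C (B + 1) Y) : ExtVanish R C (B + 1) Z := by
  intro j hj
  obtain ⟨i, rfl⟩ : ∃ i, j = 1 + i := ⟨j - 1, by omega⟩
  refine subsingleton_of_forall_eq 0 fun a => ?_
  obtain ⟨b, rfl⟩ := Abelian.Ext.contravariant_sequence_exact₃ (shortExact_of f g hf h hg)
    (ModuleCat.of R C) a (@Subsingleton.elim _ (hY (1 + i) hj) _ _) rfl
  rw [@Subsingleton.elim _ (hX i (by omega)) b 0]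
  simp

/-- Vanishing of `Ext¹` lets homomorphisms extend. -/
theorem ExtVanish.extend (f : X →ₗ[R] Y) (g : Y →ₗ[R] Z) (hf : Function.Injective f)
    (h : Function.Exact f g) (hg : Function.Surjective g) (hZ : ExtVanish R C 0 Z)
    (φ : X →ₗ[R] C) : ∃ ψ : Y →ₗ[R] C, ψ ∘ₗ f = φ := by
  obtain ⟨b, hb⟩ := Abelian.Ext.contravariant_sequence_exact₁ (shortExact_of f g hf h hg)
    (ModuleCat.of R C) (Abelian.Ext.mk₀ (ModuleCat.ofHom φ)) (n₁ := 1) rfl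
    (@Subsingleton.elim _ (hZ 1 one_pos) _ _)
  obtain ⟨ψ, rfl⟩ := (Abelian.Ext.mk₀_bijective _ _).2 b
  rw [Abelian.Ext.mk₀_comp_mk₀] at hb
  have := (Abelian.Ext.mk₀_bijective _ _).1 hb
  exact ⟨ψ.hom, congrArg ModuleCat.Hom.hom this⟩

theorem subsingleton_ext_one (f : X →ₗ[R] Y) (g : Y →ₗ[R] Z) (hf : Function.Injective f)
    (h : Function.Exact f g) (hg : Function.Surjective g)
    (hY : ExtVanish R C 0 Y) (hext : ∀ φ : X →ₗ[R] C, ∃ ψ : Y →ₗ[R] C, ψ ∘ₗ f = φ) :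
    Subsingleton (Abelian.Ext (ModuleCat.of R Z) (ModuleCat.of R C) 1) := by
  refine subsingleton_of_forall_eq 0 fun a => ?_
  obtain ⟨b, rfl⟩ := Abelian.Ext.contravariant_sequence_exact₃ (shortExact_of f g hf h hg)
    (ModuleCat.of R C) a (@Subsingleton.elim _ (hY 1 one_pos) _ _) (n₀ := 0) rfl
  obtain ⟨φ, rfl⟩ := (Abelian.Ext.mk₀_bijective _ _).2 b
  obtain ⟨ψ, hψ⟩ := hext φ.hom
  have hφ : φ = ModuleCat.ofHom f ≫ ModuleCat.ofHom ψ := by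
    rw [← ModuleCat.ofHom_comp, hψ]; rfl
  rw [hφ, ← Abelian.Ext.mk₀_comp_mk₀]
  exact (shortExact_of f g hf h hg).extClass_comp_assoc _

theorem subsingleton_ext_succ (f : X →ₗ[R] Y) (g : Y →ₗ[R] Z) (hf : Function.Injective f)
    (h : Function.Exact f g) (hg : Function.Surjective g) {j : ℕ} (hY : ExtVanish R C 0 Y)
    (hX : Subsingleton (Abelian.Ext (ModuleCat.of R X) (ModuleCat.of R C) j)) :
    Subsingleton (Abelian.Ext (ModuleCat.of R Z) (ModuleCat.of R C) (j + 1)) := by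
  refine subsingleton_of_forall_eq 0 fun a => ?_
  obtain ⟨b, rfl⟩ := Abelian.Ext.contravariant_sequence_exact₃ (shortExact_of f g hf h hg)
    (ModuleCat.of R C) a (@Subsingleton.elim _ (hY (j + 1) j.succ_pos) _ _) (n₀ := j) (add_comm 1 j)
  rw [@Subsingleton.elim _ hX b 0]
  simp

theorem ExtVanish.of_projective [Module.Projective R X] : ExtVanish R C 0 X := by
  intro j hj
  obtain ⟨i, rfl⟩ : ∃ i, j = i + 1 := ⟨j - 1, by omega⟩
  exact Abelian.Ext.subsingleton_of_projective _ _ i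

end TopVanish

section EndE

variable {R : Type u} [CommRing R] {E : Type u} [AddCommGroup E] [Module R E]

variable {X Y Z : Type u} [AddCommGroup X] [Module R X] [AddCommGroup Y] [Module R Y]
  [AddCommGroup Z] [Module R Z]

theorem exists_extend_of_rTensor_injective (hE : Module.Injective R E) (f : X →ₗ[R] Y)
    (hf : Function.Injective (f.rTensor E)) (φ : X →ₗ[R] E →ₗ[R] E) :
    ∃ ψ : Y →ₗ[R] E →ₗ[R] E, ψ ∘ₗ f = φ := by
  obtain ⟨h, hh⟩ := inj_ext hE (f.rTensor E) hf (TensorProduct.lift φ)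
  refine ⟨TensorProduct.curry h, ?_⟩
  ext x e
  simpa using hh (x ⊗ₜ e)

theorem rTensor_injective_of_extend [IsLocalRing R] {e₀ : E} (hE : IsMatlis R E e₀)
    (f : X →ₗ[R] Y) (hext : ∀ φ : X →ₗ[R] E →ₗ[R] E, ∃ ψ : Y →ₗ[R] E →ₗ[R] E, ψ ∘ₗ f = φ) :
    Function.Injective (f.rTensor E) := by
  rw [injective_iff_map_eq_zero]
  intro w hw
  by_contra hne
  obtain ⟨φ, hφ⟩ := hE.exists_ne_zero w hne
  obtain ⟨ψ, hψ⟩ := hext (TensorProduct.curry φ)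
  apply hφ
  have : φ = TensorProduct.lift ψ ∘ₗ f.rTensor E := by
    ext x e
    simpa using (LinearMap.congr_fun (LinearMap.congr_fun hψ x) e).symm
  rw [this, LinearMap.comp_apply, hw, map_zero]

theorem exists_kernel (g : Y →ₗ[R] Z) : ∃ (K : Type u) (_ : AddCommGroup K) (_ : Module R K)
    (i : K →ₗ[R] Y), Function.Injective i ∧ Function.Exact i g :=
  ⟨LinearMap.ker g, inferInstance, inferInstance, (LinearMap.ker g).subtype,
    (LinearMap.ker g).injective_subtype, LinearMap.exact_subtype_ker_map g⟩

variable (R X) in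
theorem exists_free_cover : ∃ (L : Type u) (_ : AddCommGroup L) (_ : Module R L)
    (g : L →ₗ[R] X), Module.Free R L ∧ Function.Surjective g :=
  ⟨X →₀ R, inferInstance, inferInstance, Finsupp.linearCombination R id, inferInstance,
    Finsupp.linearCombination_id_surjective R X⟩

theorem ExtVanish.of_flat (hE : Module.Injective R E) [Module.Flat R X] :
    ExtVanish R (E →ₗ[R] E) 0 X := by
  have key : ∀ (j : ℕ) (X : Type u) [AddCommGroup X] [Module R X], Module.Flat R X →
      Subsingleton (Abelian.Ext (ModuleCat.of R X) (ModuleCat.of R (E →ₗ[R] E)) (j + 1)) := by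
    intro j
    induction j with
    | zero =>
      intro X _ _ hX
      obtain ⟨L, _, _, g, _, hg⟩ := exists_free_cover R X
      obtain ⟨K, _, _, i, hi, hex⟩ := exists_kernel g
      refine subsingleton_ext_one i g hi hex hg .of_projective fun φ => ?_
      exact exists_extend_of_rTensor_injective hE i
        ((LinearMap.lTensor_inj_iff_rTensor_inj E i).1
          (LinearMap.lTensor_injective_of_exact_of_flat g hg i hi hex E)) φ
    | succ j ih =>
      intro X _ _ hX
      obtain ⟨L, _, _, g, _, hg⟩ := exists_free_cover R X
      obtain ⟨K, _, _, i, hi, hex⟩ := exists_kernel g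
      have hK : Module.Flat R K := flat_of_flat_of_flat i g hi hex hg
      exact subsingleton_ext_succ i g hi hex hg .of_projective (ih _ hK)
  intro j hj
  obtain ⟨i, rfl⟩ : ∃ i, j = i + 1 := ⟨j - 1, by omega⟩
  exact key i X inferInstance

end EndE

end

section Dual

variable {R : Type u} [CommRing R] {E : Type u} [AddCommGroup E] [Module R E]

variable {X Y Z : Type u} [AddCommGroup X] [Module R X] [AddCommGroup Y] [Module R Y]
  [AddCommGroup Z] [Module R Z]

theorem exists_lift_of_exact {A : Type*} [AddCommGroup A] [Module R A] (i : X →ₗ[R] Y)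
    (g : Y →ₗ[R] Z) (hi : Function.Injective i) (h : Function.Exact i g) (v : A →ₗ[R] Y)
    (hv : ∀ a, g (v a) = 0) : ∃ w : A →ₗ[R] X, ∀ a, i (w a) = v a := by
  choose w hw using fun a => (h (v a)).1 (hv a)
  exact ⟨{ toFun := w
           map_add' := fun a b => hi (by simp [hw])
           map_smul' := fun r a => hi (by simp [hw]) }, hw⟩

/-- Flatness of `Hom(X, Hom(E, E))` for flat `X` and injective `E`. -/
theorem flat_dual [IsNoetherianRing R] (hE : Module.Injective R E) [Module.Flat R X] :
    Module.Flat R (X →ₗ[R] E →ₗ[R] E) :=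
  have := flat_hom_of_injective (injective_tensor_of_flat (F := X) hE) hE
  Module.Flat.of_linearEquiv (TensorProduct.lift.equiv (RingHom.id R) X E E)

theorem lcomp_injective {C : Type u} [AddCommGroup C] [Module R C] (g : Y →ₗ[R] Z)
    (hg : Function.Surjective g) : Function.Injective (LinearMap.lcomp R C g) := by
  intro a b hab
  ext z
  obtain ⟨y, rfl⟩ := hg z
  exact LinearMap.congr_fun hab y

theorem lcomp_exact {C : Type u} [AddCommGroup C] [Module R C] (f : X →ₗ[R] Y) (g : Y →ₗ[R] Z)
    (h : Function.Exact f g) (hg : Function.Surjective g) :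
    Function.Exact (LinearMap.lcomp R C g) (LinearMap.lcomp R C f) := by
  intro φ
  constructor
  · intro hφ
    have hker : LinearMap.ker g ≤ LinearMap.ker φ := by
      intro y hy
      obtain ⟨x, rfl⟩ := (h y).1 hy
      exact LinearMap.congr_fun hφ x
    let e := (LinearMap.quotKerEquivOfSurjective g hg)
    refine ⟨(LinearMap.ker g).liftQ φ hker ∘ₗ e.symm.toLinearMap, ?_⟩
    ext1 y
    have : e.symm (g y) = (LinearMap.ker g).mkQ y := by
      rw [LinearEquiv.symm_apply_eq]; rfl
    simp [LinearMap.lcomp_apply, this]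
  · rintro ⟨ψ, rfl⟩
    ext1 x
    simp [LinearMap.lcomp_apply, h.apply_apply_eq_zero x]

theorem lcomp_surjective {C : Type u} [AddCommGroup C] [Module R C] (f : X →ₗ[R] Y) (g : Y →ₗ[R] Z)
    (hf : Function.Injective f) (h : Function.Exact f g) (hg : Function.Surjective g)
    (hZ : ExtVanish R C 0 Z) : Function.Surjective (LinearMap.lcomp R C f) := fun φ =>
  ExtVanish.extend f g hf h hg hZ φ

end Dual

section Right

variable {R : Type u} [CommRing R] {E : Type u} [AddCommGroup E] [Module R E]

/-- If all syzygies in a family remain exact under `E ⊗ -`, then the whole family has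
vanishing `Ext`. -/
theorem extVanish_of_family {ι : Type*} (hE : Module.Injective R E)
    (W F : ι → Type u) (s : ι → ι) [∀ i, AddCommGroup (W i)] [∀ i, Module R (W i)]
    [∀ i, AddCommGroup (F i)] [∀ i, Module R (F i)] [∀ i, Module.Flat R (F i)]
    (f : ∀ i, W (s i) →ₗ[R] F i) (g : ∀ i, F i →ₗ[R] W i) (hf : ∀ i, Function.Injective (f i))
    (h : ∀ i, Function.Exact (f i) (g i)) (hg : ∀ i, Function.Surjective (g i))
    (ht : ∀ i, Function.Injective ((f i).rTensor E)) (i : ι) :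
    ExtVanish R (E →ₗ[R] E) 0 (W i) := by
  have key : ∀ (j : ℕ) (i : ι), Subsingleton (CategoryTheory.Abelian.Ext (ModuleCat.of R (W i))
      (ModuleCat.of R (E →ₗ[R] E)) (j + 1)) := by
    intro j
    induction j with
    | zero =>
      intro i
      exact subsingleton_ext_one (f i) (g i) (hf i) (h i) (hg i) (ExtVanish.of_flat hE)
        (exists_extend_of_rTensor_injective hE (f i) (ht i))
    | succ j ih =>
      intro i
      exact subsingleton_ext_succ (f i) (g i) (hf i) (h i) (hg i) (ExtVanish.of_flat hE)
        (ih (s i))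
  intro j hj
  obtain ⟨k, rfl⟩ : ∃ k, j = k + 1 := ⟨j - 1, by omega⟩
  exact key k i

/-- `E ⊗ -` is exact on `0 → W → F`, if it is exact on a sequence `G' → G → F` with `W` the image
of `G → F` and the kernel of `G → W` the image of `G'`. -/
theorem rTensor_injective_of_exact {W F G G' : Type u} [AddCommGroup W] [Module R W]
    [AddCommGroup F] [Module R F] [AddCommGroup G] [Module R G] [AddCommGroup G'] [Module R G']
    (f : W →ₗ[R] F) (p : G →ₗ[R] W) (q : G' →ₗ[R] G) (hp : Function.Surjective p)
    (hpq : ∀ x, p (q x) = 0)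
    (hex : ∀ w : E ⊗[R] G, (f ∘ₗ p).lTensor E w = 0 → ∃ w', q.lTensor E w' = w) :
    Function.Injective (f.rTensor E) := by
  rw [← LinearMap.lTensor_inj_iff_rTensor_inj, injective_iff_map_eq_zero]
  intro w hw
  obtain ⟨w, rfl⟩ := LinearMap.lTensor_surjective E hp w
  obtain ⟨w', rfl⟩ := hex w (by rw [LinearMap.lTensor_comp]; exact hw)
  rw [← LinearMap.comp_apply, ← LinearMap.lTensor_comp]
  have : p ∘ₗ q = 0 := LinearMap.ext hpq
  simp [this]

variable (R E) in
/-- `X` has a right resolution by flat modules with all cosyzygies in the left orthogonal of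
`Hom(E, E)`. -/
def HasRightRes (X : Type u) [AddCommGroup X] [Module R X] : Prop :=
  ∃ P : (∀ (X : Type u) [AddCommGroup X] [Module R X], Prop), P X ∧
    ∀ (X : Type u) [AddCommGroup X] [Module R X], P X → ExtVanish R (E →ₗ[R] E) 0 X ∧
      ∃ (F Z : Type u) (_ : AddCommGroup F) (_ : Module R F) (_ : AddCommGroup Z) (_ : Module R Z)
        (f : X →ₗ[R] F) (g : F →ₗ[R] Z), Module.Flat R F ∧ Function.Injective f ∧
          Function.Exact f g ∧ Function.Surjective g ∧ P Z

variable {X : Type u} [AddCommGroup X] [Module R X]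

theorem HasRightRes.extVanish (h : HasRightRes R E X) : ExtVanish R (E →ₗ[R] E) 0 X := by
  obtain ⟨P, hX, hP⟩ := h
  exact (hP X hX).1

theorem HasRightRes.next (h : HasRightRes R E X) :
    ∃ (F Z : Type u) (_ : AddCommGroup F) (_ : Module R F) (_ : AddCommGroup Z) (_ : Module R Z)
      (f : X →ₗ[R] F) (g : F →ₗ[R] Z), Module.Flat R F ∧ Function.Injective f ∧
        Function.Exact f g ∧ Function.Surjective g ∧ HasRightRes R E Z := by
  obtain ⟨P, hX, hP⟩ := h
  obtain ⟨F, Z, _, _, _, _, f, g, h1, h2, h3, h4, h5⟩ := (hP X hX).2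
  exact ⟨F, Z, _, _, _, _, f, g, h1, h2, h3, h4, P, h5, hP⟩

theorem HasRightRes.intro {F Z : Type u} [AddCommGroup F] [Module R F] [AddCommGroup Z]
    [Module R Z] [Module.Flat R F] (hX : ExtVanish R (E →ₗ[R] E) 0 X) (f : X →ₗ[R] F)
    (g : F →ₗ[R] Z) (hf : Function.Injective f) (h : Function.Exact f g)
    (hg : Function.Surjective g) (hZ : HasRightRes R E Z) : HasRightRes R E X := by
  refine ⟨fun X _ _ => ExtVanish R (E →ₗ[R] E) 0 X ∧ ∃ (F Z : Type u) (_ : AddCommGroup F)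
    (_ : Module R F) (_ : AddCommGroup Z) (_ : Module R Z) (f : X →ₗ[R] F) (g : F →ₗ[R] Z),
    Module.Flat R F ∧ Function.Injective f ∧ Function.Exact f g ∧ Function.Surjective g ∧
    HasRightRes R E Z, ⟨hX, F, Z, _, _, _, _, f, g, inferInstance, hf, h, hg, hZ⟩, ?_⟩
  rintro X _ _ ⟨h0, F, Z, _, _, _, _, f, g, h1, h2, h3, h4, h5⟩
  exact ⟨h0, F, Z, _, _, _, _, f, g, h1, h2, h3, h4, h5.extVanish, h5.next⟩

theorem HasRightRes.of_equiv {Y : Type u} [AddCommGroup Y] [Module R Y] (e : X ≃ₗ[R] Y)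
    (h : HasRightRes R E X) : HasRightRes R E Y := by
  obtain ⟨F, Z, _, _, _, _, f, g, h1, h2, h3, h4, h5⟩ := h.next
  refine .intro (h.extVanish.of_equiv e) (f ∘ₗ e.symm.toLinearMap) g
    (h2.comp e.symm.injective) ?_ h4 h5
  intro y
  rw [h3 y]
  simp only [LinearMap.coe_comp, LinearEquiv.coe_coe, Set.mem_range, Function.comp]
  exact e.symm.surjective.exists

theorem HasRightRes.syzygy (hE : Module.Injective R E) {G K : Type u} [AddCommGroup G]
    [Module R G] [AddCommGroup K] [Module R K] [Module.Flat R G] (f : K →ₗ[R] G) (g : G →ₗ[R] X)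
    (hf : Function.Injective f) (h : Function.Exact f g) (hg : Function.Surjective g)
    (hX : HasRightRes R E X) : HasRightRes R E K :=
  .intro (ExtVanish.left f g hf h hg (.of_flat hE) (hX.extVanish.mono zero_le_one)) f g hf h hg hX

/-- A right resolution as a sequence. -/
theorem HasRightRes.exists_seq (h : HasRightRes R E X) :
    ∃ (W F : ℕ → ModuleCat.{u} R) (f : ∀ i, W i →ₗ[R] F i) (g : ∀ i, F i →ₗ[R] W (i + 1)),
      (∀ i, Module.Flat R (F i)) ∧ (∀ i, Function.Injective (f i)) ∧
      (∀ i, Function.Exact (f i) (g i)) ∧ (∀ i, Function.Surjective (g i)) ∧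
      (∀ i, ExtVanish R (E →ₗ[R] E) 0 (W i)) ∧ Nonempty (X ≃ₗ[R] W 0) := by
  have key : ∀ A : {A : ModuleCat.{u} R // HasRightRes R E A},
      ∃ (B : {A : ModuleCat.{u} R // HasRightRes R E A}) (F : ModuleCat.{u} R)
        (f : A.1 →ₗ[R] F) (g : F →ₗ[R] B.1), Module.Flat R F ∧ Function.Injective f ∧
        Function.Exact f g ∧ Function.Surjective g := by
    rintro ⟨A, hA⟩
    obtain ⟨F, Z, _, _, _, _, f, g, h1, h2, h3, h4, h5⟩ := hA.next
    exact ⟨⟨ModuleCat.of R Z, h5⟩, ModuleCat.of R F, f, g, h1, h2, h3, h4⟩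
  choose B F f g h1 h2 h3 h4 using key
  let W : ℕ → {A : ModuleCat.{u} R // HasRightRes R E A} := fun n =>
    Nat.rec ⟨ModuleCat.of R X, h⟩ (fun _ A => B A) n
  exact ⟨fun i => (W i).1, fun i => F (W i), fun i => f (W i), fun i => g (W i),
    fun i => h1 _, fun i => h2 _, fun i => h3 _, fun i => h4 _, fun i => (W i).2.extVanish,
    ⟨LinearEquiv.refl R X⟩⟩

end Right

section RightDual

variable {R : Type u} [CommRing R] [IsLocalRing R] [IsNoetherianRing R]
  {E : Type u} [AddCommGroup E] [Module R E] {e₀ : E}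

theorem exists_pow_smul_of_generators {J : Type*} [AddCommGroup J] [Module R J] {L : List R}
    (hL : Ideal.span {x | x ∈ L} = maximalIdeal R) (z : J) (hz : ∀ a ∈ L, ∃ N : ℕ, a ^ N • z = 0) :
    ∃ k : ℕ, ∀ a ∈ maximalIdeal R ^ k, a • z = 0 := by
  let I : Ideal R := LinearMap.ker (LinearMap.toSpanSingleton R J z)
  have hI : ∀ a, a ∈ I ↔ a • z = 0 := fun a => by simp [I]
  have : maximalIdeal R ≤ I.radical := by
    rw [← hL, Ideal.span_le]
    intro a ha
    obtain ⟨N, hN⟩ := hz a ha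
    exact ⟨N, (hI _).2 hN⟩
  obtain ⟨k, hk⟩ := Ideal.exists_pow_le_of_le_radical_of_fg this (IsNoetherian.noetherian _)
  exact ⟨k, fun a ha => (hI a).1 (hk ha)⟩

theorem matlisEval_naturality {F G : Type u} [AddCommGroup F] [Module R F] [AddCommGroup G]
    [Module R G] (p : F →ₗ[R] G) (w : E ⊗[R] (G →ₗ[R] E →ₗ[R] E)) :
    matlisEval R E F ((LinearMap.lcomp R (E →ₗ[R] E) p).lTensor E w) = matlisEval R E G w ∘ₗ p := by
  induction w with
  | zero => ext; simp
  | tmul e φ => ext; simp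
  | add a b ha hb => rw [map_add, map_add, ha, hb, map_add, LinearMap.add_comp]

theorem exists_maximalIdeal_list : ∃ L : List R, Ideal.span {x | x ∈ L} = maximalIdeal R := by
  obtain ⟨s, hs⟩ := (isNoetherianRing_iff_ideal_fg R).1 inferInstance (maximalIdeal R)
  exact ⟨s.toList, by rw [← hs]; congr 1; ext; simp⟩

/-- The functor `E ⊗ Hom(-, Hom(E, E))` turns exact sequences of flat modules into exact
sequences. -/
theorem tensor_dual_exact (hE : IsMatlis R E e₀) (F : ℕ → Type u) [∀ i, AddCommGroup (F i)]
    [∀ i, Module R (F i)] [∀ i, Module.Flat R (F i)] (p : ∀ i, F i →ₗ[R] F (i + 1))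
    (hp : ∀ i, Function.Exact (p i) (p (i + 1))) (i : ℕ)
    (w : E ⊗[R] (F (i + 1) →ₗ[R] E →ₗ[R] E))
    (hw : (LinearMap.lcomp R (E →ₗ[R] E) (p i)).lTensor E w = 0) :
    ∃ w', (LinearMap.lcomp R (E →ₗ[R] E) (p (i + 1))).lTensor E w' = w := by
  obtain ⟨L, hL⟩ := exists_maximalIdeal_list (R := R)
  have hLm : ∀ a ∈ L, a ∈ maximalIdeal R := fun a ha => hL ▸ Ideal.subset_span ha
  obtain ⟨z, hz1, hz2⟩ := exists_torsion_lift (J := fun i => F i →ₗ[R] E)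
    (fun i => injective_hom_of_flat (F := F i) hE.inj) (fun i => LinearMap.lcomp R E (p i))
    (fun i φ => ⟨fun hφ => by
        obtain ⟨ψ, hψ⟩ := exact_hom_of_injective hE.inj (p i) (p (i + 1)) (hp i) φ hφ
        exact ⟨ψ, hψ⟩, by
      rintro ⟨ψ, rfl⟩
      ext1 x
      simp [LinearMap.lcomp_apply, (hp i).apply_apply_eq_zero x]⟩)
    L i (matlisEval R E _ w) (by
      have := matlisEval_naturality (p i) w
      rw [hw, map_zero] at this
      exact this.symm) (by
      intro a ha
      obtain ⟨k, hk⟩ := hE.eval_torsion _ w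
      exact ⟨k, hk _ (Ideal.pow_mem_pow (hLm a ha) k)⟩)
  obtain ⟨k, hk⟩ := exists_pow_smul_of_generators hL z hz2
  obtain ⟨w', rfl⟩ := hE.mem_range_eval _ z k hk
  refine ⟨w', hE.eval_injective _ ?_⟩
  rw [matlisEval_naturality]
  exact hz1

theorem HasRightRes.extVanish_dual (hE : IsMatlis R E e₀) {X : Type u} [AddCommGroup X]
    [Module R X] (h : HasRightRes R E X) :
    ExtVanish R (E →ₗ[R] E) 0 (X →ₗ[R] E →ₗ[R] E) := by
  obtain ⟨W, F, f, g, hF, hf, hex, hg, hW, ⟨e⟩⟩ := h.exists_seq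
  have hH : ∀ i, Module.Flat R (F i →ₗ[R] E →ₗ[R] E) := fun i => flat_dual hE.inj
  have := extVanish_of_family hE.inj (fun i => W i →ₗ[R] E →ₗ[R] E)
    (fun i => F i →ₗ[R] E →ₗ[R] E) (fun i => i + 1)
    (fun i => LinearMap.lcomp R (E →ₗ[R] E) (g i)) (fun i => LinearMap.lcomp R (E →ₗ[R] E) (f i))
    (fun i => lcomp_injective _ (hg i)) (fun i => lcomp_exact _ _ (hex i) (hg i))
    (fun i => lcomp_surjective _ _ (hf i) (hex i) (hg i) (hW (i + 1))) (fun i => by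
      refine rTensor_injective_of_exact (LinearMap.lcomp R (E →ₗ[R] E) (g i))
        (LinearMap.lcomp R (E →ₗ[R] E) (f (i + 1)))
        (LinearMap.lcomp R (E →ₗ[R] E) (f (i + 2) ∘ₗ g (i + 1)))
        (lcomp_surjective _ _ (hf _) (hex _) (hg _) (hW _)) ?_ ?_
      · intro φ
        ext1 x
        simp [LinearMap.lcomp_apply, (hex (i + 1)).apply_apply_eq_zero x]
      · exact tensor_dual_exact hE (fun i => F i) (fun i => f (i + 1) ∘ₗ g i) (fun i y => by
          rw [LinearMap.comp_apply, map_eq_zero_iff _ (hf _), hex (i + 1) y]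
          simp only [Set.mem_range, LinearMap.comp_apply]
          exact (hg i).exists) i) 0
  exact this.of_equiv (e.symm.congrLeft (E →ₗ[R] E) R)

end RightDual

section Family

variable {R : Type u} [CommRing R] {E : Type u} [AddCommGroup E] [Module R E]

/-- The images in a complex of flat modules that stays exact under `E ⊗ -` are in the left
orthogonal of `Hom(E, E)`. -/
theorem extVanish_range (hE : Module.Injective R E) (F : ℤ → Type u) [∀ i, AddCommGroup (F i)]
    [∀ i, Module R (F i)] [∀ i, Module.Flat R (F i)] (d : ∀ i, F (i + 1) →ₗ[R] F i)
    (hd : ∀ i, Function.Exact (d (i + 1)) (d i))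
    (ht : ∀ i, Function.Exact ((d (i + 1)).lTensor E) ((d i).lTensor E)) (i : ℤ) :
    ExtVanish R (E →ₗ[R] E) 0 (LinearMap.range (d i)) := by
  refine extVanish_of_family hE (fun i => LinearMap.range (d i)) (fun i => F (i + 1))
    (fun i => i + 1) (fun i => (LinearMap.range (d (i + 1))).subtype)
    (fun i => (d i).rangeRestrict) (fun i => Submodule.injective_subtype _) ?_
    (fun i => (d i).surjective_rangeRestrict) ?_ i
  · intro i y
    rw [← (Submodule.injective_subtype _).eq_iff]
    simpa using hd i y
  · intro i
    refine rTensor_injective_of_exact (LinearMap.range (d (i + 1))).subtype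
      (d (i + 1)).rangeRestrict (d (i + 1 + 1)) (d (i + 1)).surjective_rangeRestrict ?_ ?_
    · intro x
      ext
      simpa using (hd (i + 1)).apply_apply_eq_zero x
    · intro w hw
      exact (ht (i + 1) w).1 (by simpa using hw)

theorem IsGorensteinFlat.hasRightRes (hE : Module.Injective R E) {Q : Type u} [AddCommGroup Q]
    [Module R Q] (hQ : IsGorensteinFlat R Q) : HasRightRes R E Q := by
  obtain ⟨w⟩ := hQ
  let := w.instAdd
  let := w.instMod
  have hfl := w.flat
  refine ⟨fun X _ _ => ∃ j : ℤ, Nonempty (X ≃ₗ[R] LinearMap.range (w.d j)), ⟨0, w.iso⟩, ?_⟩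
  rintro X _ _ ⟨j, ⟨e⟩⟩
  refine ⟨(extVanish_range hE w.F w.d w.exact (w.exact_tensor E hE) j).of_equiv e.symm, ?_⟩
  obtain ⟨j, rfl⟩ : ∃ i, j = i + 1 := ⟨j - 1, by ring⟩
  refine ⟨w.F (j + 1), LinearMap.range (w.d j), inferInstance, inferInstance, inferInstance,
    inferInstance, (LinearMap.range (w.d (j + 1))).subtype ∘ₗ e.toLinearMap,
    (w.d j).rangeRestrict, hfl _, (Submodule.injective_subtype _).comp e.injective, ?_,
    (w.d j).surjective_rangeRestrict, j, ⟨LinearEquiv.refl R _⟩⟩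
  intro y
  rw [← (Submodule.injective_subtype _).eq_iff]
  have := w.exact j y
  simp only [Submodule.subtype_apply, LinearMap.codRestrict_apply, ZeroMemClass.coe_zero,
    LinearMap.rangeRestrict, Set.mem_range, LinearMap.comp_apply, LinearEquiv.coe_coe] at this ⊢
  rw [this]
  constructor
  · rintro ⟨a, rfl⟩
    exact ⟨e.symm ⟨_, a, rfl⟩, by simp⟩
  · rintro ⟨a, rfl⟩
    exact (e a).2

end Family

section Syzygies

variable (R : Type u) [CommRing R]

/-- `X` is an `i`-th syzygy of `M` in some flat resolution. -/
def IsFlatSyzygy : (i : ℕ) → (X M : Type u) → [AddCommGroup X] → [Module R X] →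
    [AddCommGroup M] → [Module R M] → Prop
  | 0, X, M, _, _, _, _ => Nonempty (X ≃ₗ[R] M)
  | i + 1, X, M, _, _, _, _ => ∃ (K G : Type u) (_ : AddCommGroup K) (_ : Module R K)
      (_ : AddCommGroup G) (_ : Module R G) (f : K →ₗ[R] G) (g : G →ₗ[R] M), Module.Flat R G ∧
      Function.Injective f ∧ Function.Exact f g ∧ Function.Surjective g ∧ IsFlatSyzygy i X K

variable (E : Type u) [AddCommGroup E] [Module R E]

/-- All flat syzygies of `M` from the `n`-th one on are orthogonal to `Hom(E, E)`, and their duals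
almost are. -/
def SyzygyBound (n : ℕ) (M : Type u) [AddCommGroup M] [Module R M] : Prop :=
  ∀ i, n ≤ i → ∀ (X : Type u) [AddCommGroup X] [Module R X], IsFlatSyzygy R i X M →
    ExtVanish R (E →ₗ[R] E) 0 X ∧ ExtVanish R (E →ₗ[R] E) 1 (X →ₗ[R] E →ₗ[R] E)

variable {R E}

theorem IsFlatSyzygy.hasRightRes (hE : Module.Injective R E) {i : ℕ} {X M : Type u}
    [AddCommGroup X] [Module R X] [AddCommGroup M] [Module R M] (h : IsFlatSyzygy R i X M)
    (hM : HasRightRes R E M) : HasRightRes R E X := by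
  induction i generalizing M with
  | zero =>
    obtain ⟨e⟩ := h
    exact hM.of_equiv e.symm
  | succ i ih =>
    obtain ⟨K, G, _, _, _, _, f, g, h1, h2, h3, h4, h5⟩ := h
    exact ih h5 (hM.syzygy hE f g h2 h3 h4)

variable [IsLocalRing R] [IsNoetherianRing R] {e₀ : E}

theorem SyzygyBound.of_extension (hE : IsMatlis R E e₀) {n : ℕ} {M Y G : Type u} [AddCommGroup M]
    [Module R M] [AddCommGroup Y] [Module R Y] [AddCommGroup G] [Module R G] [Module.Flat R G]
    (f : M →ₗ[R] Y) (g : Y →ₗ[R] G) (hf : Function.Injective f) (h : Function.Exact f g)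
    (hg : Function.Surjective g) (hM : SyzygyBound R E n M) : SyzygyBound R E n Y := by
  intro i hi X _ _ hX
  cases i with
  | zero =>
    obtain ⟨e⟩ := hX
    obtain ⟨h1, h2⟩ := hM 0 hi M ⟨LinearEquiv.refl R M⟩
    have hG : Module.Flat R (G →ₗ[R] E →ₗ[R] E) := flat_dual hE.inj
    refine ⟨(ExtVanish.mid f g hf h hg h1 (.of_flat hE.inj)).of_equiv e.symm, ?_⟩
    refine ExtVanish.of_equiv (e.symm.congrLeft (E →ₗ[R] E) R) ?_
    exact ExtVanish.mid (LinearMap.lcomp R (E →ₗ[R] E) g) (LinearMap.lcomp R (E →ₗ[R] E) f)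
      (lcomp_injective _ hg) (lcomp_exact _ _ h hg)
      (lcomp_surjective _ _ hf h hg (.of_flat hE.inj))
      ((ExtVanish.of_flat hE.inj).mono zero_le_one) h2
  | succ i =>
    obtain ⟨K, H, _, _, _, _, p, q, h1, h2, h3, h4, h5⟩ := hX
    obtain ⟨H', _, _, j, hj, hjex⟩ := exists_kernel (g ∘ₗ q)
    have hH' : Module.Flat R H' := flat_of_flat_of_flat j (g ∘ₗ q) hj hjex (hg.comp h4)
    obtain ⟨s, hs⟩ := exists_lift_of_exact f g hf h (q ∘ₗ j) (fun a =>
      hjex.apply_apply_eq_zero a)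
    obtain ⟨t, ht⟩ := exists_lift_of_exact j (g ∘ₗ q) hj hjex p (fun a => by
      simp [h3.apply_apply_eq_zero a])
    refine hM (i + 1) hi X ⟨K, H', _, _, _, _, t, s, hH', ?_, ?_, ?_, h5⟩
    · exact Function.Injective.of_comp (f := j) (by
        have : (j : H' → H) ∘ t = p := funext ht
        rw [this]; exact h2)
    · intro y
      rw [← map_eq_zero_iff f hf, hs, LinearMap.comp_apply, h3]
      constructor
      · rintro ⟨k, hk⟩
        exact ⟨k, hj (by rw [ht, hk])⟩
      · rintro ⟨k, rfl⟩
        exact ⟨k, (ht k).symm⟩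
    · intro m
      obtain ⟨y, hy⟩ := h4 (f m)
      obtain ⟨y, rfl⟩ := (hjex y).1 (by simp [hy, h.apply_apply_eq_zero])
      exact ⟨y, hf (by rw [hs]; exact hy)⟩

theorem IsFlatSyzygy.horseshoe (hE : IsMatlis R E e₀) {i : ℕ} {X X₁ Y Q : Type u}
    [AddCommGroup X] [Module R X] [AddCommGroup X₁] [Module R X₁] [AddCommGroup Y] [Module R Y]
    [AddCommGroup Q] [Module R Q] (hX : IsFlatSyzygy R i X X₁) (hQ : HasRightRes R E Q)
    (f : X₁ →ₗ[R] Y) (g : Y →ₗ[R] Q) (hf : Function.Injective f) (h : Function.Exact f g)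
    (hg : Function.Surjective g) :
    ∃ (Y' Q' : Type u) (_ : AddCommGroup Y') (_ : Module R Y') (_ : AddCommGroup Q')
      (_ : Module R Q') (f' : X →ₗ[R] Y') (g' : Y' →ₗ[R] Q'), Function.Injective f' ∧
      Function.Exact f' g' ∧ Function.Surjective g' ∧ HasRightRes R E Q' ∧
      IsFlatSyzygy R i Y' Y := by
  induction i generalizing X₁ Y Q with
  | zero =>
    obtain ⟨e⟩ := hX
    refine ⟨Y, Q, _, _, _, _, f ∘ₗ e.toLinearMap, g, hf.comp e.injective, ?_, hg, hQ,
      ⟨LinearEquiv.refl R Y⟩⟩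
    intro y
    rw [h y]
    simp only [LinearMap.coe_comp, LinearEquiv.coe_coe, Set.mem_range, Function.comp]
    exact e.surjective.exists
  | succ i ih =>
    obtain ⟨K, H, _, _, _, _, p, q, h1, h2, h3, h4, h5⟩ := hX
    obtain ⟨L, _, _, r, _, hr⟩ := exists_free_cover R Q
    obtain ⟨l, hl⟩ := Module.projective_lifting_property g r hg
    obtain ⟨Q₁, _, _, k, hk, hkex⟩ := exists_kernel r
    obtain ⟨Y₁, _, _, j, hj, hjex⟩ := exists_kernel (LinearMap.coprod (f ∘ₗ q) l)
    have hgl : ∀ x, g (l x) = r x := LinearMap.congr_fun hl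
    have hgf := h.apply_apply_eq_zero
    obtain ⟨s, hs⟩ := exists_lift_of_exact j _ hj hjex (LinearMap.inl R H L ∘ₗ p) (fun a => by
      simp [h3.apply_apply_eq_zero a])
    have hjex' : ∀ a, f (q (j a).1) + l (j a).2 = 0 := fun a => by
      simpa using hjex.apply_apply_eq_zero a
    obtain ⟨t, ht⟩ := exists_lift_of_exact k r hk hkex (LinearMap.snd R H L ∘ₗ j) (fun a => by
      have := congrArg g (hjex' a)
      simpa [hgl, hgf] using this)
    have hcov : Function.Surjective (LinearMap.coprod (f ∘ₗ q) l) := by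
      intro y
      obtain ⟨x, hx⟩ := hr (g y)
      obtain ⟨z, hz⟩ := (h (y - l x)).1 (by rw [map_sub, hgl, hx, sub_self])
      obtain ⟨w, rfl⟩ := h4 z
      exact ⟨(w, x), by simp [hz]⟩
    have hHL : Module.Flat R (H × L) := flat_mid (LinearMap.inl R H L) (LinearMap.snd R H L)
      LinearMap.inl_injective .inl_snd LinearMap.snd_surjective
    suffices hst : Function.Injective s ∧ Function.Exact s t ∧ Function.Surjective t by
      obtain ⟨Y', Q', _, _, _, _, f', g', e1, e2, e3, e4, e5⟩ := ih h5
        (hQ.syzygy hE.inj k r hk hkex hr) s t hst.1 hst.2.1 hst.2.2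
      exact ⟨Y', Q', _, _, _, _, f', g', e1, e2, e3, e4, Y₁, H × L, _, _, _, _, j, _,
        hHL, hj, hjex, hcov, e5⟩
    refine ⟨?_, ?_, ?_⟩
    · intro a b hab
      have := congrArg (fun y => (j y).1) hab
      simp only [hs] at this
      exact h2 (by simpa using this)
    · intro y
      constructor
      · intro hy
        have h0 : (j y).2 = 0 := by simpa [hy] using (ht y).symm
        have h00 := hjex' y
        rw [h0, map_zero, add_zero, map_eq_zero_iff f hf] at h00
        obtain ⟨x, hx⟩ := (h3 _).1 h00
        exact ⟨x, hj (by rw [hs]; ext <;> simp [hx, h0])⟩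
      · rintro ⟨x, rfl⟩
        exact hk (by rw [ht]; simp [hs])
    · intro a
      obtain ⟨x, hx⟩ := (h (- l (k a))).1 (by
        rw [map_neg, hgl, hkex.apply_apply_eq_zero, neg_zero])
      obtain ⟨w, rfl⟩ := h4 x
      obtain ⟨y, hy⟩ := (hjex (w, k a)).1 (by simp [hx])
      exact ⟨y, hk (by rw [ht]; simp [hy])⟩

theorem SyzygyBound.of_kernel (hE : IsMatlis R E e₀) {n : ℕ} {X₁ Y Q : Type u}
    [AddCommGroup X₁] [Module R X₁] [AddCommGroup Y] [Module R Y]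
    [AddCommGroup Q] [Module R Q] (hQ : HasRightRes R E Q)
    (f : X₁ →ₗ[R] Y) (g : Y →ₗ[R] Q) (hf : Function.Injective f) (h : Function.Exact f g)
    (hg : Function.Surjective g) (hY : SyzygyBound R E n Y) : SyzygyBound R E n X₁ := by
  intro i hi X _ _ hX
  obtain ⟨Y', Q', _, _, _, _, f', g', e1, e2, e3, e4, e5⟩ := hX.horseshoe hE hQ f g hf h hg
  obtain ⟨h1, h2⟩ := hY i hi Y' e5
  refine ⟨ExtVanish.left f' g' e1 e2 e3 h1 (e4.extVanish.mono zero_le_one), ?_⟩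
  exact ExtVanish.right (LinearMap.lcomp R (E →ₗ[R] E) g') (LinearMap.lcomp R (E →ₗ[R] E) f')
      (lcomp_injective _ e3) (lcomp_exact _ _ e2 e3)
      (lcomp_surjective _ _ e1 e2 e3 e4.extVanish) (e4.extVanish_dual hE) h2

theorem gfdLE.syzygyBound (hE : IsMatlis R E e₀) {n : ℕ} {M : Type u} [AddCommGroup M]
    [Module R M] (h : gfdLE R n M) : SyzygyBound R E n M := by
  induction n generalizing M with
  | zero =>
    intro i _ X _ _ hX
    have := hX.hasRightRes hE.inj (IsGorensteinFlat.hasRightRes hE.inj h)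
    exact ⟨this.extVanish, (this.extVanish_dual hE).mono zero_le_one⟩
  | succ n ih =>
    obtain ⟨⟨Q, π, hQ, hπ⟩, hc⟩ := h
    intro i hi X _ _ hX
    obtain ⟨i, rfl⟩ : ∃ k, i = k + 1 := ⟨i - 1, by omega⟩
    obtain ⟨K, G, _, _, _, _, p, q, h1, h2, h3, h4, h5⟩ := hX
    have hM' := ih hc
    obtain ⟨Y, _, _, j, hj, hjex⟩ := exists_kernel (LinearMap.coprod π (-q))
    have hY : ∀ y, π (j y).1 = q (j y).2 := fun y => by
      have := hjex.apply_apply_eq_zero y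
      simpa [add_neg_eq_zero] using this
    have hY' : ∀ a b, π a = q b → ∃ y, j y = (a, b) := fun a b hab =>
      (hjex (a, b)).1 (by simp [hab])
    obtain ⟨s, hs⟩ := exists_lift_of_exact j _ hj hjex
      (LinearMap.inl R Q G ∘ₗ (LinearMap.ker π).subtype) (fun a => by simp)
    obtain ⟨t, ht⟩ := exists_lift_of_exact j _ hj hjex
      (LinearMap.inr R Q G ∘ₗ p) (fun a => by simp [h3.apply_apply_eq_zero a])
    have hYb : SyzygyBound R E n Y := by
      refine SyzygyBound.of_extension (M := LinearMap.ker π) hE s (LinearMap.snd R Q G ∘ₗ j)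
        ?_ ?_ ?_ hM'
      · intro a b hab
        have := congrArg (fun y => (j y).1) hab
        simp only [hs] at this
        exact Subtype.ext (by simpa using this)
      · intro y
        constructor
        · intro hy
          have hy : (j y).2 = 0 := hy
          refine ⟨⟨(j y).1, by rw [LinearMap.mem_ker, hY, hy, map_zero]⟩, hj ?_⟩
          rw [hs]
          ext <;> simp [hy]
        · rintro ⟨x, rfl⟩
          simp [hs]
      · intro b
        obtain ⟨a, ha⟩ := hπ (q b)
        obtain ⟨y, hy⟩ := hY' a b ha
        exact ⟨y, by simp [hy]⟩
    refine SyzygyBound.of_kernel hE (IsGorensteinFlat.hasRightRes hE.inj hQ) t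
      (LinearMap.fst R Q G ∘ₗ j) ?_ ?_ ?_ hYb i (by omega) X h5
    · intro a b hab
      have := congrArg (fun y => (j y).2) hab
      simp only [ht] at this
      exact h2 (by simpa using this)
    · intro y
      constructor
      · intro hy
        have hy : (j y).1 = 0 := hy
        obtain ⟨x, hx⟩ := (h3 (j y).2).1 (by rw [← hY, hy, map_zero])
        exact ⟨x, hj (by rw [ht]; ext <;> simp [hy, hx])⟩
      · rintro ⟨x, rfl⟩
        simp [ht]
    · intro a
      obtain ⟨b, hb⟩ := h4 (π a)
      obtain ⟨y, hy⟩ := hY' a b hb.symm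
      exact ⟨y, by simp [hy]⟩

end Syzygies

section MatAct

variable {S : Type u} [CommRing S]

/-- The action of a matrix on tuples of elements of a module. -/
def matAct (X : Type u) [AddCommGroup X] [Module S X] {m n : ℕ} (A : Matrix (Fin m) (Fin n) S) :
    (Fin n → X) →ₗ[S] (Fin m → X) :=
  LinearMap.pi fun i => ∑ j, A i j • LinearMap.proj j

/-- Exactness at the middle of `Xⁿ → Xᵐ → Xˡ`. -/
def MatExact (X : Type u) [AddCommGroup X] [Module S X] {l m n : ℕ} (A : Matrix (Fin l) (Fin m) S)
    (B : Matrix (Fin m) (Fin n) S) : Prop :=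
  ∀ v : Fin m → X, matAct X A v = 0 → ∃ w, matAct X B w = v

variable {X Y : Type u} [AddCommGroup X] [Module S X] [AddCommGroup Y] [Module S Y] {l m n : ℕ}

@[simp]
theorem matAct_apply (A : Matrix (Fin m) (Fin n) S) (v : Fin n → X) (i : Fin m) :
    matAct X A v i = ∑ j, A i j • v j := by
  simp [matAct]

theorem matAct_mul (A : Matrix (Fin l) (Fin m) S) (B : Matrix (Fin m) (Fin n) S) (v : Fin n → X) :
    matAct X A (matAct X B v) = matAct X (A * B) v := by
  ext i
  simp only [matAct_apply, Matrix.mul_apply, Finset.smul_sum, Finset.sum_smul, smul_smul]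
  exact Finset.sum_comm

theorem matAct_zero : matAct X (0 : Matrix (Fin m) (Fin n) S) = 0 := by
  ext
  simp

theorem matAct_matAct_eq_zero {A : Matrix (Fin l) (Fin m) S} {B : Matrix (Fin m) (Fin n) S}
    (h : A * B = 0) (v : Fin n → X) : matAct X A (matAct X B v) = 0 := by
  rw [matAct_mul, h, matAct_zero, LinearMap.zero_apply]

theorem matAct_map (A : Matrix (Fin m) (Fin n) S) (q : X →ₗ[S] Y) (v : Fin n → X) :
    matAct Y A (fun j => q (v j)) = fun i => q (matAct X A v i) := by
  ext i
  simp

theorem matAct_single (A : Matrix (Fin m) (Fin n) S) (j : Fin n) (x : X) (i : Fin m) :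
    matAct X A (Pi.single j x) i = A i j • x := by
  rw [matAct_apply, Finset.sum_eq_single j]
  · simp
  · intro k _ hk
    simp [hk]
  · simp

theorem eq_zero_of_matAct {A : Matrix (Fin m) (Fin n) S}
    (h : ∀ v : Fin n → S, matAct S A v = 0) : A = 0 := by
  ext i j
  have := congrFun (h (Pi.single j 1)) i
  rw [matAct_single] at this
  simpa using this

theorem mul_eq_zero_of_matAct {A : Matrix (Fin l) (Fin m) S} {B : Matrix (Fin m) (Fin n) S}
    (h : ∀ v : Fin n → S, matAct S A (matAct S B v) = 0) : A * B = 0 :=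
  eq_zero_of_matAct fun v => by rw [← matAct_mul]; exact h v

theorem exists_matrix (f : (Fin n → S) →ₗ[S] (Fin m → S)) :
    ∃ A : Matrix (Fin m) (Fin n) S, matAct S A = f := by
  refine ⟨LinearMap.toMatrix' f, ?_⟩
  ext j i
  change matAct S _ (Pi.single j 1) i = f (Pi.single j 1) i
  rw [matAct_single, LinearMap.toMatrix'_apply]
  simp

/-- Duality into a module: exactness on a cyclic module `X` gives exactness of the transposed
sequence on `T`, if homomorphisms into `T` extend. -/
theorem MatExact.transpose {T : Type u} [AddCommGroup T] [Module S T] {A : Matrix (Fin l) (Fin m) S}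
    {B : Matrix (Fin m) (Fin n) S} (h : MatExact X A B) (q : S →ₗ[S] X)
    (hq : Function.Surjective q) (hT : ∀ s, q s = 0 → ∀ t : T, s • t = 0)
    (hext : ∀ (α : (Fin m → S) →ₗ[S] (Fin l → X)) (g : (Fin m → S) →ₗ[S] T),
      (∀ v, α v = 0 → g v = 0) → ∃ k : (Fin l → X) →ₗ[S] T, ∀ v, k (α v) = g v) :
    MatExact T B.transpose A.transpose := by
  intro t ht
  have hg : ∀ w : Fin n → S, ∑ i, matAct S B w i • t i = 0 := by
    intro w
    have h1 : ∑ i, matAct S B w i • t i = ∑ j, w j • matAct T B.transpose t j := by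
      simp only [matAct_apply, Finset.sum_smul, Finset.smul_sum, smul_smul, smul_eq_mul,
        Matrix.transpose_apply]
      rw [Finset.sum_comm]
      simp only [mul_comm]
    rw [h1, ht]
    simp
  obtain ⟨k, hk⟩ := hext (matAct X A ∘ₗ LinearMap.pi fun i => q ∘ₗ LinearMap.proj i)
    (∑ i, (LinearMap.proj i).smulRight (t i)) (by
      intro v hv
      obtain ⟨w, hw⟩ := h (fun i => q (v i)) hv
      choose w' hw' using fun j => hq (w j)
      have h2 : ∀ i, q (v i - matAct S B w' i) = 0 := by
        intro i
        have := congrFun (matAct_map B q w') i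
        simp only [hw', hw] at this
        rw [map_sub, ← this, sub_self]
      have h3 : ∀ i, v i • t i = matAct S B w' i • t i := fun i => by
        rw [← sub_eq_zero, ← sub_smul]
        exact hT _ (h2 i) _
      simp [h3]
      simpa using hg w')
  refine ⟨fun i => k (Pi.single i (q 1)), ?_⟩
  ext j
  have h4 := hk (Pi.single j 1)
  have h5 : (∑ i, (LinearMap.proj i).smulRight (t i) : (Fin m → S) →ₗ[S] T) (Pi.single j 1) =
      t j := by
    rw [LinearMap.sum_apply, Finset.sum_eq_single j]
    · simp
    · intro i _ hi
      simp [hi]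
    · simp
  rw [h5] at h4
  rw [← h4, matAct_apply]
  simp only [Matrix.transpose_apply, ← map_smul, ← map_sum]
  congr 1
  ext i
  have h6 : (LinearMap.pi fun i => q ∘ₗ LinearMap.proj i : (Fin m → S) →ₗ[S] (Fin m → X))
      (Pi.single j 1) = Pi.single j (q 1) := by
    ext i
    by_cases hi : i = j
    · subst hi; simp
    · simp [hi]
  rw [LinearMap.comp_apply, h6, matAct_single, Finset.sum_apply, Finset.sum_eq_single i]
  · simp
  · intro b _ hb
    simp [hb.symm]
  · simp

/-- The converse duality: exactness on `T` gives exactness of the transposed sequence on the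
cyclic module `X`, if `T` cogenerates. -/
theorem MatExact.transpose_of_cogenerator {T : Type u} [AddCommGroup T] [Module S T]
    {A : Matrix (Fin l) (Fin m) S} {B : Matrix (Fin m) (Fin n) S} (h : MatExact T A B)
    (q : S →ₗ[S] X) (hq : Function.Surjective q) (hT : ∀ s, q s = 0 → ∀ t : T, s • t = 0)
    (hcog : ∀ (N : Submodule S (Fin m → X)) (v : Fin m → X), v ∉ N →
      ∃ k : (Fin m → X) →ₗ[S] T, (∀ w ∈ N, k w = 0) ∧ k v ≠ 0) :
    MatExact X B.transpose A.transpose := by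
  intro v hv
  by_contra hne
  obtain ⟨k, hk, hkv⟩ := hcog (LinearMap.range (matAct X A.transpose)) v
    (fun ⟨w, hw⟩ => hne ⟨w, hw⟩)
  apply hkv
  obtain ⟨u, hu⟩ := h (fun i => k (Pi.single i (q 1))) (by
    ext i
    rw [Pi.zero_apply, ← hk _ ⟨Pi.single i (q 1), rfl⟩, matAct_apply]
    simp only [← map_smul, ← map_sum]
    congr 1
    ext j
    rw [matAct_single, Finset.sum_apply, Finset.sum_eq_single j]
    · simp
    · intro b _ hb
      simp [hb.symm]
    · simp)
  choose v' hv' using fun j => hq (v j)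
  have h1 : k v = ∑ i, v' i • k (Pi.single i (q 1)) := by
    simp only [← map_smul, ← map_sum]
    congr 1
    ext j
    rw [Finset.sum_apply, Finset.sum_eq_single j]
    · simp [← hv', ← map_smul]
    · intro b _ hb
      simp [hb.symm]
    · simp
  have h2 : ∀ i, k (Pi.single i (q 1)) = ∑ j, B i j • u j := fun i => by
    rw [← congrFun hu i, matAct_apply]
  rw [h1]
  simp only [h2, Finset.smul_sum, smul_smul]
  rw [Finset.sum_comm]
  refine Finset.sum_eq_zero fun j _ => ?_
  rw [← Finset.sum_smul]
  apply hT
  have h3 := congrFun hv j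
  rw [matAct_apply] at h3
  rw [map_sum, ← h3.trans (Pi.zero_apply j)]
  refine Finset.sum_congr rfl fun i _ => ?_
  rw [← hv', ← map_smul, Matrix.transpose_apply, smul_eq_mul, mul_comm]

end MatAct

section MatStep

variable {S : Type u} [CommRing S] {X Y : Type u} [AddCommGroup X] [Module S X] [AddCommGroup Y]
  [Module S Y] {x : S} (π : X →ₗ[S] Y)

theorem exists_smul_eq_of_pi (hker : ∀ v, π v = 0 ↔ ∃ w, x • w = v) {n : ℕ} (v : Fin n → X)
    (hv : ∀ i, π (v i) = 0) : ∃ w : Fin n → X, x • w = v := by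
  choose w hw using fun i => (hker (v i)).1 (hv i)
  exact ⟨w, funext hw⟩

theorem MatExact.of_quotient [IsLocalRing S] [IsNoetherianRing S] [Module.Finite S X]
    (hx : ∀ v : X, x • v = 0 → v = 0) (hxm : x ∈ maximalIdeal S)
    (hπ : Function.Surjective π) (hker : ∀ v, π v = 0 ↔ ∃ w, x • w = v) {l m n : ℕ}
    {A : Matrix (Fin l) (Fin m) S} {B : Matrix (Fin m) (Fin n) S} (hAB : A * B = 0)
    (h : MatExact Y A B) : MatExact X A B := by
  have hle : LinearMap.ker (matAct X A) ≤ LinearMap.range (matAct X B) := by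
    have hfg : (LinearMap.ker (matAct X A)).FG := IsNoetherian.noetherian _
    refine Submodule.le_of_le_smul_of_le_jacobson_bot (I := maximalIdeal S) hfg
      (IsLocalRing.maximalIdeal_le_jacobson _) ?_
    intro v hv
    obtain ⟨w, hw⟩ := h (fun i => π (v i)) (by
      rw [matAct_map, LinearMap.mem_ker.1 hv]
      ext; simp)
    choose w' hw' using fun j => hπ (w j)
    obtain ⟨u, hu⟩ := exists_smul_eq_of_pi π hker (v - matAct X B w') (fun i => by
      have := congrFun (matAct_map B π w') i
      simp only [hw', hw] at this
      rw [Pi.sub_apply, map_sub, ← this, sub_self])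
    have hu' : matAct X A u = 0 := by
      ext i
      apply hx
      have : x • matAct X A u = 0 := by
        rw [← map_smul, hu, map_sub, LinearMap.mem_ker.1 hv, matAct_matAct_eq_zero hAB, sub_zero]
      exact congrFun this i
    rw [show v = matAct X B w' + x • u by rw [hu]; abel]
    exact Submodule.add_mem_sup ⟨w', rfl⟩ (Submodule.smul_mem_smul hxm hu')
  exact fun v hv => hle hv

theorem MatExact.quotient (hx : ∀ v : X, x • v = 0 → v = 0)
    (hπ : Function.Surjective π) (hker : ∀ v, π v = 0 ↔ ∃ w, x • w = v) {k l m n : ℕ}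
    {D : Matrix (Fin k) (Fin l) S} {A : Matrix (Fin l) (Fin m) S} {B : Matrix (Fin m) (Fin n) S}
    (hDA : D * A = 0) (h₁ : MatExact X D A) (h₂ : MatExact X A B) : MatExact Y A B := by
  intro v hv
  choose v' hv' using fun j => hπ (v j)
  have hv'' : (fun j => π (v' j)) = v := funext hv'
  rw [← hv'', matAct_map] at hv
  obtain ⟨u, hu⟩ := exists_smul_eq_of_pi π hker (matAct X A v') (congrFun hv)
  obtain ⟨w, hw⟩ := h₁ u (by
    ext i
    apply hx
    have : x • matAct X D u = 0 := by
      rw [← map_smul, hu, matAct_matAct_eq_zero hDA]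
    exact congrFun this i)
  obtain ⟨z, hz⟩ := h₂ (v' - x • w) (by rw [map_sub, map_smul, hw, hu, sub_self])
  refine ⟨fun j => π (z j), ?_⟩
  rw [matAct_map, hz]
  ext i
  have : π (x • w i) = 0 := (hker _).2 ⟨_, rfl⟩
  simp [this, hv']

end MatStep

section Extension

variable {R S : Type u} [CommRing R] [CommRing S] [IsLocalRing R] [IsLocalRing S]
  [IsNoetherianRing S] [Algebra R S]
  {T : Type u} [AddCommGroup T] [Module S T] [Module R T] [IsScalarTower R S T]
  {J : Ideal S}

theorem exists_pow_smul_eq_zero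
    (hJ : maximalIdeal S ≤ (maximalIdeal R).map (algebraMap R S) ⊔ J)
    (htor : ∀ t : T, ∃ k : ℕ, ∀ a ∈ maximalIdeal R ^ k, a • t = 0)
    (hJT : ∀ s ∈ J, ∀ t : T, s • t = 0) (t : T) :
    ∃ k : ℕ, ∀ c ∈ maximalIdeal S ^ k, c • t = 0 := by
  let I : Ideal S := LinearMap.ker (LinearMap.toSpanSingleton S T t)
  have hI : ∀ a, a ∈ I ↔ a • t = 0 := fun a => by simp [I]
  have : maximalIdeal S ≤ I.radical := by
    refine hJ.trans (sup_le ?_ ?_)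
    · rw [Ideal.map_le_iff_le_comap]
      intro a ha
      obtain ⟨k, hk⟩ := htor t
      refine ⟨k, (hI _).2 ?_⟩
      rw [← map_pow, algebraMap_smul]
      exact hk _ (Ideal.pow_mem_pow ha k)
    · intro s hs
      exact Ideal.le_radical ((hI s).2 (hJT s hs t))
  obtain ⟨k, hk⟩ := Ideal.exists_pow_le_of_le_radical_of_fg this (IsNoetherian.noetherian _)
  exact ⟨k, fun a ha => (hI a).1 (hk ha)⟩

theorem exists_pow_smul_eq_zero_of_fg
    (htor : ∀ t : T, ∃ k : ℕ, ∀ c ∈ maximalIdeal S ^ k, c • t = 0) (N : Submodule S T) (hN : N.FG) :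
    ∃ k : ℕ, ∀ c ∈ maximalIdeal S ^ k, ∀ t ∈ N, c • t = 0 := by
  obtain ⟨s, rfl⟩ := hN
  choose k hk using htor
  refine ⟨s.sup k, fun c hc t ht => ?_⟩
  induction ht using Submodule.span_induction with
  | mem t ht => exact hk t c (Ideal.pow_le_pow_right (Finset.le_sup ht) hc)
  | zero => simp
  | add a b _ _ ha hb => rw [smul_add, ha, hb, add_zero]
  | smul r a _ ha => rw [smul_comm, ha, smul_zero]

/-- Relative injectivity: homomorphisms into an `R`-injective, `m`-torsion `S`-module `T` extend
from submodules of finite `S`-modules, as far as only modules killed by `J` are concerned. -/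
theorem exists_extension (hT : Module.Injective R T)
    (hJ : maximalIdeal S ≤ (maximalIdeal R).map (algebraMap R S) ⊔ J)
    (hRS : (maximalIdeal R).map (algebraMap R S) ≤ maximalIdeal S)
    (htor : ∀ t : T, ∃ k : ℕ, ∀ a ∈ maximalIdeal R ^ k, a • t = 0)
    (hJT : ∀ s ∈ J, ∀ t : T, s • t = 0)
    {P V : Type u} [AddCommGroup P] [Module S P] [AddCommGroup V] [Module S V] [Module.Finite S V]
    (hJV : ∀ s ∈ J, ∀ v : V, s • v = 0) (α : P →ₗ[S] V) (g : P →ₗ[S] T)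
    (hg : ∀ p, α p = 0 → g p = 0) : ∃ k : V →ₗ[S] T, ∀ p, k (α p) = g p := by
  have htor' := exists_pow_smul_eq_zero hJ htor hJT
  let f₀ : V →ₗ.[S] T := ⟨LinearMap.range α,
    (LinearMap.ker α).liftQ g (fun p hp => hg p hp) ∘ₗ α.quotKerEquivRange.symm.toLinearMap⟩
  have hf₀ : ∀ p (h : α p ∈ f₀.domain), f₀ ⟨α p, h⟩ = g p := by
    intro p h
    change (LinearMap.ker α).liftQ g (fun p hp => hg p hp) (α.quotKerEquivRange.symm ⟨α p, h⟩) = g p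
    have : α.quotKerEquivRange.symm ⟨α p, h⟩ = (LinearMap.ker α).mkQ p := by
      rw [LinearEquiv.symm_apply_eq]; rfl
    rw [this]
    exact Submodule.liftQ_apply _ _ _
  obtain ⟨Z, ⟨f, hf, rfl⟩, hmax⟩ := WellFounded.has_min
    (wellFounded_gt : WellFounded (α := Submodule S V) (· > ·))
    {Z | ∃ f : V →ₗ.[S] T, f₀ ≤ f ∧ f.domain = Z} ⟨_, f₀, le_rfl, rfl⟩
  have hglue : ∀ h : V →ₗ.[S] T, (∀ (a : f.domain) (b : h.domain), (a : V) = b → f a = h b) →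
      h.domain ≤ f.domain := by
    intro h hh
    by_contra hne
    refine hmax (f.sup h hh).domain ⟨_, hf.trans (f.left_le_sup h hh), rfl⟩ ?_
    refine lt_of_le_of_ne (f.left_le_sup h hh).1 fun he => hne ?_
    rw [he]
    exact (f.right_le_sup h hh).1
  have hdom : ∃ l : ℕ, maximalIdeal S ^ l • (⊤ : Submodule S V) ≤ f.domain := by
    obtain ⟨K, hK⟩ := exists_pow_smul_eq_zero_of_fg htor' (LinearMap.range f.toFun)
      (by
        have : Module.Finite S f.domain := Module.IsNoetherian.finite S _
        rw [LinearMap.range_eq_map]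
        exact Module.Finite.fg_top.map _)
    obtain ⟨k, hk⟩ := Ideal.exists_pow_inf_eq_pow_smul (maximalIdeal S) f.domain
    refine ⟨k + K, hglue ⟨_, 0⟩ ?_⟩
    rintro ⟨a, ha⟩ ⟨b, hb⟩ (rfl : a = b)
    change f ⟨a, ha⟩ = 0
    have h1 : a ∈ maximalIdeal S ^ K • f.domain := by
      have h2 := hk (k + K) (Nat.le_add_right _ _)
      rw [Nat.add_sub_cancel_left] at h2
      exact Submodule.smul_mono le_rfl inf_le_right (h2.le ⟨hb, ha⟩)
    have h3 : ∀ a (ha : a ∈ maximalIdeal S ^ K • f.domain), ∀ h : a ∈ f.domain, f ⟨a, h⟩ = 0 := by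
      intro a ha
      induction ha using Submodule.smul_induction_on' with
      | smul r hr n hn =>
        intro h
        have := f.map_smul r ⟨n, hn⟩
        exact this.trans (hK r hr _ ⟨_, rfl⟩)
      | add x hx y hy h1 h2 =>
        intro h
        have hx' := Submodule.smul_le_right hx
        have hy' := Submodule.smul_le_right hy
        have := f.map_add ⟨x, hx'⟩ ⟨y, hy'⟩
        rw [h1, h2, add_zero] at this
        exact this
    exact h3 a h1 ha
  have htop : f.domain = ⊤ := by
    by_contra hne
    obtain ⟨l, hl⟩ := hdom
    obtain ⟨s, hs, hns⟩ : ∃ s, s ∉ f.domain ∧ ∀ c ∈ maximalIdeal S, c • s ∈ f.domain := by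
      by_contra! hcon
      apply hne
      refine top_le_iff.1 (le_trans ?_ le_rfl)
      have : ∀ j ≤ l, maximalIdeal S ^ (l - j) • (⊤ : Submodule S V) ≤ f.domain := by
        intro j
        induction j with
        | zero => intro _; exact hl
        | succ j ih =>
          intro hj
          have ih := ih (by omega)
          intro v hv
          by_contra hv'
          obtain ⟨c, hc, hcv⟩ := hcon v hv'
          refine hcv (ih ?_)
          rw [show l - j = (l - (j + 1)) + 1 by omega, pow_succ', mul_smul]
          exact Submodule.smul_mem_smul hc hv
      simpa using this l le_rfl
    have hfe : ∀ a b (ha : a ∈ f.domain) (hb : b ∈ f.domain), a = b → f ⟨a, ha⟩ = f ⟨b, hb⟩ := by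
      rintro a b ha hb rfl; rfl
    have hfadd : ∀ a b c (ha : a ∈ f.domain) (hb : b ∈ f.domain) (hc : c ∈ f.domain),
        c = a + b → f ⟨c, hc⟩ = f ⟨a, ha⟩ + f ⟨b, hb⟩ := by
      rintro a b c ha hb hc rfl; exact f.map_add ⟨a, ha⟩ ⟨b, hb⟩
    have hfsmul : ∀ (r : S) a c (ha : a ∈ f.domain) (hc : c ∈ f.domain),
        c = r • a → f ⟨c, hc⟩ = r • f ⟨a, ha⟩ := by
      rintro r a c ha hc rfl; exact f.map_smul r ⟨a, ha⟩
    have hfz : ∀ a (ha : a ∈ f.domain), a = 0 → f ⟨a, ha⟩ = 0 := by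
      rintro a ha rfl; exact f.map_zero
    obtain ⟨h, hh⟩ := inj_ext hT (maximalIdeal R).subtype (Submodule.injective_subtype _)
      ({ toFun := fun a => f ⟨algebraMap R S a • s, hns _ (hRS (Ideal.mem_map_of_mem _ a.2))⟩
         map_add' := fun a b => hfadd _ _ _ _ _ _ (by simp [add_smul])
         map_smul' := fun r a => by
          rw [RingHom.id_apply, ← algebraMap_smul S r (f _)]
          exact hfsmul _ _ _ _ _ (by simp [mul_smul]) } : maximalIdeal R →ₗ[R] T)
    have hmem : ∀ c ∈ maximalIdeal S, c ∈ (maximalIdeal R).map (algebraMap R S) ⊔ J :=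
      fun c hc => hJ hc
    have key : ∀ c (hc : c ∈ maximalIdeal S), f ⟨c • s, hns c hc⟩ = c • h 1 := by
      have key1 : ∀ c (hc : c ∈ (maximalIdeal R).map (algebraMap R S)),
          f ⟨c • s, hns c (hRS hc)⟩ = c • h 1 := by
        intro c hc
        rw [Ideal.map] at hc
        induction hc using Submodule.span_induction with
        | mem c hc' =>
          obtain ⟨a, ha, rfl⟩ := hc'
          refine (hh ⟨a, ha⟩).symm.trans ?_
          rw [algebraMap_smul, ← h.map_smul, smul_eq_mul, mul_one]
          rfl
        | zero => exact (hfz _ _ (zero_smul _ _)).trans (zero_smul _ _).symm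
        | add a b ha hb h1 h2 =>
          exact (hfadd _ _ _ (hns a (hRS ha)) (hns b (hRS hb)) _ (add_smul a b s)).trans
            (by rw [h1 ha, h2 hb, add_smul])
        | smul r a ha h1 =>
          exact (hfsmul r _ _ (hns a (hRS ha)) _ (mul_smul r a s)).trans
            (by rw [h1 ha, smul_eq_mul, mul_smul])
      intro c hc
      obtain ⟨a, ha, b, hb, rfl⟩ := Submodule.mem_sup.1 (hmem c hc)
      exact (hfe _ (a • s) _ _ (by rw [add_smul, hJV b hb, add_zero])).trans
        ((key1 a ha).trans (by rw [add_smul, hJT b hb, add_zero]))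
    have hunit : ∀ c : S, c • s ∈ f.domain → c ∈ maximalIdeal S := by
      intro c hc
      by_contra hcn
      have hu : IsUnit c := by
        rwa [mem_maximalIdeal, mem_nonunits_iff, not_not] at hcn
      exact hs ((Submodule.smul_mem_iff_of_isUnit _ hu).1 hc)
    refine hs (hglue (LinearPMap.mkSpanSingleton' s (h 1) ?_) ?_
      (Submodule.mem_span_singleton_self s))
    · intro c hc
      have hc' := hunit c (by rw [hc]; exact zero_mem _)
      exact (key c hc').symm.trans (hfz _ _ hc)
    · rintro ⟨a, ha⟩ ⟨b, hb⟩ (rfl : a = b)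
      obtain ⟨c, rfl⟩ := Submodule.mem_span_singleton.1 hb
      rw [LinearPMap.mkSpanSingleton'_apply]
      exact key c (hunit c ha)
  refine ⟨f.toFun ∘ₗ LinearMap.codRestrict f.domain LinearMap.id (fun v => htop ▸ trivial), ?_⟩
  intro p
  rw [← hf₀ p ⟨p, rfl⟩]
  exact (hf.2 rfl).symm

/-- The same modules `T` cogenerate. -/
theorem exists_cogenerate (hT : Module.Injective R T)
    (hJ : maximalIdeal S ≤ (maximalIdeal R).map (algebraMap R S) ⊔ J)
    (hRS : (maximalIdeal R).map (algebraMap R S) ≤ maximalIdeal S)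
    (htor : ∀ t : T, ∃ k : ℕ, ∀ a ∈ maximalIdeal R ^ k, a • t = 0)
    (hJT : ∀ s ∈ J, ∀ t : T, s • t = 0) [Nontrivial T]
    {V : Type u} [AddCommGroup V] [Module S V] [Module.Finite S V]
    (hJV : ∀ s ∈ J, ∀ v : V, s • v = 0) (N : Submodule S V) (v : V) (hv : v ∉ N) :
    ∃ k : V →ₗ[S] T, (∀ w ∈ N, k w = 0) ∧ k v ≠ 0 := by
  obtain ⟨τ, hτ, hτn⟩ : ∃ τ : T, τ ≠ 0 ∧ ∀ c ∈ maximalIdeal S, c • τ = 0 := by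
    obtain ⟨t, ht⟩ := exists_ne (0 : T)
    obtain ⟨k, hk⟩ := exists_pow_smul_eq_zero hJ htor hJT t
    by_contra! hcon
    have : ∀ j, ∃ c ∈ maximalIdeal S ^ j, c • t ≠ 0 := by
      intro j
      induction j with
      | zero => exact ⟨1, by simp, by simpa using ht⟩
      | succ j ih =>
        obtain ⟨c, hc, hct⟩ := ih
        obtain ⟨b, hb, hbt⟩ := hcon _ hct
        exact ⟨b * c, by rw [pow_succ']; exact Ideal.mul_mem_mul hb hc, by rwa [mul_smul]⟩
    obtain ⟨c, hc, hct⟩ := this k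
    exact hct (hk c hc)
  obtain ⟨k, hk⟩ := exists_extension hT hJ hRS htor hJT (V := V ⧸ N)
    (fun s hs v => by
      obtain ⟨v, rfl⟩ := N.mkQ_surjective v
      rw [← map_smul, hJV s hs, map_zero])
    (LinearMap.toSpanSingleton S _ (N.mkQ v)) (LinearMap.toSpanSingleton S T τ) (by
      intro c hc
      refine hτn c ?_
      by_contra hcn
      have hu : IsUnit c := by
        rwa [mem_maximalIdeal, mem_nonunits_iff, not_not] at hcn
      rw [LinearMap.toSpanSingleton_apply, ← map_smul, Submodule.mkQ_apply,
        Submodule.Quotient.mk_eq_zero] at hc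
      exact hv ((Submodule.smul_mem_iff_of_isUnit _ hu).1 hc))
  refine ⟨k ∘ₗ N.mkQ, fun w hw => ?_, ?_⟩
  · rw [LinearMap.comp_apply, Submodule.mkQ_apply, (Submodule.Quotient.mk_eq_zero N).2 hw, map_zero]
  · have := hk 1
    rw [LinearMap.toSpanSingleton_apply, one_smul, LinearMap.toSpanSingleton_apply,
      one_smul] at this
    rw [LinearMap.comp_apply, this]
    exact hτ

end Extension

section HomExact

variable {R S : Type u} [CommRing R] [CommRing S] [Algebra R S]

/-- Exactness in the middle of the sequence obtained from `Xⁿ → Xᵐ → Xˡ` by applying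
`Hom_R(-, C)`. -/
def HomExact (R : Type u) {S : Type u} [CommRing R] [CommRing S] (C X : Type u)
    [AddCommGroup C] [Module R C] [AddCommGroup X] [Module S X]
    [Module R X] {l m n : ℕ} (A : Matrix (Fin l) (Fin m) S) (B : Matrix (Fin m) (Fin n) S) : Prop :=
  ∀ φ : (Fin m → X) →ₗ[R] C, (∀ v, φ (matAct X B v) = 0) →
    ∃ ψ : (Fin l → X) →ₗ[R] C, ∀ v, ψ (matAct X A v) = φ v

variable {E X : Type u} [AddCommGroup E] [Module R E] [AddCommGroup X] [Module S X] [Module R X]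
  [IsScalarTower R S X] {l m n : ℕ}

theorem exists_tensor_pairing (φ : (Fin n → X) →ₗ[R] E →ₗ[R] E) :
    ∃ θ : (Fin n → X ⊗[R] E) →ₗ[R] E, ∀ v e, θ (fun i => v i ⊗ₜ e) = φ v e := by
  refine ⟨∑ i, TensorProduct.lift (φ ∘ₗ LinearMap.single R (fun _ => X) i) ∘ₗ LinearMap.proj i,
    fun v e => ?_⟩
  simp only [LinearMap.coe_sum, Finset.sum_apply, LinearMap.comp_apply, LinearMap.proj_apply,
    TensorProduct.lift.tmul]
  rw [← LinearMap.sum_apply, ← map_sum]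
  congr 2
  exact LinearMap.sum_single_apply _ v

theorem exists_of_tensor_pairing (θ : (Fin n → X ⊗[R] E) →ₗ[R] E) :
    ∃ φ : (Fin n → X) →ₗ[R] E →ₗ[R] E, ∀ v e, θ (fun i => v i ⊗ₜ e) = φ v e := by
  refine ⟨LinearMap.mk₂ R (fun v e => θ (fun i => v i ⊗ₜ e)) ?_ ?_ ?_ ?_, fun _ _ => rfl⟩
  · intro a b e
    rw [← map_add]
    congr 1
    ext i
    simp [TensorProduct.add_tmul]
  · intro c a e
    rw [← map_smul]
    congr 1
  · intro a b e
    rw [← map_add]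
    congr 1
    ext i
    simp [TensorProduct.tmul_add]
  · intro c a e
    rw [← map_smul]
    congr 1
    ext i
    simp

theorem eq_of_tensor_pairing {θ θ' : (Fin n → X ⊗[R] E) →ₗ[R] E}
    (h : ∀ (v : Fin n → X) (e : E), θ (fun i => v i ⊗ₜ e) = θ' (fun i => v i ⊗ₜ e)) : θ = θ' := by
  refine LinearMap.pi_ext' fun i => TensorProduct.ext' fun x e => ?_
  have h1 : ∀ (x : X) (e : E), (Pi.single i (x ⊗ₜ[R] e) : Fin n → X ⊗[R] E) =
      fun j => (Pi.single i x : Fin n → X) j ⊗ₜ[R] e := by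
    intro x e
    ext j
    by_cases hj : j = i
    · subst hj; simp
    · simp [hj]
  simp only [LinearMap.comp_apply, LinearMap.coe_single, h1]
  exact h _ _

theorem matAct_tmul (B : Matrix (Fin m) (Fin n) S) (v : Fin n → X) (e : E) :
    matAct (X ⊗[R] E) B (fun j => v j ⊗ₜ e) = fun i => matAct X B v i ⊗ₜ[R] e :=
  matAct_map B ((TensorProduct.AlgebraTensorModule.mk R S X E).flip e) v

theorem HomExact.matExact [IsLocalRing R] {e₀ : E} (hE : IsMatlis R E e₀)
    {A : Matrix (Fin l) (Fin m) S} {B : Matrix (Fin m) (Fin n) S}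
    (h : HomExact R (E →ₗ[R] E) X A B) : MatExact (X ⊗[R] E) A B := by
  intro t ht
  by_contra hne
  obtain ⟨θ, hθ, hθt⟩ := hE.exists_separating
    (LinearMap.range ((matAct (X ⊗[R] E) B).restrictScalars R)) t (fun ⟨w, hw⟩ => hne ⟨w, hw⟩)
  obtain ⟨φ, hφ⟩ := exists_of_tensor_pairing θ
  obtain ⟨ψ, hψ⟩ := h φ (fun v => by
    ext e
    rw [← hφ, ← matAct_tmul]
    exact hθ _ ⟨_, rfl⟩)
  obtain ⟨θ', hθ'⟩ := exists_tensor_pairing ψ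
  have : θ = θ' ∘ₗ (matAct (X ⊗[R] E) A).restrictScalars R := by
    refine eq_of_tensor_pairing fun v e => ?_
    rw [hφ, LinearMap.comp_apply, LinearMap.restrictScalars_apply, matAct_tmul, hθ', hψ]
  apply hθt
  rw [this, LinearMap.comp_apply, LinearMap.restrictScalars_apply, ht, map_zero]

theorem MatExact.homExact (hE : Module.Injective R E)
    {A : Matrix (Fin l) (Fin m) S} {B : Matrix (Fin m) (Fin n) S}
    (h : MatExact (X ⊗[R] E) A B) : HomExact R (E →ₗ[R] E) X A B := by
  intro φ hφ
  obtain ⟨θ, hθ⟩ := exists_tensor_pairing φ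
  have hB : θ ∘ₗ (matAct (X ⊗[R] E) B).restrictScalars R = 0 := by
    refine eq_of_tensor_pairing fun v e => ?_
    rw [LinearMap.comp_apply, LinearMap.restrictScalars_apply, matAct_tmul, hθ, hφ]
    rfl
  obtain ⟨θ', hθ'⟩ := inj_factor hE ((matAct (X ⊗[R] E) A).restrictScalars R) θ (by
    intro t ht
    obtain ⟨w, rfl⟩ := h t ht
    exact LinearMap.congr_fun hB w)
  obtain ⟨ψ, hψ⟩ := exists_of_tensor_pairing θ'
  refine ⟨ψ, fun v => ?_⟩
  ext e
  rw [← hψ, ← matAct_tmul, ← hθ]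
  exact hθ' _

theorem tensor_torsion [IsLocalRing R] [IsNoetherianRing R] {e₀ : E}
    (hE : IsMatlis R E e₀) (t : X ⊗[R] E) :
    ∃ k : ℕ, ∀ a ∈ maximalIdeal R ^ k, a • t = 0 := by
  induction t with
  | zero => exact ⟨0, by simp⟩
  | tmul x e =>
    obtain ⟨k, hk⟩ := hE.torsion e
    exact ⟨k, fun a ha => by rw [← TensorProduct.tmul_smul, hk a ha, TensorProduct.tmul_zero]⟩
  | add s t hs ht =>
    obtain ⟨k, hk⟩ := hs
    obtain ⟨l, hl⟩ := ht
    exact ⟨max k l, fun a ha => by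
      rw [smul_add, hk a (Ideal.pow_le_pow_right (le_max_left _ _) ha),
        hl a (Ideal.pow_le_pow_right (le_max_right _ _) ha), add_zero]⟩

theorem tensor_smul_eq_zero {s : S} (h : ∀ x : X, s • x = 0) (t : X ⊗[R] E) : s • t = 0 := by
  induction t with
  | zero => simp
  | tmul x e => rw [TensorProduct.smul_tmul', h, TensorProduct.zero_tmul]
  | add s t hs ht => rw [smul_add, hs, ht, add_zero]

theorem tensor_nontrivial [IsLocalRing R] [IsLocalRing S] [Module.Finite S X] [Nontrivial X]
    [Module.Flat R X] [Nontrivial E]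
    (hRS : (maximalIdeal R).map (algebraMap R S) ≤ maximalIdeal S) : Nontrivial (X ⊗[R] E) := by
  have : Module.FaithfullyFlat R X := by
    refine ⟨fun {m} hm htop => ?_⟩
    rw [IsLocalRing.eq_maximalIdeal hm] at htop
    have h1 : (⊤ : Submodule S X) ≤ maximalIdeal S • ⊤ := by
      intro x _
      have hx : x ∈ maximalIdeal R • (⊤ : Submodule R X) := by rw [htop]; trivial
      induction hx using Submodule.smul_induction_on' with
      | smul r hr y hy =>
        rw [← algebraMap_smul S r y]
        exact Submodule.smul_mem_smul (hRS (Ideal.mem_map_of_mem _ hr)) trivial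
      | add a _ b _ ha hb => exact add_mem (ha trivial) (hb trivial)
    have h2 := Submodule.le_of_le_smul_of_le_jacobson_bot (N := (⊥ : Submodule S X))
      (Module.Finite.fg_top (R := S) (M := X)) (IsLocalRing.maximalIdeal_le_jacobson _)
      (by rw [bot_sup_eq]; exact h1)
    obtain ⟨x, hx⟩ := exists_ne (0 : X)
    exact hx (by simpa using h2 (show x ∈ ⊤ from trivial))
  infer_instance

end HomExact

section FlatQuotient

variable {R : Type u} [CommRing R] {X : Type u} [AddCommGroup X] [Module R X]

theorem exists_sum_of_mem_smul_top {𝔟 : Ideal R} {v : X} (hv : v ∈ 𝔟 • (⊤ : Submodule R X)) :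
    ∃ (κ : Type u) (_ : Fintype κ) (b : κ → R) (y : κ → X), (∀ j, b j ∈ 𝔟) ∧
      ∑ j, b j • y j = v := by
  have hv' : v ∈ 𝔟 • Submodule.span R (Set.range (id : X → X)) := by simpa using hv
  obtain ⟨a, ha, rfl⟩ := (Submodule.mem_ideal_smul_span_iff_exists_sum _ _ _).1 hv'
  refine ⟨a.support, inferInstance, fun j => a j, fun j => j, fun j => ha j, ?_⟩
  rw [Finsupp.sum]
  exact Finset.sum_coe_sort a.support (fun j => a j • j)

/-- In a flat module, linear relations modulo an ideal come from relations in the ring. -/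
theorem mem_smul_top_of_sum [Module.Flat R X] {ι : Type*} [Fintype ι] {𝔟 𝔠 : Ideal R} (c : ι → R)
    (hc : ∀ r : ι → R, ∑ i, c i * r i ∈ 𝔟 → ∀ i, r i ∈ 𝔠) (w : ι → X)
    (hw : ∑ i, c i • w i ∈ 𝔟 • (⊤ : Submodule R X)) (i : ι) : w i ∈ 𝔠 • (⊤ : Submodule R X) := by
  obtain ⟨κ, _, b, y, hb, hy⟩ := exists_sum_of_mem_smul_top hw
  obtain ⟨k, a, z, haz, ha⟩ := Module.Flat.isTrivialRelation_of_sum_smul_eq_zero (R := R)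
    (f := Sum.elim c (fun j => - b j)) (x := Sum.elim w y) (by
      simp only [Fintype.sum_sum_type, Sum.elim_inl, Sum.elim_inr, neg_smul, Finset.sum_neg_distrib]
      rw [hy, add_neg_cancel])
  have h1 := haz (Sum.inl i)
  rw [Sum.elim_inl] at h1
  rw [h1]
  refine sum_mem fun j _ => Submodule.smul_mem_smul ?_ trivial
  refine hc (fun i => a (Sum.inl i) j) ?_ i
  have h2 := ha j
  simp only [Fintype.sum_sum_type, Sum.elim_inl, Sum.elim_inr, neg_mul,
    Finset.sum_neg_distrib] at h2
  rw [add_neg_eq_zero.1 h2]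
  exact sum_mem fun j _ => Ideal.mul_mem_right _ _ (hb j)

variable {S : Type u} [CommRing S] [Algebra R S] [Module S X] [IsScalarTower R S X]

theorem smul_mem_smul_top {𝔟 : Ideal R} (x : S) {v : X} (hv : v ∈ 𝔟 • (⊤ : Submodule R X)) :
    x • v ∈ 𝔟 • (⊤ : Submodule R X) := by
  induction hv using Submodule.smul_induction_on' with
  | smul r hr y hy => rw [smul_comm]; exact Submodule.smul_mem_smul hr trivial
  | add a _ b _ ha hb => rw [smul_add]; exact add_mem ha hb

variable [IsLocalRing R] [IsNoetherianRing R] [Module.Flat R X]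

theorem regular_mod_of_pow_le {x : S}
    (hx : ∀ v : X, x • v ∈ maximalIdeal R • (⊤ : Submodule R X) →
      v ∈ maximalIdeal R • (⊤ : Submodule R X))
    {k : ℕ} (𝔟 : Ideal R) (hk : maximalIdeal R ^ k ≤ 𝔟) (v : X)
    (hv : x • v ∈ 𝔟 • (⊤ : Submodule R X)) : v ∈ 𝔟 • (⊤ : Submodule R X) := by
  induction 𝔟 using WellFoundedGT.induction generalizing v with
  | ind 𝔟 ih =>
    by_cases htop : 𝔟 = ⊤
    · rw [htop, Submodule.top_smul]; trivial
    obtain ⟨c, hc, hcm⟩ : ∃ c, c ∉ 𝔟 ∧ ∀ a ∈ maximalIdeal R, a * c ∈ 𝔟 := by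
      by_contra! hcon
      have : ∀ j, ∃ c ∈ maximalIdeal R ^ j, c ∉ 𝔟 := by
        intro j
        induction j with
        | zero => exact ⟨1, by simp, fun h => htop ((Ideal.eq_top_iff_one _).2 h)⟩
        | succ j ihj =>
          obtain ⟨c, hc, hcb⟩ := ihj
          obtain ⟨a, ha, hab⟩ := hcon c hcb
          exact ⟨a * c, by rw [pow_succ']; exact Ideal.mul_mem_mul ha hc, hab⟩
      obtain ⟨c, hc, hcb⟩ := this k
      exact hcb (hk hc)
    have hlt : 𝔟 < 𝔟 ⊔ Ideal.span {c} := by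
      refine lt_of_le_of_ne le_sup_left fun he => hc ?_
      rw [he]
      exact Ideal.mem_sup_right (Ideal.mem_span_singleton_self c)
    have h1 := ih _ hlt (hk.trans le_sup_left) v (Submodule.smul_mono_left le_sup_left hv)
    rw [Submodule.sup_smul] at h1
    obtain ⟨b, hb, d, hd, rfl⟩ := Submodule.mem_sup.1 h1
    rw [Submodule.ideal_span_singleton_smul] at hd
    obtain ⟨u, -, rfl⟩ := Submodule.mem_smul_pointwise_iff_exists _ _ _ |>.1 hd
    refine add_mem hb ?_
    rw [smul_add] at hv
    have h2 := (Submodule.add_mem_iff_right _ (smul_mem_smul_top x hb)).1 hv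
    rw [smul_comm] at h2
    have h3 : x • u ∈ maximalIdeal R • (⊤ : Submodule R X) :=
      mem_smul_top_of_sum (𝔟 := 𝔟) (fun _ : Unit => c) (fun r hr i => by
        by_contra hri
        have hu : IsUnit (r i) := by
          rwa [mem_maximalIdeal, mem_nonunits_iff, not_not] at hri
        refine hc ((Ideal.mul_unit_mem_iff_mem _ hu).1 ?_)
        simpa using hr) (fun _ => x • u) (by simpa using h2) ()
    have h4 := hx u h3
    have : ∀ u ∈ maximalIdeal R • (⊤ : Submodule R X), c • u ∈ 𝔟 • (⊤ : Submodule R X) := by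
      intro u hu
      induction hu using Submodule.smul_induction_on' with
      | smul r hr y hy =>
        rw [smul_smul, mul_comm]
        exact Submodule.smul_mem_smul (hcm r hr) trivial
      | add a _ b _ ha hb => rw [smul_add]; exact add_mem ha hb
    exact this u h4

variable [IsLocalRing S] [IsNoetherianRing S] [Module.Finite S X]

theorem regular_mod {x : S} (hRS : (maximalIdeal R).map (algebraMap R S) ≤ maximalIdeal S)
    (hx : ∀ v : X, x • v ∈ maximalIdeal R • (⊤ : Submodule R X) →
      v ∈ maximalIdeal R • (⊤ : Submodule R X))
    (𝔞 : Ideal R) (v : X) (hv : x • v ∈ 𝔞 • (⊤ : Submodule R X)) :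
    v ∈ 𝔞 • (⊤ : Submodule R X) := by
  let N : Submodule S X :=
    { (𝔞 • (⊤ : Submodule R X)).toAddSubmonoid with
      smul_mem' := fun s w hw => smul_mem_smul_top s hw }
  have hN : ∀ w, w ∈ N ↔ w ∈ 𝔞 • (⊤ : Submodule R X) := fun w => Iff.rfl
  rw [← hN, ← Submodule.Quotient.mk_eq_zero, ← Submodule.mem_bot S,
    ← Ideal.iInf_pow_smul_eq_bot_of_isLocalRing (R := S) (M := X ⧸ N) (maximalIdeal S)
      (Ideal.IsPrime.ne_top inferInstance), Submodule.mem_iInf]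
  have hmk : ∀ k, ∀ b ∈ maximalIdeal R ^ k • (⊤ : Submodule R X),
      (Submodule.Quotient.mk b : X ⧸ N) ∈ maximalIdeal S ^ k • (⊤ : Submodule S (X ⧸ N)) := by
    intro k b hb
    induction hb using Submodule.smul_induction_on' with
    | smul r hr y hy =>
      rw [← algebraMap_smul S r y, Submodule.Quotient.mk_smul]
      refine Submodule.smul_mem_smul (Ideal.pow_right_mono hRS k ?_) trivial
      rw [← Ideal.map_pow]
      exact Ideal.mem_map_of_mem _ hr
    | add a _ b _ ha hb => rw [Submodule.Quotient.mk_add]; exact add_mem ha hb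
  intro k
  have h1 := regular_mod_of_pow_le hx (𝔞 ⊔ maximalIdeal R ^ k) le_sup_right v
    (Submodule.smul_mono_left le_sup_left hv)
  rw [Submodule.sup_smul] at h1
  obtain ⟨a, ha, b, hb, rfl⟩ := Submodule.mem_sup.1 h1
  rw [Submodule.Quotient.mk_add, (Submodule.Quotient.mk_eq_zero N).2 ha, zero_add]
  exact hmk k b hb

theorem regular_of_regular_mod {x : S}
    (hRS : (maximalIdeal R).map (algebraMap R S) ≤ maximalIdeal S)
    (hx : ∀ v : X, x • v ∈ maximalIdeal R • (⊤ : Submodule R X) →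
      v ∈ maximalIdeal R • (⊤ : Submodule R X)) (v : X) (hv : x • v = 0) : v = 0 := by
  have := regular_mod hRS hx ⊥ v (by rw [hv]; exact zero_mem _)
  simpa using this

theorem lift_lsmul_mem {Y : Type u} [AddCommGroup Y] [Module R Y] (𝔞 : Ideal R) (w : 𝔞 ⊗[R] Y) :
    TensorProduct.lift ((LinearMap.lsmul R Y).comp 𝔞.subtype) w ∈ 𝔞 • (⊤ : Submodule R Y) := by
  induction w with
  | zero => rw [map_zero]; exact zero_mem _
  | tmul a y => exact Submodule.smul_mem_smul a.2 trivial
  | add a b ha hb => rw [map_add]; exact add_mem ha hb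

theorem exists_lift_lsmul {Y : Type u} [AddCommGroup Y] [Module R Y] (𝔞 : Ideal R) {y : Y}
    (hy : y ∈ 𝔞 • (⊤ : Submodule R Y)) :
    ∃ w, TensorProduct.lift ((LinearMap.lsmul R Y).comp 𝔞.subtype) w = y := by
  induction hy using Submodule.smul_induction_on' with
  | smul r hr y hy => exact ⟨⟨r, hr⟩ ⊗ₜ y, rfl⟩
  | add a _ b _ ha hb =>
    obtain ⟨v, rfl⟩ := ha
    obtain ⟨w, rfl⟩ := hb
    exact ⟨v + w, map_add _ _ _⟩

theorem lift_lsmul_lTensor {Y Z : Type u} [AddCommGroup Y] [Module R Y] [AddCommGroup Z]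
    [Module R Z] (𝔞 : Ideal R) (g : Y →ₗ[R] Z) (w : 𝔞 ⊗[R] Y) :
    TensorProduct.lift ((LinearMap.lsmul R Z).comp 𝔞.subtype) (g.lTensor 𝔞 w) =
      g (TensorProduct.lift ((LinearMap.lsmul R Y).comp 𝔞.subtype) w) := by
  induction w with
  | zero => simp
  | tmul a y => simp
  | add a b ha hb => rw [map_add, map_add, ha, hb, map_add, map_add]

theorem flat_of_regular_mod {x : S}
    (hRS : (maximalIdeal R).map (algebraMap R S) ≤ maximalIdeal S)
    (hx : ∀ v : X, x • v ∈ maximalIdeal R • (⊤ : Submodule R X) →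
      v ∈ maximalIdeal R • (⊤ : Submodule R X))
    {Y : Type u} [AddCommGroup Y] [Module R Y] (π : X →ₗ[R] Y) (hπ : Function.Surjective π)
    (hker : ∀ v, π v = 0 ↔ ∃ w : X, x • w = v) : Module.Flat R Y := by
  rw [Module.Flat.iff_lift_lsmul_comp_subtype_injective]
  intro 𝔞 _
  rw [injective_iff_map_eq_zero]
  intro w hw
  obtain ⟨w', rfl⟩ := LinearMap.lTensor_surjective 𝔞 hπ w
  rw [lift_lsmul_lTensor] at hw
  obtain ⟨v, hv⟩ := (hker _).1 hw
  obtain ⟨v', rfl⟩ := exists_lift_lsmul 𝔞 (regular_mod hRS hx 𝔞 v (by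
    rw [hv]; exact lift_lsmul_mem 𝔞 w'))
  let ξ : X →ₗ[R] X := (LinearMap.lsmul S X x).restrictScalars R
  have h1 : ξ.lTensor 𝔞 v' = w' := by
    apply Module.Flat.iff_lift_lsmul_comp_subtype_injective.1 inferInstance
      (IsNoetherian.noetherian 𝔞)
    rw [lift_lsmul_lTensor]
    exact hv
  have h2 : π ∘ₗ ξ = 0 := LinearMap.ext fun u => (hker _).2 ⟨u, rfl⟩
  rw [← h1, ← LinearMap.comp_apply, ← LinearMap.lTensor_comp, h2, LinearMap.lTensor_zero,
    LinearMap.zero_apply]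

end FlatQuotient

section HomQuotient

variable {R S : Type u} [CommRing R] [CommRing S] [Algebra R S]
  {X Y : Type u} [AddCommGroup X] [Module S X] [Module R X] [IsScalarTower R S X]
  [AddCommGroup Y] [Module S Y] [Module R Y] [IsScalarTower R S Y]
  {x : S}

theorem flat_pi [Module.Flat R Y] (n : ℕ) : Module.Flat R (Fin n → Y) :=
  Module.Flat.of_linearEquiv (DirectSum.linearEquivFunOnFintype R (Fin n) (fun _ => Y)).symm

/-- The kernel of `Hom_R(Xˡ, C) → Hom_R(Xᵐ, C)`. -/
def homKer (R : Type u) {S : Type u} [CommRing R] [CommRing S] [Algebra R S] (C X : Type u)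
    [AddCommGroup C] [Module R C] [AddCommGroup X] [Module S X] [Module R X] [IsScalarTower R S X]
    {l m : ℕ} (A : Matrix (Fin l) (Fin m) S) : Submodule R ((Fin l → X) →ₗ[R] C) :=
  LinearMap.ker (LinearMap.lcomp R C ((matAct X A).restrictScalars R))

theorem mem_homKer {C : Type u} [AddCommGroup C] [Module R C] {l m : ℕ}
    {A : Matrix (Fin l) (Fin m) S} {φ : (Fin l → X) →ₗ[R] C} :
    φ ∈ homKer R C X A ↔ ∀ v, φ (matAct X A v) = 0 :=
  LinearMap.mem_ker.trans LinearMap.ext_iff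

/-- `π` is a quotient by the regular element `x`. -/
structure IsRegularQuotient (x : S) (π : X →ₗ[S] Y) : Prop where
  regular : ∀ v : X, x • v = 0 → v = 0
  surj : Function.Surjective π
  ker : ∀ v, π v = 0 ↔ ∃ w, x • w = v

namespace IsRegularQuotient

variable {π : X →ₗ[S] Y}

theorem pi_injective (h : IsRegularQuotient x π) (n : ℕ) :
    Function.Injective ((LinearMap.lsmul S (Fin n → X) x).restrictScalars R) := by
  rw [injective_iff_map_eq_zero]
  intro v hv
  ext i
  exact h.regular _ (congrFun hv i)

theorem pi_exact (h : IsRegularQuotient x π) (n : ℕ) :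
    Function.Exact ((LinearMap.lsmul S (Fin n → X) x).restrictScalars R)
      ((π.compLeft (Fin n)).restrictScalars R) := by
  intro v
  constructor
  · intro hv
    obtain ⟨w, hw⟩ := exists_smul_eq_of_pi π h.ker v (congrFun hv)
    exact ⟨w, hw⟩
  · rintro ⟨w, rfl⟩
    ext i
    exact (h.ker _).2 ⟨w i, rfl⟩

theorem pi_surjective (h : IsRegularQuotient x π) (n : ℕ) :
    Function.Surjective ((π.compLeft (Fin n)).restrictScalars R) := by
  intro y
  choose v hv using fun i => h.surj (y i)
  exact ⟨v, funext hv⟩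

theorem exists_div [Module.Flat R Y] {E : Type u} [AddCommGroup E] [Module R E]
    (h : IsRegularQuotient x π) (hE : Module.Injective R E) {n : ℕ}
    (φ : (Fin n → X) →ₗ[R] E →ₗ[R] E) :
    ∃ χ : (Fin n → X) →ₗ[R] E →ₗ[R] E, ∀ v, χ (x • v) = φ v := by
  have := flat_pi (R := R) (Y := Y) n
  obtain ⟨ψ, hψ⟩ := ExtVanish.extend _ _ (h.pi_injective (R := R) n) (h.pi_exact n)
    (h.pi_surjective n) (ExtVanish.of_flat hE) φ
  exact ⟨ψ, fun v => LinearMap.congr_fun hψ v⟩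

theorem exists_factor {C : Type u} [AddCommGroup C] [Module R C]
    (h : IsRegularQuotient x π) {n : ℕ} (ψ : (Fin n → X) →ₗ[R] C) (hψ : ∀ v, ψ (x • v) = 0) :
    ∃ ψ' : (Fin n → Y) →ₗ[R] C, ∀ v : Fin n → X, ψ' (fun i => π (v i)) = ψ v := by
  obtain ⟨ψ', hψ'⟩ := (lcomp_exact (C := C) _ _ (h.pi_exact (R := R) n) (h.pi_surjective n) ψ).1
    (LinearMap.ext hψ)
  exact ⟨ψ', fun v => LinearMap.congr_fun hψ' v⟩

variable [Module.Flat R Y] {E : Type u} [AddCommGroup E] [Module R E] {k l m n : ℕ}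
  {D : Matrix (Fin k) (Fin l) S} {A : Matrix (Fin l) (Fin m) S}

theorem homExact (h : IsRegularQuotient x π) (hE : Module.Injective R E)
    {B : Matrix (Fin m) (Fin n) S} (hDA : D * A = 0)
    (h₁ : HomExact R (E →ₗ[R] E) X D A) (h₂ : HomExact R (E →ₗ[R] E) X A B) :
    HomExact R (E →ₗ[R] E) Y A B := by
  intro φ hφ
  obtain ⟨ψ, hψ⟩ := h₂ (φ ∘ₗ (π.compLeft (Fin m)).restrictScalars R) (fun v => by
    rw [← hφ (fun i => π (v i)), matAct_map]
    rfl)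
  obtain ⟨χ, hχ⟩ := h₁ (ψ ∘ₗ (LinearMap.lsmul S (Fin l → X) x).restrictScalars R) (fun v => by
    change ψ (x • matAct X A v) = 0
    rw [← map_smul, hψ]
    change φ (fun i => π (x • v i)) = 0
    rw [← map_zero φ]
    congr 1
    ext i
    exact (h.ker _).2 ⟨_, rfl⟩)
  obtain ⟨χ', hχ'⟩ := h.exists_div hE χ
  obtain ⟨ψ', hψ'⟩ := h.exists_factor (ψ - χ' ∘ₗ (matAct X D).restrictScalars R) (fun v => by
    rw [LinearMap.sub_apply, LinearMap.comp_apply, LinearMap.restrictScalars_apply,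
      (matAct X D).map_smul, hχ',
      hχ, sub_eq_zero]
    rfl)
  refine ⟨ψ', fun y => ?_⟩
  obtain ⟨v, rfl⟩ := h.pi_surjective (R := R) m y
  change ψ' (matAct Y A (fun i => π (v i))) = _
  rw [matAct_map, hψ', LinearMap.sub_apply, LinearMap.comp_apply, LinearMap.restrictScalars_apply,
    matAct_matAct_eq_zero hDA, map_zero, sub_zero, hψ]
  rfl

theorem extVanish_homKer (h : IsRegularQuotient x π) (hE : Module.Injective R E) (hDA : D * A = 0)
    (h₁ : HomExact R (E →ₗ[R] E) X D A)
    (hA : ExtVanish R (E →ₗ[R] E) 1 (homKer R (E →ₗ[R] E) X A)) :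
    ExtVanish R (E →ₗ[R] E) 1 (homKer R (E →ₗ[R] E) Y A) := by
  have hι : ∀ φ ∈ homKer R (E →ₗ[R] E) Y A,
      LinearMap.lcomp R (E →ₗ[R] E) ((π.compLeft (Fin l)).restrictScalars R) φ ∈
        homKer R (E →ₗ[R] E) X A := by
    intro φ hφ
    rw [mem_homKer] at hφ ⊢
    intro v
    rw [← hφ (fun i => π (v i)), matAct_map]
    rfl
  have hξ : ∀ φ ∈ homKer R (E →ₗ[R] E) X A,
      LinearMap.lcomp R (E →ₗ[R] E) ((LinearMap.lsmul S (Fin l → X) x).restrictScalars R) φ ∈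
        homKer R (E →ₗ[R] E) X A := by
    intro φ hφ
    rw [mem_homKer] at hφ ⊢
    intro v
    rw [← hφ (x • v), map_smul]
    rfl
  refine ExtVanish.left (X := homKer R (E →ₗ[R] E) Y A) (Y := homKer R (E →ₗ[R] E) X A)
    (Z := homKer R (E →ₗ[R] E) X A) (LinearMap.restrict _ hι) (LinearMap.restrict _ hξ)
    ?_ ?_ ?_ hA (hA.mono one_le_two)
  · rintro ⟨a, ha⟩ ⟨b, hb⟩ hab
    exact Subtype.ext (lcomp_injective _ (h.pi_surjective l) (congrArg Subtype.val hab))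
  · rintro ⟨φ, hφ⟩
    constructor
    · intro h0
      obtain ⟨ψ, hψ⟩ := (lcomp_exact (C := E →ₗ[R] E) _ _ (h.pi_exact (R := R) l)
        (h.pi_surjective l) φ).1 (congrArg Subtype.val h0)
      refine ⟨⟨ψ, ?_⟩, Subtype.ext hψ⟩
      rw [mem_homKer] at hφ ⊢
      intro y
      obtain ⟨v, rfl⟩ := h.pi_surjective (R := R) m y
      rw [← hφ v, ← hψ]
      change ψ (matAct Y A (fun i => π (v i))) = _
      rw [matAct_map]
      rfl
    · rintro ⟨⟨ψ, hψ'⟩, hψ⟩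
      refine Subtype.ext ?_
      rw [← hψ]
      exact (lcomp_exact (C := E →ₗ[R] E) _ _ (h.pi_exact (R := R) l)
        (h.pi_surjective l) _).2 ⟨ψ, rfl⟩
  · rintro ⟨φ, hφ⟩
    obtain ⟨ψ, hψ⟩ := h₁ φ (mem_homKer.1 hφ)
    obtain ⟨χ, hχ⟩ := h.exists_div hE ψ
    refine ⟨⟨χ ∘ₗ (matAct X D).restrictScalars R, mem_homKer.2 fun v => ?_⟩, Subtype.ext ?_⟩
    · rw [LinearMap.comp_apply, LinearMap.restrictScalars_apply, matAct_matAct_eq_zero hDA,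
        map_zero]
    · refine LinearMap.ext fun v => ?_
      change χ (matAct X D (x • v)) = φ v
      rw [(matAct X D).map_smul, hχ, hψ]

end IsRegularQuotient

end HomQuotient

section Chain

variable {S : Type u} [CommRing S]

/-- `xs` is a weakly regular sequence modulo the ideal `J`. -/
def RegularMod : List S → Ideal S → Prop
  | [], _ => True
  | x :: xs, J => (∀ s, x * s ∈ J → s ∈ J) ∧ RegularMod xs (J ⊔ Ideal.span {x})

variable {R : Type u} [CommRing R] [Algebra R S]

/-- The transfer properties of exactness between a module `X` and its quotient `X'` by a regular
sequence of length `d`. -/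
structure ExactTransfer (R S C : Type u) [CommRing R] [CommRing S] [Algebra R S] [AddCommGroup C]
    [Module R C] (d : ℕ) (X X' : Type u) [AddCommGroup X] [Module S X] [Module R X]
    [IsScalarTower R S X] [AddCommGroup X'] [Module S X'] [Module R X'] [IsScalarTower R S X'] :
    Prop where
  hom : ∀ (r : ℕ → ℕ) (p : ∀ i, Matrix (Fin (r i)) (Fin (r (i + 1))) S),
    (∀ i, p i * p (i + 1) = 0) → ∀ N, (∀ i, N ≤ i → HomExact R C X (p i) (p (i + 1))) →
    ∀ i, N + d ≤ i → HomExact R C X' (p i) (p (i + 1))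
  far : ∀ (r : ℕ → ℕ) (p : ∀ i, Matrix (Fin (r i)) (Fin (r (i + 1))) S),
    (∀ i, p i * p (i + 1) = 0) → ∀ N, (∀ i, N ≤ i → HomExact R C X (p i) (p (i + 1))) →
    (∀ i, N ≤ i → ExtVanish R C 1 (homKer R C X (p i))) →
    ∀ i, N + d ≤ i → ExtVanish R C 1 (homKer R C X' (p i))
  down : ∀ {l m n : ℕ} (A : Matrix (Fin l) (Fin m) S) (B : Matrix (Fin m) (Fin n) S),
    A * B = 0 → MatExact X' A B → MatExact X A B
  up : ∀ (t : ℤ → ℕ) (B : ∀ i, Matrix (Fin (t i)) (Fin (t (i + 1))) S),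
    (∀ i, B i * B (i + 1) = 0) → (∀ i, MatExact X (B (i + 1)).transpose (B i).transpose) →
    ∀ i, MatExact X' (B (i + 1)).transpose (B i).transpose

section

variable {C : Type u} [AddCommGroup C] [Module R C] {X Y Z : Type u} [AddCommGroup X] [Module S X]
  [Module R X] [IsScalarTower R S X] [AddCommGroup Y] [Module S Y] [Module R Y]
  [IsScalarTower R S Y] [AddCommGroup Z] [Module S Z] [Module R Z] [IsScalarTower R S Z]

theorem ExactTransfer.refl : ExactTransfer R S C 0 X X :=
  ⟨fun _ _ _ _ h i hi => h i hi, fun _ _ _ _ _ h i hi => h i hi, fun _ _ _ h => h,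
    fun _ _ _ h => h⟩

theorem ExactTransfer.trans {d d' : ℕ} (h : ExactTransfer R S C d X Y)
    (h' : ExactTransfer R S C d' Y Z) : ExactTransfer R S C (d + d') X Z where
  hom r p hp N hN i hi := h'.hom r p hp (N + d) (h.hom r p hp N hN) i (by omega)
  far r p hp N hN hN' i hi :=
    h'.far r p hp (N + d) (h.hom r p hp N hN) (h.far r p hp N hN hN') i (by omega)
  down A B hAB hZ := h.down A B hAB (h'.down A B hAB hZ)
  up t B hB hX := h'.up t B hB (h.up t B hB hX)

theorem IsRegularQuotient.exactTransfer {E : Type u} [AddCommGroup E] [Module R E] {x : S}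
    {π : X →ₗ[S] Y} [IsLocalRing S] [IsNoetherianRing S] [Module.Finite S X] [Module.Flat R Y]
    (h : IsRegularQuotient x π) (hE : Module.Injective R E) (hxm : x ∈ maximalIdeal S) :
    ExactTransfer R S (E →ₗ[R] E) 1 X Y where
  hom r p hp N hN i hi := by
    obtain ⟨j, rfl⟩ : ∃ j, i = j + 1 := ⟨i - 1, by omega⟩
    exact h.homExact hE (hp j) (hN j (by omega)) (hN (j + 1) (by omega))
  far r p hp N hN hN' i hi := by
    obtain ⟨j, rfl⟩ : ∃ j, i = j + 1 := ⟨i - 1, by omega⟩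
    exact h.extVanish_homKer hE (hp j) (hN j (by omega)) (hN' (j + 1) (by omega))
  down A B hAB hY := hY.of_quotient π h.regular hxm h.surj h.ker hAB
  up t B hB hX i := by
    refine MatExact.quotient π h.regular h.surj h.ker ?_ (hX (i + 1)) (hX i)
    rw [← Matrix.transpose_mul, hB, Matrix.transpose_zero]

end

variable [IsLocalRing R] [IsNoetherianRing R] [IsLocalRing S] [IsNoetherianRing S]

theorem map_mem_smul_top_iff {X : Type u} [AddCommGroup X] [Module S X] [Module R X]
    [IsScalarTower R S X] (q : S →ₗ[S] X) (hq : Function.Surjective q) (𝔞 : Ideal R) (s : S) :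
    q s ∈ 𝔞 • (⊤ : Submodule R X) ↔ s ∈ LinearMap.ker q ⊔ 𝔞.map (algebraMap R S) := by
  constructor
  · have : ∀ v ∈ 𝔞 • (⊤ : Submodule R X), ∃ t ∈ 𝔞.map (algebraMap R S), q t = v := by
      intro v hv
      induction hv using Submodule.smul_induction_on' with
      | smul r hr y hy =>
        obtain ⟨t, rfl⟩ := hq y
        refine ⟨algebraMap R S r * t, Ideal.mul_mem_right _ _ (Ideal.mem_map_of_mem _ hr), ?_⟩
        rw [← smul_eq_mul, map_smul, algebraMap_smul]
      | add a _ b _ ha hb =>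
        obtain ⟨s, hs, rfl⟩ := ha
        obtain ⟨t, ht, rfl⟩ := hb
        exact ⟨s + t, add_mem hs ht, map_add _ _ _⟩
    intro hs
    obtain ⟨t, ht, hts⟩ := this _ hs
    rw [← sub_add_cancel s t]
    refine Submodule.add_mem_sup ?_ ht
    rw [LinearMap.mem_ker, map_sub, hts, sub_self]
  · intro hs
    obtain ⟨a, ha, b, hb, rfl⟩ := Submodule.mem_sup.1 hs
    rw [map_add, LinearMap.mem_ker.1 ha, zero_add]
    clear hs
    rw [Ideal.map] at hb
    induction hb using Submodule.span_induction with
    | mem c hc =>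
      obtain ⟨r, hr, rfl⟩ := hc
      rw [← mul_one (algebraMap R S r), ← smul_eq_mul, map_smul, algebraMap_smul]
      exact Submodule.smul_mem_smul hr trivial
    | zero => rw [map_zero]; exact zero_mem _
    | add c d _ _ hc hd => rw [map_add]; exact add_mem hc hd
    | smul r c _ hc => rw [map_smul]; exact smul_mem_smul_top r hc

theorem exists_exactTransfer {E : Type u} [AddCommGroup E] [Module R E]
    (hE : Module.Injective R E) (hRS : (maximalIdeal R).map (algebraMap R S) ≤ maximalIdeal S)
    (xs : List S) (hxs : ∀ x ∈ xs, x ∈ maximalIdeal S) (X : Type u) [AddCommGroup X] [Module S X]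
    [Module R X] [IsScalarTower R S X] [Module.Flat R X] (q : S →ₗ[S] X)
    (hq : Function.Surjective q)
    (hreg : RegularMod xs (LinearMap.ker q ⊔ (maximalIdeal R).map (algebraMap R S))) :
    ∃ (X' : Type u) (_ : AddCommGroup X') (_ : Module S X') (_ : Module R X')
      (_ : IsScalarTower R S X') (q' : S →ₗ[S] X'), Module.Flat R X' ∧ Function.Surjective q' ∧
      LinearMap.ker q' = LinearMap.ker q ⊔ Ideal.ofList xs ∧
      ExactTransfer R S (E →ₗ[R] E) xs.length X X' := by
  induction xs generalizing X with
  | nil =>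
    exact ⟨X, _, _, _, inferInstance, q, inferInstance, hq, by simp, ExactTransfer.refl⟩
  | cons x xs ih =>
    have : Module.Finite S X := Module.Finite.of_surjective q hq
    let Y := S ⧸ (LinearMap.ker q ⊔ Ideal.span {x} : Submodule S S)
    have hle : LinearMap.ker q ≤
        LinearMap.ker (LinearMap.ker q ⊔ Ideal.span {x} : Submodule S S).mkQ := by
      rw [Submodule.ker_mkQ]; exact le_sup_left
    let π : X →ₗ[S] Y :=
      (LinearMap.ker q).liftQ _ hle ∘ₗ (q.quotKerEquivOfSurjective hq).symm.toLinearMap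
    have hπq : ∀ s, π (q s) = (LinearMap.ker q ⊔ Ideal.span {x} : Submodule S S).mkQ s := by
      intro s
      have : (q.quotKerEquivOfSurjective hq).symm (q s) = (LinearMap.ker q).mkQ s := by
        rw [LinearEquiv.symm_apply_eq]; rfl
      change (LinearMap.ker q).liftQ _ hle ((q.quotKerEquivOfSurjective hq).symm (q s)) = _
      rw [this]
      exact Submodule.liftQ_apply _ _ _
    have hx : ∀ v : X, x • v ∈ maximalIdeal R • (⊤ : Submodule R X) →
        v ∈ maximalIdeal R • (⊤ : Submodule R X) := by
      intro v hv
      obtain ⟨s, rfl⟩ := hq v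
      rw [← map_smul, map_mem_smul_top_iff q hq] at hv
      rw [map_mem_smul_top_iff q hq]
      exact hreg.1 s hv
    have hquot : IsRegularQuotient x π := by
      refine ⟨regular_of_regular_mod hRS hx, ?_, ?_⟩
      · intro y
        obtain ⟨s, rfl⟩ := Submodule.mkQ_surjective _ y
        exact ⟨q s, hπq s⟩
      · intro v
        obtain ⟨s, rfl⟩ := hq v
        rw [hπq, ← LinearMap.mem_ker, Submodule.ker_mkQ]
        constructor
        · intro hs
          obtain ⟨a, ha, b, hb, rfl⟩ := Submodule.mem_sup.1 hs
          obtain ⟨t, rfl⟩ := Ideal.mem_span_singleton'.1 hb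
          refine ⟨q t, ?_⟩
          rw [map_add, LinearMap.mem_ker.1 ha, zero_add, ← map_smul, smul_eq_mul, mul_comm]
        · rintro ⟨w, hw⟩
          obtain ⟨t, rfl⟩ := hq w
          rw [← sub_add_cancel s (x * t)]
          refine Submodule.add_mem_sup ?_ (Ideal.mem_span_singleton'.2 ⟨t, mul_comm _ _⟩)
          rw [LinearMap.mem_ker, map_sub, ← hw, ← smul_eq_mul, map_smul, sub_self]
    have : Module.Flat R Y :=
      flat_of_regular_mod hRS hx (π.restrictScalars R) hquot.surj hquot.ker
    obtain ⟨X', i1, i2, i3, i4, q', hX', hq', hk, ht⟩ := ih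
      (fun y hy => hxs y (List.mem_cons_of_mem _ hy)) Y
      (LinearMap.ker q ⊔ Ideal.span {x} : Submodule S S).mkQ (Submodule.mkQ_surjective _) (by
        rw [Submodule.ker_mkQ, sup_right_comm]
        exact hreg.2)
    refine ⟨X', i1, i2, i3, i4, q', hX', hq', ?_, ?_⟩
    · rw [hk, Submodule.ker_mkQ, Ideal.ofList_cons, sup_assoc]
    · rw [List.length_cons, add_comm]
      exact (hquot.exactTransfer hE (hxs x List.mem_cons_self)).trans ht

end Chain

section LiftRegular

open scoped Pointwise

theorem regularMod_of_isWeaklyRegular {S : Type u} [CommRing S] {M : Type u} [AddCommGroup M]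
    [Module S M] (q : S →ₗ[S] M) (hq : Function.Surjective q) {J : Ideal S}
    (hJ : ∀ s, q s = 0 ↔ s ∈ J) {xs : List S} (h : RingTheory.Sequence.IsWeaklyRegular M xs) :
    RegularMod xs J := by
  induction xs generalizing M J with
  | nil => trivial
  | cons x xs ih =>
    obtain ⟨h1, h2⟩ := (RingTheory.Sequence.isWeaklyRegular_cons_iff M x xs).1 h
    refine ⟨fun s hs => ?_, ?_⟩
    · rw [← hJ] at hs ⊢
      rw [← smul_eq_mul, map_smul] at hs
      exact h1.right_eq_zero_of_smul hs
    · refine ih ((x • (⊤ : Submodule S M)).mkQ ∘ₗ q) ((Submodule.mkQ_surjective _).comp hq)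
        (fun s => ?_) h2
      rw [LinearMap.comp_apply, ← LinearMap.mem_ker, Submodule.ker_mkQ,
        Submodule.mem_smul_pointwise_iff_exists]
      constructor
      · rintro ⟨w, -, hw⟩
        obtain ⟨t, rfl⟩ := hq w
        rw [← sub_add_cancel s (x * t)]
        refine Submodule.add_mem_sup ((hJ _).1 ?_) (Ideal.mem_span_singleton'.2 ⟨t, mul_comm _ _⟩)
        rw [map_sub, ← hw, ← smul_eq_mul, map_smul, sub_self]
      · intro hs
        obtain ⟨a, ha, b, hb, rfl⟩ := Submodule.mem_sup.1 hs
        obtain ⟨t, rfl⟩ := Ideal.mem_span_singleton'.1 hb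
        refine ⟨q t, trivial, ?_⟩
        rw [map_add, (hJ a).2 ha, zero_add, ← map_smul, smul_eq_mul, mul_comm]

/-- A regular system of parameters of the fiber lifts to the total ring. -/
theorem exists_regularMod {S : Type u} [CommRing S] [IsLocalRing S] {J : Ideal S}
    {rs : List (S ⧸ J)}
    (hrs : RingTheory.Sequence.IsRegular (S ⧸ J) rs) [IsLocalRing (S ⧸ J)]
    (hspan : Ideal.span {x | x ∈ rs} = maximalIdeal (S ⧸ J)) :
    ∃ xs : List S, xs.length = rs.length ∧ (∀ x ∈ xs, x ∈ maximalIdeal S) ∧ RegularMod xs J ∧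
      maximalIdeal S = J ⊔ Ideal.ofList xs ∧ xs.map (Ideal.Quotient.mk J) = rs := by
  obtain ⟨xs, rfl⟩ := List.map_surjective_iff.2 (Ideal.Quotient.mk_surjective (I := J)) rs
  have hloc : (maximalIdeal (S ⧸ J)).comap (Ideal.Quotient.mk J) = maximalIdeal S :=
    IsLocalRing.eq_maximalIdeal
      (Ideal.comap_isMaximal_of_surjective _ Ideal.Quotient.mk_surjective)
  have hmem : ∀ x ∈ xs, x ∈ maximalIdeal S := by
    intro x hx
    rw [← hloc, Ideal.mem_comap, ← hspan]
    exact Ideal.subset_span (List.mem_map_of_mem hx)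
  have hJ : J ≤ maximalIdeal S := by
    rw [← hloc]
    intro s hs
    rw [Ideal.mem_comap, Ideal.Quotient.eq_zero_iff_mem.2 hs]
    exact zero_mem _
  refine ⟨xs, by simp, hmem, ?_, le_antisymm ?_ ?_, rfl⟩
  · exact regularMod_of_isWeaklyRegular (M := S ⧸ J) J.mkQ J.mkQ_surjective
      (fun s => by rw [← LinearMap.mem_ker, Submodule.ker_mkQ])
      ((RingTheory.Sequence.isWeaklyRegular_map_algebraMap_iff (S ⧸ J) (S ⧸ J) xs).1
        hrs.toIsWeaklyRegular)
  · rw [← hloc, ← hspan]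
    have : Ideal.span {x | x ∈ xs.map (Ideal.Quotient.mk J)} =
        (Ideal.ofList xs).map (Ideal.Quotient.mk J) := by
      rw [Ideal.map_ofList]
    rw [this, Ideal.comap_map_of_surjective _ Ideal.Quotient.mk_surjective, sup_comm]
    refine sup_le_sup_right ?_ _
    intro s hs
    simpa [Ideal.mem_comap, Ideal.Quotient.eq_zero_iff_mem] using hs
  · exact sup_le hJ (Ideal.span_le.2 hmem)

end LiftRegular

section EmbeddingDimension

theorem linearIndependent_toCotangent_iff {S : Type u} [CommRing S] [IsLocalRing S] {ι : Type*}
    [Fintype ι] (y : ι → maximalIdeal S) :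
    LinearIndependent (ResidueField S) (fun i => (maximalIdeal S).toCotangent (y i) :
        ι → CotangentSpace S) ↔
      ∀ c : ι → S, ∑ i, c i * (y i : S) ∈ maximalIdeal S ^ 2 → ∀ i, c i ∈ maximalIdeal S := by
  have key : ∀ c : ι → S, ∑ i, residue S (c i) •
      ((maximalIdeal S).toCotangent (y i) : CotangentSpace S) = 0 ↔
      ∑ i, c i * (y i : S) ∈ maximalIdeal S ^ 2 := by
    intro c
    have : ∑ i, residue S (c i) • ((maximalIdeal S).toCotangent (y i) : CotangentSpace S) =
        (maximalIdeal S).toCotangent (∑ i, c i • y i) := by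
      rw [map_sum]
      refine Finset.sum_congr rfl fun i _ => ?_
      rw [map_smul]
      exact algebraMap_smul (ResidueField S) (c i)
        ((maximalIdeal S).toCotangent (y i) : CotangentSpace S)
    rw [this, Ideal.toCotangent_eq_zero]
    simp
  rw [Fintype.linearIndependent_iff]
  constructor
  · intro h c hc i
    rw [← residue_eq_zero_iff]
    exact h (fun i => residue S (c i)) ((key c).2 hc) i
  · intro h g hg i
    choose c hc using fun i => residue_surjective (g i)
    obtain rfl : (fun i => residue S (c i)) = g := funext hc
    exact (residue_eq_zero_iff _).2 (h c ((key c).1 hg) i)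

/-- A regular system of parameters is linearly independent modulo the square of the maximal
ideal. -/
theorem mem_maximalIdeal_of_isRegular {A : Type u} [CommRing A] [IsLocalRing A] [IsNoetherianRing A]
    {rs : List A} (hrs : RingTheory.Sequence.IsRegular A rs)
    (hspan : Ideal.span {x | x ∈ rs} = maximalIdeal A) (c : Fin rs.length → A)
    (hc : ∑ i, c i * rs.get i ∈ maximalIdeal A ^ 2) (i : Fin rs.length) :
    c i ∈ maximalIdeal A := by
  have hmem : ∀ i, rs.get i ∈ maximalIdeal A := fun i => by
    rw [← hspan]; exact Ideal.subset_span (List.get_mem rs i)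
  have hdim : rs.length ≤ Module.finrank (ResidueField A) (CotangentSpace A) := by
    have h1 := ringKrullDim_add_length_eq_ringKrullDim_of_isRegular rs hrs
    have h2 := ringKrullDim_le_spanFinrank_maximalIdeal A
    rw [IsLocalRing.spanFinrank_maximalIdeal_eq_finrank_cotangentSpace, ← h1] at h2
    have h3 : (0 : WithBot ℕ∞) ≤ ringKrullDim (A ⧸ Ideal.ofList rs) := by
      have : Nontrivial (A ⧸ Ideal.ofList rs) := by
        refine Ideal.Quotient.nontrivial_iff.2 ?_
        have : Ideal.ofList rs = maximalIdeal A := hspan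
        rw [this]
        exact Ideal.IsPrime.ne_top'
      exact ringKrullDim_nonneg_of_nontrivial
    have h4 : (rs.length : WithBot ℕ∞) ≤
        (Module.finrank (ResidueField A) (CotangentSpace A) : WithBot ℕ∞) :=
      le_trans (by simpa using add_le_add_left h3 (rs.length : WithBot ℕ∞)) h2
    exact_mod_cast h4
  refine (linearIndependent_toCotangent_iff (fun i => ⟨rs.get i, hmem i⟩)).1 ?_ c hc i
  refine linearIndependent_of_top_le_span_of_card_le_finrank (top_le_iff.2 ?_) (by simpa using hdim)
  have hr : Set.range (fun i =>
        ((maximalIdeal A).toCotangent ⟨rs.get i, hmem i⟩ : CotangentSpace A)) =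
      (maximalIdeal A).toCotangent ''
        Set.range (fun i => (⟨rs.get i, hmem i⟩ : maximalIdeal A)) := by
    rw [← Set.range_comp]; rfl
  rw [hr, CotangentSpace.span_image_eq_top_iff]
  apply Submodule.map_injective_of_injective (maximalIdeal A).subtype_injective
  rw [Submodule.map_span, Submodule.map_top, Submodule.range_subtype, ← Set.range_comp]
  refine Eq.trans ?_ hspan
  refine congrArg (Submodule.span A) ?_
  ext x
  simp [List.mem_iff_get]

theorem sup_sq_le {S : Type u} [CommRing S] (J K : Ideal S) : (J ⊔ K) ^ 2 ≤ K ⊔ J ^ 2 := by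
  rw [pow_two, Ideal.mul_le]
  intro r hr s hs
  obtain ⟨a, ha, b, hb, rfl⟩ := Submodule.mem_sup.1 hr
  obtain ⟨c, hc, d, hd, rfl⟩ := Submodule.mem_sup.1 hs
  have : (a + b) * (c + d) = (b * (c + d) + a * d) + a * c := by ring
  rw [this]
  refine Submodule.add_mem_sup (add_mem (K.mul_mem_right _ hb) (K.mul_mem_left _ hd)) ?_
  rw [pow_two]
  exact Ideal.mul_mem_mul ha hc

theorem embDim_add_length_le {R S : Type u} [CommRing R] [CommRing S] [IsLocalRing R]
    [IsLocalRing S] [IsNoetherianRing R] [IsNoetherianRing S] [Algebra R S] [Module.Flat R S]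
    (hRS : (maximalIdeal R).map (algebraMap R S) ≤ maximalIdeal S)
    [IsLocalRing (S ⧸ (maximalIdeal R).map (algebraMap R S))]
    {rs : List (S ⧸ (maximalIdeal R).map (algebraMap R S))}
    (hrs : RingTheory.Sequence.IsRegular (S ⧸ (maximalIdeal R).map (algebraMap R S)) rs)
    (hspan : Ideal.span {x | x ∈ rs} = maximalIdeal (S ⧸ (maximalIdeal R).map (algebraMap R S))) :
    embDim R + rs.length ≤ embDim S := by
  set J := (maximalIdeal R).map (algebraMap R S) with hJ
  have hloc : (maximalIdeal (S ⧸ J)).comap (Ideal.Quotient.mk J) = maximalIdeal S :=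
    IsLocalRing.eq_maximalIdeal
      (Ideal.comap_isMaximal_of_surjective _ Ideal.Quotient.mk_surjective)
  obtain ⟨xs, -, hxs, hreg, hmax, rfl⟩ := exists_regularMod hrs hspan
  obtain ⟨E, _, _, e₀, hE⟩ := exists_isMatlis R
  obtain ⟨X, _, _, _, _, q, _, hq, hk, -⟩ := exists_exactTransfer hE.inj hRS xs hxs S LinearMap.id
    Function.surjective_id (by rwa [LinearMap.ker_id, bot_sup_eq])
  rw [LinearMap.ker_id, bot_sup_eq] at hk
  have hb := fun i => (maximalIdeal R).toCotangent_surjective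
    (Module.finBasis (ResidueField R) (CotangentSpace R) i)
  choose a ha using hb
  have hlin : LinearIndependent (ResidueField R) (fun i => (maximalIdeal R).toCotangent (a i) :
      _ → CotangentSpace R) := by
    have : (fun i => (maximalIdeal R).toCotangent (a i) : _ → CotangentSpace R) =
      Module.finBasis (ResidueField R) (CotangentSpace R) := funext ha
    rw [this]
    exact (Module.finBasis (ResidueField R) (CotangentSpace R)).linearIndependent
  rw [linearIndependent_toCotangent_iff] at hlin
  have haS : ∀ i, algebraMap R S (a i) ∈ J := fun i => Ideal.mem_map_of_mem _ (a i).2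
  let y : Fin (embDim R) ⊕ Fin xs.length → maximalIdeal S :=
    Sum.elim (fun i => ⟨algebraMap R S (a i), hRS (haS i)⟩)
      (fun j => ⟨xs.get j, hxs _ (List.get_mem xs j)⟩)
  have hy : LinearIndependent (ResidueField S) (fun i => (maximalIdeal S).toCotangent (y i) :
      _ → CotangentSpace S) := by
    rw [linearIndependent_toCotangent_iff]
    intro c hc
    rw [Fintype.sum_sum_type] at hc
    have ht : ∀ j, c (Sum.inr j) ∈ maximalIdeal S := by
      intro j
      have h1 : ∑ j : Fin (xs.map (Ideal.Quotient.mk J)).length,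
          Ideal.Quotient.mk J (c (Sum.inr (Fin.cast (by simp) j))) *
            (xs.map (Ideal.Quotient.mk J)).get j ∈ maximalIdeal (S ⧸ J) ^ 2 := by
        have h2 := Ideal.mem_map_of_mem (Ideal.Quotient.mk J) hc
        rw [Ideal.map_pow] at h2
        have h3 : (maximalIdeal S).map (Ideal.Quotient.mk J) ≤ maximalIdeal (S ⧸ J) :=
          Ideal.map_le_iff_le_comap.2 hloc.ge
        have h4 := Ideal.pow_right_mono h3 2 h2
        rw [map_add] at h4
        have h5 : Ideal.Quotient.mk J (∑ i, c (Sum.inl i) * (y (Sum.inl i) : S)) = 0 := by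
          rw [Ideal.Quotient.eq_zero_iff_mem]
          exact sum_mem fun i _ => Ideal.mul_mem_left _ _ (haS i)
        rw [h5, zero_add, map_sum] at h4
        convert h4 using 1
        refine Fintype.sum_equiv (finCongr (by simp)) _ _ fun j => ?_
        simp [y]
      have h2 := mem_maximalIdeal_of_isRegular hrs hspan _ h1 (Fin.cast (by simp) j)
      rw [← hloc]
      simpa [Ideal.mem_comap] using h2
    have hs : ∑ i, c (Sum.inl i) * algebraMap R S (a i) ∈ maximalIdeal S ^ 2 := by
      refine (Submodule.add_mem_iff_left _ ?_).1 hc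
      refine sum_mem fun j _ => ?_
      rw [pow_two]
      exact Ideal.mul_mem_mul (ht j) (y (Sum.inr j)).2
    have hsq : maximalIdeal S ^ 2 ≤
        LinearMap.ker q ⊔ (maximalIdeal R ^ 2).map (algebraMap R S) := by
      rw [Ideal.map_pow, ← hJ, hk, hmax]
      exact sup_sq_le J (Ideal.ofList xs)
    rintro (i | j)
    · have h1 := (map_mem_smul_top_iff q hq (maximalIdeal R ^ 2) _).2 (hsq hs)
      have h2 : q (∑ i, c (Sum.inl i) * algebraMap R S (a i)) =
          ∑ i, (a i : R) • q (c (Sum.inl i)) := by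
        rw [map_sum]
        refine Finset.sum_congr rfl fun i _ => ?_
        rw [mul_comm, ← smul_eq_mul, map_smul, algebraMap_smul]
      rw [h2] at h1
      have h3 := mem_smul_top_of_sum (𝔠 := maximalIdeal R) (fun i => (a i : R)) (fun r hr i => by
        refine hlin r ?_ i
        simpa only [mul_comm] using hr) _ h1 i
      rw [map_mem_smul_top_iff q hq, hk, sup_comm] at h3
      rw [hmax]
      exact h3
    · exact ht j
  have := hy.fintype_card_le_finrank
  rwa [Fintype.card_sum, Fintype.card_fin, Fintype.card_fin, ← List.length_map] at this

end EmbeddingDimension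

section Resolution

variable {S : Type u} [CommRing S]

/-- The cokernel of the map of free modules given by a matrix. -/
def matCoker {l m : ℕ} (A : Matrix (Fin l) (Fin m) S) : Type u :=
  (Fin l → S) ⧸ LinearMap.range (matAct S A)

instance {l m : ℕ} (A : Matrix (Fin l) (Fin m) S) : AddCommGroup (matCoker A) :=
  inferInstanceAs (AddCommGroup ((Fin l → S) ⧸ LinearMap.range (matAct S A)))

instance {R : Type u} [CommRing R] [Algebra R S] {l m : ℕ} (A : Matrix (Fin l) (Fin m) S) :
    Module R (matCoker A) :=
  inferInstanceAs (Module R ((Fin l → S) ⧸ LinearMap.range (matAct S A)))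

instance {R : Type u} [CommRing R] [Algebra R S] {l m : ℕ} (A : Matrix (Fin l) (Fin m) S) :
    IsScalarTower R S (matCoker A) :=
  inferInstanceAs (IsScalarTower R S ((Fin l → S) ⧸ LinearMap.range (matAct S A)))

/-- The projection onto the cokernel. -/
def cokerProj {l m : ℕ} (A : Matrix (Fin l) (Fin m) S) : (Fin l → S) →ₗ[S] matCoker A :=
  (LinearMap.range (matAct S A)).mkQ

theorem cokerProj_surjective {l m : ℕ} (A : Matrix (Fin l) (Fin m) S) :
    Function.Surjective (cokerProj A) :=
  Submodule.mkQ_surjective _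

theorem cokerProj_exact {l m : ℕ} (A : Matrix (Fin l) (Fin m) S) :
    Function.Exact (matAct S A) (cokerProj A) :=
  LinearMap.exact_iff.2 (Submodule.ker_mkQ _)

theorem exists_coker_lift {R : Type u} [CommRing R] [Algebra R S] {C : Type u} [AddCommGroup C]
    [Module R C] {l m : ℕ} (A : Matrix (Fin l) (Fin m) S) (φ : (Fin l → S) →ₗ[R] C)
    (hφ : ∀ v, φ (matAct S A v) = 0) :
    ∃ ψ : matCoker A →ₗ[R] C, ∀ v, ψ (cokerProj A v) = φ v := by
  let e := ((cokerProj A).restrictScalars R).quotKerEquivOfSurjective (cokerProj_surjective A)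
  have hle : LinearMap.ker ((cokerProj A).restrictScalars R) ≤ LinearMap.ker φ := by
    intro v hv
    obtain ⟨w, rfl⟩ := (cokerProj_exact A v).1 hv
    exact hφ w
  refine ⟨(LinearMap.ker ((cokerProj A).restrictScalars R)).liftQ φ hle ∘ₗ e.symm.toLinearMap,
    fun v => ?_⟩
  have : e.symm (cokerProj A v) = Submodule.Quotient.mk v := by
    rw [LinearEquiv.symm_apply_eq]
    rfl
  rw [LinearMap.comp_apply, LinearEquiv.coe_coe, this]
  rfl

variable {P : Type u} [AddCommGroup P] [Module S P]

theorem exists_matrix_exact [IsNoetherianRing S] {m : ℕ} (g : (Fin m → S) →ₗ[S] P) :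
    ∃ (n : ℕ) (B : Matrix (Fin m) (Fin n) S), Function.Exact (matAct S B) g := by
  have hfg : (LinearMap.ker g).FG := IsNoetherian.noetherian _
  obtain ⟨n, s, hs⟩ := Submodule.fg_iff_exists_fin_generating_family.1 hfg
  obtain ⟨B, hB⟩ := exists_matrix (Fintype.linearCombination S s)
  refine ⟨n, B, ?_⟩
  rw [LinearMap.exact_iff, hB, ← hs, Fintype.range_linearCombination]

/-- A resolution of the kernel of a map by finite free modules. -/
theorem exists_matrix_resolution [IsNoetherianRing S] {m : ℕ} (g : (Fin m → S) →ₗ[S] P) :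
    ∃ (s : ℕ → ℕ) (B : Matrix (Fin m) (Fin (s 0)) S)
      (q : ∀ i, Matrix (Fin (s i)) (Fin (s (i + 1))) S),
      Function.Exact (matAct S B) g ∧ Function.Exact (matAct S (q 0)) (matAct S B) ∧
      ∀ i, Function.Exact (matAct S (q (i + 1))) (matAct S (q i)) := by
  obtain ⟨n, B, hB⟩ := exists_matrix_exact g
  choose next mat hmat using fun (x : Σ l m : ℕ, Matrix (Fin l) (Fin m) S) =>
    exists_matrix_exact (matAct S x.2.2)
  let st : ℕ → Σ l m : ℕ, Matrix (Fin l) (Fin m) S :=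
    fun i => Nat.rec ⟨m, n, B⟩ (fun _ x => ⟨x.2.1, next x, mat x⟩) i
  exact ⟨fun i => (st i).2.1, B, fun i => (st (i + 1)).2.2, hB, hmat (st 0),
    fun i => hmat (st (i + 1))⟩

theorem exists_free_resolution [IsNoetherianRing S] [Module.Finite S P] :
    ∃ (r : ℕ → ℕ) (p : ∀ i, Matrix (Fin (r i)) (Fin (r (i + 1))) S),
      (∀ i, Function.Exact (matAct S (p (i + 1))) (matAct S (p i))) ∧
      Nonempty (matCoker (p 0) ≃ₗ[S] P) := by
  obtain ⟨k, g, hg⟩ := Module.Finite.exists_fin' S P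
  obtain ⟨s, B, q, h1, h2, h3⟩ := exists_matrix_resolution g
  let r : ℕ → ℕ
    | 0 => k
    | i + 1 => s i
  let p : ∀ i, Matrix (Fin (r i)) (Fin (r (i + 1))) S
    | 0 => B
    | i + 1 => q i
  refine ⟨r, p, ?_, ⟨(Submodule.quotEquivOfEq _ _ ?_).trans (g.quotKerEquivOfSurjective hg)⟩⟩
  · rintro (_ | i)
    · exact h2
    · exact h3 i
  · exact (LinearMap.exact_iff.1 h1).symm

theorem mul_eq_zero_of_exact {l m n : ℕ} {A : Matrix (Fin l) (Fin m) S}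
    {B : Matrix (Fin m) (Fin n) S} (h : Function.Exact (matAct S B) (matAct S A)) : A * B = 0 :=
  mul_eq_zero_of_matAct fun v => h.apply_apply_eq_zero v

theorem MatExact.exact {X : Type u} [AddCommGroup X] [Module S X] {l m n : ℕ}
    {A : Matrix (Fin l) (Fin m) S} {B : Matrix (Fin m) (Fin n) S} (h : MatExact X A B)
    (hAB : A * B = 0) : Function.Exact (matAct X B) (matAct X A) := by
  intro v
  constructor
  · exact h v
  · rintro ⟨w, rfl⟩
    exact matAct_matAct_eq_zero hAB w

/-- The cokernel of `B` embeds in the free module in which the next map takes values. -/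
theorem exists_cokerMap {l m n : ℕ} {A : Matrix (Fin l) (Fin m) S} {B : Matrix (Fin m) (Fin n) S}
    (h : Function.Exact (matAct S B) (matAct S A)) :
    ∃ j : matCoker B →ₗ[S] (Fin l → S), (∀ v, j (cokerProj B v) = matAct S A v) ∧
      Function.Injective j ∧ Function.Exact j (cokerProj A) := by
  obtain ⟨j, hj⟩ := exists_coker_lift B (matAct S A) h.apply_apply_eq_zero
  refine ⟨j, hj, ?_, fun v => ?_⟩
  · rw [injective_iff_map_eq_zero]
    intro x hx
    obtain ⟨v, rfl⟩ := cokerProj_surjective B x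
    rw [hj] at hx
    exact (cokerProj_exact B v).2 ((h v).1 hx)
  · rw [cokerProj_exact A v]
    constructor
    · rintro ⟨w, rfl⟩
      exact ⟨cokerProj B w, hj w⟩
    · rintro ⟨x, rfl⟩
      obtain ⟨w, rfl⟩ := cokerProj_surjective B x
      exact ⟨w, (hj w).symm⟩

variable {R : Type u} [CommRing R] [Algebra R S]

theorem isFlatSyzygy_of_equiv {i : ℕ} {X K L : Type u} [AddCommGroup X] [Module R X]
    [AddCommGroup K] [Module R K] [AddCommGroup L] [Module R L] (e : K ≃ₗ[R] L)
    (h : IsFlatSyzygy R i X K) : IsFlatSyzygy R i X L := by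
  cases i with
  | zero =>
    obtain ⟨e'⟩ := h
    exact ⟨e'.trans e⟩
  | succ i =>
    obtain ⟨N, G, _, _, _, _, f, g, h1, h2, h3, h4, h5⟩ := h
    refine ⟨N, G, _, _, _, _, f, e.toLinearMap ∘ₗ g, h1, h2, ?_, e.surjective.comp h4, h5⟩
    intro y
    rw [← h3 y]
    exact e.map_eq_zero_iff

theorem isFlatSyzygy_matCoker [Module.Flat R S] {r : ℕ → ℕ}
    {p : ∀ i, Matrix (Fin (r i)) (Fin (r (i + 1))) S}
    (hp : ∀ i, Function.Exact (matAct S (p (i + 1))) (matAct S (p i))) (j i : ℕ) :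
    IsFlatSyzygy R j (matCoker (p (i + j))) (matCoker (p i)) := by
  induction j generalizing i with
  | zero => exact ⟨LinearEquiv.refl R _⟩
  | succ j ih =>
    obtain ⟨k, -, hk, hk'⟩ := exists_cokerMap (hp i)
    refine ⟨matCoker (p (i + 1)), Fin (r i) → S, inferInstance, inferInstance, inferInstance,
      inferInstance, k.restrictScalars R, (cokerProj (p i)).restrictScalars R, flat_pi (r i),
      hk, hk', cokerProj_surjective _, ?_⟩
    have := ih (i + 1)
    have h2 : i + 1 + j = i + (j + 1) := by omega
    rwa [h2] at this

variable {C : Type u} [AddCommGroup C] [Module R C]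

/-- Maps out of a cokernel are the maps that vanish on the image. -/
theorem nonempty_homKerEquiv {l m : ℕ} (A : Matrix (Fin l) (Fin m) S) :
    Nonempty ((matCoker A →ₗ[R] C) ≃ₗ[R] homKer R C S A) := by
  have hmem : ∀ φ : matCoker A →ₗ[R] C,
      LinearMap.lcomp R C ((cokerProj A).restrictScalars R) φ ∈ homKer R C S A := by
    intro φ
    rw [mem_homKer]
    intro v
    have : cokerProj A (matAct S A v) = 0 := (cokerProj_exact A).apply_apply_eq_zero v
    change φ (cokerProj A (matAct S A v)) = 0
    rw [this, map_zero]
  refine ⟨LinearEquiv.ofBijective ((LinearMap.lcomp R C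
    ((cokerProj A).restrictScalars R)).codRestrict (homKer R C S A) hmem) ⟨?_, ?_⟩⟩
  · intro φ ψ h
    ext x
    obtain ⟨v, rfl⟩ := cokerProj_surjective A x
    exact LinearMap.congr_fun (congrArg Subtype.val h) v
  · rintro ⟨φ, hφ⟩
    rw [mem_homKer] at hφ
    obtain ⟨ψ, hψ⟩ := exists_coker_lift A φ hφ
    exact ⟨ψ, Subtype.ext (LinearMap.ext hψ)⟩

theorem HomExact.of_extVanish {l m n : ℕ} {A : Matrix (Fin l) (Fin m) S}
    {B : Matrix (Fin m) (Fin n) S} (h : Function.Exact (matAct S B) (matAct S A))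
    (hA : ExtVanish R C 0 (matCoker A)) : HomExact R C S A B := by
  intro φ hφ
  obtain ⟨ψ, hψ⟩ := exists_coker_lift B φ hφ
  obtain ⟨j, hj, hj', hj''⟩ := exists_cokerMap h
  obtain ⟨χ, hχ⟩ := hA.extend (j.restrictScalars R) ((cokerProj A).restrictScalars R) hj' hj''
    (cokerProj_surjective A) ψ
  refine ⟨χ, fun v => ?_⟩
  rw [← hψ v, ← hχ, ← hj]
  rfl

end Resolution

section Splice

/-- The ranks of the two-sided complex obtained by splicing two one-sided ones. -/
def spliceSize (u v : ℕ → ℕ) : ℤ → ℕ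
  | Int.ofNat 0 => v 0
  | Int.ofNat (k + 1) => u k
  | Int.negSucc j => v (j + 1)

/-- The two-sided complex obtained by splicing two one-sided ones along `D`. -/
def spliceMat {S : Type u} {u v : ℕ → ℕ} (P : ∀ i, Matrix (Fin (u i)) (Fin (u (i + 1))) S)
    (D : Matrix (Fin (v 0)) (Fin (u 0)) S) (Q : ∀ i, Matrix (Fin (v (i + 1))) (Fin (v i)) S) :
    ∀ i : ℤ, Matrix (Fin (spliceSize u v i)) (Fin (spliceSize u v (i + 1))) S
  | Int.ofNat 0 => D
  | Int.ofNat (k + 1) => P k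
  | Int.negSucc 0 => Q 0
  | Int.negSucc (j + 1) => Q (j + 1)

theorem spliceMat_rel {S : Type u} {u v : ℕ → ℕ} (P : ∀ i, Matrix (Fin (u i)) (Fin (u (i + 1))) S)
    (D : Matrix (Fin (v 0)) (Fin (u 0)) S) (Q : ∀ i, Matrix (Fin (v (i + 1))) (Fin (v i)) S)
    (Φ : ∀ {l m n : ℕ}, Matrix (Fin l) (Fin m) S → Matrix (Fin m) (Fin n) S → Prop)
    (hP : ∀ i, Φ (P i) (P (i + 1))) (hD : Φ D (P 0)) (hQ₀ : Φ (Q 0) D)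
    (hQ : ∀ i, Φ (Q (i + 1)) (Q i)) (i : ℤ) : Φ (spliceMat P D Q i) (spliceMat P D Q (i + 1)) := by
  match i with
  | Int.ofNat 0 => exact hD
  | Int.ofNat (k + 1) => exact hP k
  | Int.negSucc 0 => exact hQ₀
  | Int.negSucc 1 => exact hQ 0
  | Int.negSucc (j + 2) => exact hQ (j + 1)

end Splice

section Shift

variable {R : Type u} [CommRing R] {E : Type u} [AddCommGroup E] [Module R E] [IsLocalRing R]
  {e₀ : E}

theorem exists_lTensor_preimage (hE : IsMatlis R E e₀) {A B D W : Type u} [AddCommGroup A]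
    [Module R A] [AddCommGroup B] [Module R B] [AddCommGroup D]
    [Module R D] [AddCommGroup W] [Module R W] (f : A →ₗ[R] B) (g : B →ₗ[R] D)
    (p : D →ₗ[R] W) (hfg : Function.Exact f g) (hgp : Function.Exact g p)
    (hp : Function.Surjective p)
    (hW : ExtVanish R (E →ₗ[R] E) 0 W) (w : E ⊗[R] B) (hw : g.lTensor E w = 0) :
    ∃ w', f.lTensor E w' = w := by
  obtain ⟨K, _, _, i, hi, hip⟩ := exists_kernel p
  obtain ⟨g', hg'⟩ := exists_lift_of_exact i p hi hip g hgp.apply_apply_eq_zero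
  obtain rfl : i ∘ₗ g' = g := LinearMap.ext hg'
  have hsurj : Function.Surjective g' := by
    intro y
    obtain ⟨x, hx⟩ := (hgp (i y)).1 (hip.apply_apply_eq_zero y)
    exact ⟨x, hi hx⟩
  have hex : Function.Exact f g' := by
    intro x
    rw [← hfg x, LinearMap.comp_apply, map_eq_zero_iff i hi]
  have hinj := (LinearMap.lTensor_inj_iff_rTensor_inj E i).2
    (rTensor_injective_of_extend hE i (hW.extend i p hi hip hp))
  rw [LinearMap.lTensor_comp, LinearMap.comp_apply] at hw
  exact (lTensor_exact E hex hsurj w).1 (hinj (by rw [hw, map_zero]))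

variable {S : Type u} [CommRing S] [Algebra R S] {X : Type u} [AddCommGroup X] [Module S X]
  [Module R X] [IsScalarTower R S X]

/-- Precomposition with a matrix, as a map onto the cocycles of the next matrix. -/
theorem exists_homKer_map {C : Type u} [AddCommGroup C] [Module R C] {l m n : ℕ}
    {A : Matrix (Fin l) (Fin m) S} {B : Matrix (Fin m) (Fin n) S} (hAB : A * B = 0)
    (h : HomExact R C X A B) : ∃ g : ((Fin l → X) →ₗ[R] C) →ₗ[R] homKer R C X B,
      Function.Surjective g ∧ Function.Exact (homKer R C X A).subtype g := by
  have hmem : ∀ φ, LinearMap.lcomp R C ((matAct X A).restrictScalars R) φ ∈ homKer R C X B := by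
    intro φ
    rw [mem_homKer]
    intro v
    change φ (matAct X A (matAct X B v)) = 0
    rw [matAct_matAct_eq_zero hAB, map_zero]
  refine ⟨(LinearMap.lcomp R C ((matAct X A).restrictScalars R)).codRestrict _ hmem, ?_, ?_⟩
  · rintro ⟨φ, hφ⟩
    obtain ⟨ψ, hψ⟩ := h φ (mem_homKer.1 hφ)
    exact ⟨ψ, Subtype.ext (LinearMap.ext hψ)⟩
  · rw [LinearMap.exact_iff, LinearMap.ker_codRestrict, Submodule.range_subtype]
    rfl

theorem lcomp_matAct_exact {C : Type u} [AddCommGroup C] [Module R C] {l m n : ℕ}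
    {A : Matrix (Fin l) (Fin m) S} {B : Matrix (Fin m) (Fin n) S} (hAB : A * B = 0)
    (h : HomExact R C X A B) : Function.Exact
      (LinearMap.lcomp R C ((matAct X A).restrictScalars R))
      (LinearMap.lcomp R C ((matAct X B).restrictScalars R)) := by
  intro φ
  constructor
  · intro hφ
    obtain ⟨ψ, hψ⟩ := h φ (fun v => LinearMap.congr_fun hφ v)
    exact ⟨ψ, LinearMap.ext hψ⟩
  · rintro ⟨ψ, rfl⟩
    refine LinearMap.ext fun v => ?_
    change ψ (matAct X A (matAct X B v)) = 0
    rw [matAct_matAct_eq_zero hAB, map_zero]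

variable [IsNoetherianRing R]

theorem extVanish_homKer_of_far (hE : Module.Injective R E) [Module.Flat R X] {t : ℤ → ℕ}
    {B : ∀ i, Matrix (Fin (t i)) (Fin (t (i + 1))) S} (hB : ∀ i, B i * B (i + 1) = 0)
    (hex : ∀ i, HomExact R (E →ₗ[R] E) X (B i) (B (i + 1)))
    (hfar : ∀ k : ℕ, ExtVanish R (E →ₗ[R] E) 1 (homKer R (E →ₗ[R] E) X (B (k + 1)))) (i : ℤ) :
    ExtVanish R (E →ₗ[R] E) 0 (homKer R (E →ₗ[R] E) X (B i)) := by
  have step : ∀ i : ℤ, ExtVanish R (E →ₗ[R] E) 1 (homKer R (E →ₗ[R] E) X (B (i + 1))) →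
      ExtVanish R (E →ₗ[R] E) 0 (homKer R (E →ₗ[R] E) X (B i)) := by
    intro i hi
    obtain ⟨g, hg, hg'⟩ := exists_homKer_map (hB i) (hex i)
    have : Module.Flat R (Fin (t i) → X) := flat_pi _
    have : Module.Flat R ((Fin (t i) → X) →ₗ[R] E →ₗ[R] E) := flat_dual hE
    exact ExtVanish.left _ g (Submodule.subtype_injective _) hg' hg (ExtVanish.of_flat hE) hi
  have all : ∀ i : ℤ, ExtVanish R (E →ₗ[R] E) 1 (homKer R (E →ₗ[R] E) X (B i)) := by
    have down : ∀ n : ℕ, ExtVanish R (E →ₗ[R] E) 1 (homKer R (E →ₗ[R] E) X (B (1 - n))) := by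
      intro n
      induction n with
      | zero => exact hfar 0
      | succ n ih =>
        refine (step _ ?_).mono zero_le_one
        have : (1 - ((n + 1 : ℕ) : ℤ)) + 1 = 1 - n := by push_cast; ring
        rw [this]
        exact ih
    intro i
    obtain hi | hi := le_or_gt 1 i
    · obtain ⟨k, hk⟩ := Int.eq_ofNat_of_zero_le (sub_nonneg.2 hi)
      obtain rfl : i = k + 1 := by omega
      exact hfar k
    · obtain ⟨k, hk⟩ := Int.eq_ofNat_of_zero_le (sub_nonneg.2 hi.le)
      obtain rfl : i = 1 - k := by omega
      exact down k
  exact step i (all (i + 1))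

/-- Torsion functionals that vanish on boundaries extend. -/
theorem exists_factor_of_torsion (hE : IsMatlis R E e₀) {F₀ F₁ F₂ : Type u} [AddCommGroup F₀]
    [Module R F₀] [AddCommGroup F₁] [Module R F₁] [AddCommGroup F₂] [Module R F₂]
    [Module.Flat R F₁] [Module.Flat R F₂] (a : F₁ →ₗ[R] F₀) (b : F₂ →ₗ[R] F₁)
    (hex : ∀ w, (LinearMap.lcomp R (E →ₗ[R] E) b).lTensor E w = 0 →
      ∃ w', (LinearMap.lcomp R (E →ₗ[R] E) a).lTensor E w' = w)
    (φ : F₁ →ₗ[R] E) (hφ : ∀ v, φ (b v) = 0) (k : ℕ) (hk : ∀ c ∈ maximalIdeal R ^ k, c • φ = 0) :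
    ∃ ψ : F₀ →ₗ[R] E, ∀ v, ψ (a v) = φ v := by
  obtain ⟨w, hw⟩ := hE.mem_range_eval F₁ φ k hk
  obtain ⟨y, rfl⟩ := hex w (hE.eval_injective F₂ (by
    rw [matlisEval_naturality, hw, map_zero]
    exact LinearMap.ext hφ))
  refine ⟨matlisEval R E F₀ y, fun v => ?_⟩
  rw [← hw, matlisEval_naturality]
  rfl

theorem exists_lTensor_lcomp (hE : IsMatlis R E e₀) {a b c d e : ℕ}
    {A₀ : Matrix (Fin a) (Fin b) S} {A₁ : Matrix (Fin b) (Fin c) S} {A₂ : Matrix (Fin c) (Fin d) S}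
    {A₃ : Matrix (Fin d) (Fin e) S} (h₀ : A₀ * A₁ = 0) (h₁ : A₁ * A₂ = 0) (h₂ : A₂ * A₃ = 0)
    (hex₀ : HomExact R (E →ₗ[R] E) X A₀ A₁) (hex₁ : HomExact R (E →ₗ[R] E) X A₁ A₂)
    (hex₂ : HomExact R (E →ₗ[R] E) X A₂ A₃)
    (hext : ExtVanish R (E →ₗ[R] E) 0 (homKer R (E →ₗ[R] E) X A₃))
    (w : E ⊗[R] ((Fin b → X) →ₗ[R] E →ₗ[R] E))
    (hw : (LinearMap.lcomp R (E →ₗ[R] E) ((matAct X A₁).restrictScalars R)).lTensor E w = 0) :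
    ∃ w', (LinearMap.lcomp R (E →ₗ[R] E) ((matAct X A₀).restrictScalars R)).lTensor E w' = w := by
  obtain ⟨g, hg, hg'⟩ := exists_homKer_map h₂ hex₂
  refine exists_lTensor_preimage hE _ _ g (lcomp_matAct_exact h₀ hex₀) ?_ hg hext w hw
  intro φ
  rw [hg' φ, ← lcomp_matAct_exact h₁ hex₁ φ, Submodule.coe_subtype, Subtype.range_coe]
  rfl

theorem matExact_of_far [IsLocalRing S] [IsNoetherianRing S] [Module.Finite S X]
    (hRS : (maximalIdeal R).map (algebraMap R S) ≤ maximalIdeal S)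
    (hE : IsMatlis R E e₀) [Module.Flat R X] {t : ℤ → ℕ}
    {B : ∀ i, Matrix (Fin (t i)) (Fin (t (i + 1))) S} (hB : ∀ i, B i * B (i + 1) = 0)
    (hex : ∀ i, HomExact R (E →ₗ[R] E) X (B i) (B (i + 1)))
    (hfar : ∀ k : ℕ, ExtVanish R (E →ₗ[R] E) 1 (homKer R (E →ₗ[R] E) X (B (k + 1)))) (i : ℤ) :
    MatExact X (B i) (B (i + 1)) := by
  intro v hv
  by_contra hne
  let N : Submodule S (Fin (t (i + 1)) → X) := LinearMap.range (matAct X (B (i + 1)))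
  let I : Ideal S := (maximalIdeal R).map (algebraMap R S)
  obtain ⟨k, hk⟩ : ∃ k : ℕ, N.mkQ v ∉ (I ^ k • ⊤ : Submodule S ((Fin (t (i + 1)) → X) ⧸ N)) := by
    by_contra! hall
    have hkrull := Ideal.iInf_pow_smul_eq_bot_of_isLocalRing
      (M := (Fin (t (i + 1)) → X) ⧸ N) I (fun h => Ideal.IsPrime.ne_top'
        (top_le_iff.1 (h.ge.trans hRS)))
    have hmem : N.mkQ v ∈ (⨅ k : ℕ, I ^ k • ⊤ : Submodule S ((Fin (t (i + 1)) → X) ⧸ N)) :=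
      (Submodule.mem_iInf _).2 hall
    rw [hkrull, Submodule.mem_bot, ← LinearMap.mem_ker, Submodule.ker_mkQ] at hmem
    exact hne hmem
  have hsmul : ∀ y ∈ (maximalIdeal R ^ k • ⊤ : Submodule R (Fin (t (i + 1)) → X)),
      N.mkQ y ∈ (I ^ k • ⊤ : Submodule S ((Fin (t (i + 1)) → X) ⧸ N)) := by
    intro y hy
    induction hy using Submodule.smul_induction_on' with
    | smul a ha y _ =>
      rw [← algebraMap_smul S a y, map_smul]
      refine Submodule.smul_mem_smul ?_ trivial
      rw [← Ideal.map_pow]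
      exact Ideal.mem_map_of_mem _ ha
    | add a _ b _ ha hb => rw [map_add]; exact add_mem ha hb
  obtain ⟨φ, hφ, hφv⟩ := hE.exists_separating
    (N.restrictScalars R ⊔ maximalIdeal R ^ k • (⊤ : Submodule R (Fin (t (i + 1)) → X))) v (by
      intro hmem
      obtain ⟨a, ha, b, hb, rfl⟩ := Submodule.mem_sup.1 hmem
      apply hk
      have : N.mkQ a = 0 := by
        rw [← LinearMap.mem_ker, Submodule.ker_mkQ]; exact ha
      rw [map_add, this, zero_add]
      exact hsmul b hb)
  have hfl : ∀ n, Module.Flat R (Fin n → X) := fun n => flat_pi n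
  obtain ⟨ψ, hψ⟩ := exists_factor_of_torsion hE
    ((matAct X (B i)).restrictScalars R) ((matAct X (B (i + 1))).restrictScalars R)
    (exists_lTensor_lcomp hE (hB i) (hB (i + 1)) (hB (i + 1 + 1)) (hex i) (hex (i + 1))
      (hex (i + 1 + 1)) (extVanish_homKer_of_far hE.inj hB hex hfar (i + 1 + 1 + 1))) φ
    (fun w => hφ _ (Submodule.mem_sup_left ⟨w, rfl⟩)) k (fun a ha => by
      refine LinearMap.ext fun y => ?_
      rw [LinearMap.smul_apply, ← map_smul]
      exact hφ _ (Submodule.mem_sup_right (Submodule.smul_mem_smul ha trivial)))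
  exact hφv (by rw [← hψ, LinearMap.restrictScalars_apply, hv, map_zero])

end Shift

section GorensteinFlat

variable {S : Type u} [CommRing S]

theorem piScalarRight_lTensor_matAct (I : Type u) [AddCommGroup I] [Module S I] {m n : ℕ}
    (A : Matrix (Fin m) (Fin n) S) (x : I ⊗[S] (Fin n → S)) :
    TensorProduct.piScalarRight S S I (Fin m) (LinearMap.lTensor I (matAct S A) x) =
      matAct I A (TensorProduct.piScalarRight S S I (Fin n) x) := by
  induction x with
  | zero => simp only [map_zero]
  | add x y hx hy => simp only [map_add, hx, hy]
  | tmul i v =>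
    ext j
    simp [Finset.sum_smul, smul_smul]

theorem MatExact.lTensor {I : Type u} [AddCommGroup I] [Module S I] {l m n : ℕ}
    {A : Matrix (Fin l) (Fin m) S} {B : Matrix (Fin m) (Fin n) S} (h : MatExact I A B)
    (hAB : A * B = 0) :
    Function.Exact (LinearMap.lTensor I (matAct S B)) (LinearMap.lTensor I (matAct S A)) := by
  intro x
  constructor
  · intro hx
    obtain ⟨w, hw⟩ := h (TensorProduct.piScalarRight S S I (Fin m) x) (by
      rw [← piScalarRight_lTensor_matAct, hx, map_zero])
    refine ⟨(TensorProduct.piScalarRight S S I (Fin n)).symm w, ?_⟩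
    apply (TensorProduct.piScalarRight S S I (Fin m)).injective
    rw [piScalarRight_lTensor_matAct, LinearEquiv.apply_symm_apply, hw]
  · rintro ⟨y, rfl⟩
    apply (TensorProduct.piScalarRight S S I (Fin l)).injective
    rw [piScalarRight_lTensor_matAct, piScalarRight_lTensor_matAct, matAct_matAct_eq_zero hAB,
      map_zero]

theorem MatExact.of_transpose {I : Type u} [AddCommGroup I] [Module S I]
    (hI : Module.Injective S I) {l m n : ℕ} {A : Matrix (Fin l) (Fin m) S}
    {B : Matrix (Fin m) (Fin n) S} (h : MatExact S B.transpose A.transpose) : MatExact I A B := by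
  have := MatExact.transpose (T := I) h LinearMap.id Function.surjective_id
    (fun s hs t => by rw [LinearMap.id_apply] at hs; rw [hs, zero_smul])
    (fun α g hg => inj_factor hI α g hg)
  rwa [Matrix.transpose_transpose, Matrix.transpose_transpose] at this

/-- The images in a totally acyclic complex of finite free modules are Gorenstein flat. -/
theorem isGorensteinFlat_of_matExact {t : ℤ → ℕ} (B : ∀ i, Matrix (Fin (t i)) (Fin (t (i + 1))) S)
    (hB : ∀ i, B i * B (i + 1) = 0) (h : ∀ i, MatExact S (B i) (B (i + 1)))
    (h' : ∀ i, MatExact S (B (i + 1)).transpose (B i).transpose) {Q : Type u} [AddCommGroup Q]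
    [Module S Q] (e : Q ≃ₗ[S] LinearMap.range (matAct S (B 0))) : IsGorensteinFlat S Q :=
  ⟨{ F := fun i => Fin (t i) → S
     d := fun i => matAct S (B i)
     flat := fun _ => inferInstance
     exact := fun i => (h i).exact (hB i)
     exact_tensor := fun _ _ _ hI i => (MatExact.of_transpose hI (h' i)).lTensor (hB i)
     iso := ⟨e⟩ }⟩

theorem IsGorensteinFlat.of_equiv {Q Q' : Type u} [AddCommGroup Q] [Module S Q] [AddCommGroup Q']
    [Module S Q'] (e : Q ≃ₗ[S] Q') (h : IsGorensteinFlat S Q) : IsGorensteinFlat S Q' := by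
  obtain ⟨w⟩ := h
  let _ := w.instAdd
  let _ := w.instMod
  exact ⟨{ w with iso := w.iso.map fun e' => e.symm.trans e' }⟩

theorem IsGorensteinFlat.of_flat (G : Type u) [AddCommGroup G] [Module S G] [Module.Flat S G] :
    IsGorensteinFlat S G := by
  have hflat : Module.Flat S (G × G) :=
    have := flat_pi (R := S) (Y := G) 2
    Module.Flat.of_linearEquiv (LinearEquiv.finTwoArrow S G).symm
  let d : G × G →ₗ[S] G × G := LinearMap.inl S G G ∘ₗ LinearMap.snd S G G
  let s : G × G →ₗ[S] G × G := LinearMap.inr S G G ∘ₗ LinearMap.fst S G G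
  have hd : d ∘ₗ d = 0 := by ext <;> simp [d]
  have hs : d ∘ₗ s + s ∘ₗ d = LinearMap.id := by ext <;> simp [d, s]
  have hex : Function.Exact d d := by
    intro x
    refine ⟨fun hx => ⟨s x, ?_⟩, ?_⟩
    · have := LinearMap.congr_fun hs x
      simpa [hx] using this
    · rintro ⟨y, rfl⟩
      exact LinearMap.congr_fun hd y
  refine ⟨{ F := fun _ => G × G
            d := fun _ => d
            flat := fun _ => hflat
            exact := fun _ => hex
            exact_tensor := fun I _ _ _ _ x => ⟨fun hx => ⟨LinearMap.lTensor I s x, ?_⟩, ?_⟩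
            iso := ?_ }⟩
  · have := congrArg (fun g => LinearMap.lTensor I g x) hs
    simpa [LinearMap.lTensor_add, LinearMap.lTensor_comp, hx] using this
  · rintro ⟨y, rfl⟩
    rw [← LinearMap.lTensor_comp_apply, hd, LinearMap.lTensor_zero, LinearMap.zero_apply]
  · have hr : LinearMap.range d = LinearMap.range (LinearMap.inl S G G) :=
      LinearMap.range_comp_of_range_eq_top _ (LinearMap.range_eq_top.2 Prod.snd_surjective)
    rw [hr]
    exact ⟨LinearEquiv.ofInjective _ LinearMap.inl_injective⟩

theorem gfdLE.of_equiv {n : ℕ} {M M' : Type u} [AddCommGroup M] [Module S M] [AddCommGroup M']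
    [Module S M'] (e : M ≃ₗ[S] M') (h : gfdLE S n M) : gfdLE S n M' := by
  induction n generalizing M M' with
  | zero => exact IsGorensteinFlat.of_equiv e h
  | succ n ih =>
    obtain ⟨c, hc⟩ := h
    refine ⟨⟨c.Q, e.toLinearMap ∘ₗ c.π, c.gflat, e.surjective.comp c.surj⟩, ?_⟩
    refine ih (LinearEquiv.ofEq _ _ ?_) hc
    exact (LinearEquiv.ker_comp e c.π).symm

theorem gfdLE_matCoker {r : ℕ → ℕ} {p : ∀ i, Matrix (Fin (r i)) (Fin (r (i + 1))) S}
    (hp : ∀ i, Function.Exact (matAct S (p (i + 1))) (matAct S (p i))) (j i : ℕ)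
    (h : IsGorensteinFlat S (matCoker (p (i + j)))) : gfdLE S j (matCoker (p i)) := by
  induction j generalizing i with
  | zero => exact h
  | succ j ih =>
    obtain ⟨k, -, hk, hk'⟩ := exists_cokerMap (hp i)
    refine ⟨⟨Fin (r i) → S, cokerProj (p i), IsGorensteinFlat.of_flat _, cokerProj_surjective _⟩,
      ?_⟩
    refine gfdLE.of_equiv ?_ (ih (i + 1) (by rwa [show i + 1 + j = i + (j + 1) by omega]))
    exact (LinearEquiv.ofInjective k hk).trans (LinearEquiv.ofEq _ _ hk'.linearMap_ker_eq.symm)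

end GorensteinFlat

section FlatBaseChange

variable {R S : Type u} [CommRing R] [CommRing S] [IsLocalRing R] [IsLocalRing S]
  [IsNoetherianRing R] [IsNoetherianRing S] [Algebra R S] [Module.Flat R S]

section Duality

variable {E : Type u} [AddCommGroup E] [Module R E] {e₀ : E} {X : Type u} [AddCommGroup X]
  [Module S X] [Module R X] [IsScalarTower R S X] [Module.Flat R X] {q : S →ₗ[S] X}

theorem smul_eq_zero_of_mem_ker (hq : Function.Surjective q) {s : S} (hs : s ∈ LinearMap.ker q)
    (x : X) : s • x = 0 := by
  obtain ⟨a, rfl⟩ := hq x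
  rw [← map_smul, smul_eq_mul, mul_comm, ← smul_eq_mul, map_smul, LinearMap.mem_ker.1 hs, smul_zero]

theorem matExact_transpose_of_homExact (hE : IsMatlis R E e₀)
    (hRS : (maximalIdeal R).map (algebraMap R S) ≤ maximalIdeal S) (hq : Function.Surjective q)
    (hJ : maximalIdeal S = (maximalIdeal R).map (algebraMap R S) ⊔ LinearMap.ker q)
    {l m n : ℕ} {A : Matrix (Fin l) (Fin m) S} {B : Matrix (Fin m) (Fin n) S}
    (h : HomExact R (E →ₗ[R] E) X A B) : MatExact X B.transpose A.transpose := by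
  have hker := fun s hs => smul_eq_zero_of_mem_ker (q := q) hq (s := s) hs
  have : Module.Finite S X := Module.Finite.of_surjective q hq
  have : Nontrivial X := by
    refine ⟨q 1, 0, fun h1 => ?_⟩
    have : (1 : S) ∈ maximalIdeal S := hJ ▸ Ideal.mem_sup_right (LinearMap.mem_ker.2 h1)
    exact (maximalIdeal S).ne_top_iff_one.1 (IsLocalRing.maximalIdeal.isMaximal S).ne_top this
  have : Nontrivial E := ⟨e₀, 0, hE.ne⟩
  have : Nontrivial (X ⊗[R] E) := tensor_nontrivial hRS
  exact MatExact.transpose_of_cogenerator (T := X ⊗[R] E) (h.matExact hE) q hq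
    (fun s hs => tensor_smul_eq_zero (hker s hs))
    (exists_cogenerate (J := LinearMap.ker q) (injective_tensor_of_flat hE.inj) hJ.le hRS
      (tensor_torsion hE) (fun s hs => tensor_smul_eq_zero (hker s hs))
      (fun s hs v => funext fun i => hker s hs (v i)))

theorem homExact_of_matExact_transpose (hE : IsMatlis R E e₀)
    (hRS : (maximalIdeal R).map (algebraMap R S) ≤ maximalIdeal S) (hq : Function.Surjective q)
    (hJ : maximalIdeal S = (maximalIdeal R).map (algebraMap R S) ⊔ LinearMap.ker q)
    {l m n : ℕ} {A : Matrix (Fin l) (Fin m) S} {B : Matrix (Fin m) (Fin n) S}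
    (h : MatExact X B.transpose A.transpose) : HomExact R (E →ₗ[R] E) X A B := by
  have hker := fun s hs => smul_eq_zero_of_mem_ker (q := q) hq (s := s) hs
  have : Module.Finite S X := Module.Finite.of_surjective q hq
  have h' := MatExact.transpose (T := X ⊗[R] E) h q hq
    (fun s hs => tensor_smul_eq_zero (hker s hs))
    (exists_extension (J := LinearMap.ker q) (injective_tensor_of_flat hE.inj) hJ.le hRS
      (tensor_torsion hE) (fun s hs => tensor_smul_eq_zero (hker s hs))
      (fun s hs v => funext fun i => hker s hs (v i)))
  rw [Matrix.transpose_transpose, Matrix.transpose_transpose] at h'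
  exact h'.homExact hE.inj

end Duality

theorem matExact_of_exact {l m n : ℕ} {A : Matrix (Fin l) (Fin m) S} {B : Matrix (Fin m) (Fin n) S}
    (h : Function.Exact (matAct S B) (matAct S A)) : MatExact S A B :=
  fun v hv => (h v).1 hv

/-- A syzygy far out in a finite free resolution is Gorenstein flat once the resolution is
well-behaved on the quotient by a regular sequence generating the fiber. -/
theorem isGorensteinFlat_matCoker {E : Type u} [AddCommGroup E] [Module R E] {e₀ : E}
    (hE : IsMatlis R E e₀) (hRS : (maximalIdeal R).map (algebraMap R S) ≤ maximalIdeal S)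
    {X : Type u} [AddCommGroup X] [Module S X] [Module R X] [IsScalarTower R S X] [Module.Flat R X]
    {q : S →ₗ[S] X} (hq : Function.Surjective q)
    (hJ : maximalIdeal S = (maximalIdeal R).map (algebraMap R S) ⊔ LinearMap.ker q) {d : ℕ}
    (ht : ExactTransfer R S (E →ₗ[R] E) d S X) {u : ℕ → ℕ}
    (P : ∀ i, Matrix (Fin (u i)) (Fin (u (i + 1))) S)
    (hP : ∀ i, Function.Exact (matAct S (P (i + 1))) (matAct S (P i)))
    (hhom : ∀ i, HomExact R (E →ₗ[R] E) X (P i) (P (i + 1)))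
    (hfar : ∀ i, ExtVanish R (E →ₗ[R] E) 1 (homKer R (E →ₗ[R] E) X (P i))) :
    IsGorensteinFlat S (matCoker (P 0)) := by
  have : Module.Finite S X := Module.Finite.of_surjective q hq
  have hP0 : ∀ i, P i * P (i + 1) = 0 := fun i => mul_eq_zero_of_exact (hP i)
  obtain ⟨s, D, Q, hD, hQ₀, hQ⟩ := exists_matrix_resolution (matAct S (P 0).transpose)
  let B := spliceMat P D.transpose (fun i => (Q i).transpose)
  have htr : ∀ {l m n : ℕ} {A : Matrix (Fin l) (Fin m) S} {B : Matrix (Fin m) (Fin n) S},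
      A * B = 0 → B.transpose * A.transpose = 0 := fun h => by
    rw [← Matrix.transpose_mul, h, Matrix.transpose_zero]
  have hD0 : D.transpose * P 0 = 0 := by
    rw [← Matrix.transpose_transpose (P 0)]; exact htr (mul_eq_zero_of_exact hD)
  have hB : ∀ i, B i * B (i + 1) = 0 :=
    spliceMat_rel P D.transpose (fun i => (Q i).transpose) (fun A B => A * B = 0) hP0 hD0
      (htr (mul_eq_zero_of_exact hQ₀)) (fun i => htr (mul_eq_zero_of_exact (hQ i)))
  have hB' : ∀ i, MatExact S (B (i + 1)).transpose (B i).transpose := by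
    refine spliceMat_rel P D.transpose (fun i => (Q i).transpose)
      (fun A B => MatExact S B.transpose A.transpose) (fun i => ?_) ?_ ?_ (fun i => ?_)
    · exact ht.down _ _ (htr (hP0 i)) (matExact_transpose_of_homExact hE hRS hq hJ (hhom i))
    · exact matExact_of_exact hD
    · exact matExact_of_exact hQ₀
    · exact matExact_of_exact (hQ i)
  have hhom' : ∀ i, HomExact R (E →ₗ[R] E) X (B i) (B (i + 1)) := fun i =>
    homExact_of_matExact_transpose hE hRS hq hJ (ht.up _ B hB hB' i)
  have hB'' : ∀ i, MatExact S (B i) (B (i + 1)) := fun i =>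
    ht.down _ _ (hB i) (matExact_of_far hRS hE hB hhom' hfar i)
  have hDP : Function.Exact (matAct S (P 0)) (matAct S D.transpose) := (hB'' 0).exact hD0
  obtain ⟨j, hj, hj', -⟩ := exists_cokerMap hDP
  refine isGorensteinFlat_of_matExact B hB hB'' hB'
    ((LinearEquiv.ofInjective j hj').trans (LinearEquiv.ofEq _ _ ?_))
  ext v
  constructor
  · rintro ⟨x, rfl⟩
    obtain ⟨w, rfl⟩ := cokerProj_surjective _ x
    exact ⟨w, (hj w).symm⟩
  · rintro ⟨w, rfl⟩
    exact ⟨cokerProj _ w, hj w⟩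

/-- Gorenstein flat dimension along a flat local homomorphism whose closed fiber is regular. -/
theorem gfdLE_of_regularMod (hRS : (maximalIdeal R).map (algebraMap R S) ≤ maximalIdeal S)
    (xs : List S) (hxs : ∀ x ∈ xs, x ∈ maximalIdeal S)
    (hreg : RegularMod xs ((maximalIdeal R).map (algebraMap R S)))
    (hspan : maximalIdeal S = (maximalIdeal R).map (algebraMap R S) ⊔ Ideal.ofList xs)
    {M : Type u} [AddCommGroup M] [Module S M] [Module R M] [IsScalarTower R S M]
    [Module.Finite S M] {n : ℕ} (h : gfdLE R n M) : gfdLE S (n + xs.length) M := by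
  obtain ⟨E, _, _, e₀, hE⟩ := exists_isMatlis R
  obtain ⟨r, p, hp, ⟨e⟩⟩ := exists_free_resolution (S := S) (P := M)
  obtain ⟨X, _, _, _, _, q, _, hq, hk, ht⟩ := exists_exactTransfer hE.inj hRS xs hxs S LinearMap.id
    Function.surjective_id (by rwa [LinearMap.ker_id, bot_sup_eq])
  rw [LinearMap.ker_id, bot_sup_eq] at hk
  have hp0 : ∀ i, p i * p (i + 1) = 0 := fun i => mul_eq_zero_of_exact (hp i)
  have hbound : ∀ i, n ≤ i → ExtVanish R (E →ₗ[R] E) 0 (matCoker (p i)) ∧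
      ExtVanish R (E →ₗ[R] E) 1 (matCoker (p i) →ₗ[R] E →ₗ[R] E) := fun i hi =>
    h.syzygyBound hE i hi _ (isFlatSyzygy_of_equiv (e.restrictScalars R)
      (by
        have := isFlatSyzygy_matCoker (R := R) hp i 0
        rwa [Nat.zero_add] at this))
  have hhom : ∀ i, n ≤ i → HomExact R (E →ₗ[R] E) S (p i) (p (i + 1)) := fun i hi =>
    HomExact.of_extVanish (hp i) (hbound i hi).1
  have hfar : ∀ i, n ≤ i → ExtVanish R (E →ₗ[R] E) 1 (homKer R (E →ₗ[R] E) S (p i)) :=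
    fun i hi => (nonempty_homKerEquiv (p i)).elim fun e => (hbound i hi).2.of_equiv e
  refine gfdLE.of_equiv e (gfdLE_matCoker hp (n + xs.length) 0 ?_)
  rw [Nat.zero_add]
  exact isGorensteinFlat_matCoker hE hRS hq (hk ▸ hspan) ht (u := fun k => r (n + xs.length + k))
    (fun k => p (n + xs.length + k)) (fun k => hp _)
    (fun k => ht.hom r p hp0 n hhom _ (Nat.le_add_right _ _))
    (fun k => ht.far r p hp0 n hhom hfar _ (Nat.le_add_right _ _))

end FlatBaseChange

theorem gfd_add_embDim_le {R S : Type u} [CommRing R] [CommRing S] [IsLocalRing R] [IsLocalRing S]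
    [IsNoetherianRing R] [IsNoetherianRing S] [Algebra R S] [Module.Flat R S]
    (hRS : (maximalIdeal R).map (algebraMap R S) ≤ maximalIdeal S)
    (hfib : IsRegularLocal (S ⧸ (maximalIdeal R).map (algebraMap R S)))
    (M : Type u) [AddCommGroup M] [Module S M] [Module R M] [IsScalarTower R S M]
    [Module.Finite S M] : gfd S M + embDim R ≤ gfd R M + embDim S := by
  obtain ⟨-, _, rs, hrs, hspan⟩ := hfib
  obtain ⟨xs, hlen, hxs, hreg, hJ, -⟩ := exists_regularMod hrs hspan
  have hdim := embDim_add_length_le hRS hrs hspan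
  rcases Set.eq_empty_or_nonempty {n : ℕ | gfdLE R n M} with hempty | hne
  · have : gfd R M = ⊤ := by rw [gfd, hempty, Set.image_empty, sInf_empty]
    rw [this, top_add]
    exact le_top
  · obtain ⟨n, hn, hgfd⟩ := csInf_mem (hne.image ((↑) : ℕ → ℕ∞))
    have hle : gfd S M ≤ ((n + xs.length : ℕ) : ℕ∞) :=
      sInf_le ⟨_, gfdLE_of_regularMod hRS xs hxs hreg hJ hn, rfl⟩
    calc gfd S M + embDim R ≤ ((n + xs.length : ℕ) : ℕ∞) + embDim R := by gcongr
      _ ≤ (n : ℕ∞) + embDim S := by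
        exact_mod_cast (by omega : n + xs.length + embDim R ≤ n + embDim S)
      _ = gfd R M + embDim S := by rw [gfd, hgfd]

end

/-- If `f : R → S` is a flat local homomorphism of complete noetherian local rings with
regular closed fiber `S/mS` and `M` is a finitely generated `S`-module, then
`Gfd_S M ≤ Gfd_R M + edim S - edim R`. -/
theorem gfd_le_gfd_add_embDim_sub {R S : Type u} [CommRing R] [CommRing S]
    [IsLocalRing R] [IsLocalRing S] [IsNoetherianRing R] [IsNoetherianRing S]
    (f : R →+* S) (hloc : IsLocalHom f) (hflat : f.Flat)
    (hRc : IsAdicComplete (IsLocalRing.maximalIdeal R) R)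
    (hSc : IsAdicComplete (IsLocalRing.maximalIdeal S) S)
    (hfib : IsRegularLocal (S ⧸ (IsLocalRing.maximalIdeal R).map f))
    (M : Type u) [AddCommGroup M] [Module S M] [Module.Finite S M] :
    gfd S M + embDim R ≤ gfdAlong f M + embDim S := by
  let _ : Algebra R S := f.toAlgebra
  let _ : Module R M := Module.compHom M f
  have : Module.Flat R S := hflat
  have : IsScalarTower R S M := ⟨fun r s m => mul_smul (f r) s m⟩
  exact gfd_add_embDim_le (((IsLocalRing.local_hom_TFAE f).out 0 2).1 hloc) hfib M
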